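/- The inclusion of the full subcategory of S-cofibrant flows into the category of flows induces an equivalence of categories between the category of S-cofibrant flows with morphisms taken up to S-homotopy and the localization of the category Flow with respect to the class of weak S-homotopy equivalences. -/

import Mathlib

open CategoryTheory

namespace Gaucher

/-- Helper: any map out of an empty space is continuous. -/
theorem continuous_of_isEmpty {α β : Type*} [TopologicalSpace α] [TopologicalSpace β]
    [IsEmpty α] (f : α → β) : Continuous f :=
  ⟨fun s _ => by rw [Set.eq_empty_of_isEmpty (f ⁻¹' s)]; exact isOpen_empty⟩

/-- Helper: fibers of constant maps are open. -/
theorem isOpen_preimage_const {α β : Type*} [TopologicalSpace α] (b a : β) :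
    IsOpen ((fun _ : α => b) ⁻¹' {a}) := by
  rcases eq_or_ne b a with h | h
  · rw [Set.preimage_const_of_mem (by simpa using h)]; exact isOpen_univ
  · rw [Set.preimage_const_of_notMem (by simpa using h)]; exact isOpen_empty

/-- A flow (Gaucher): a set of states (with the discrete topology), a topological
space of (non-constant) execution paths, source and target maps which are continuous
(i.e. have open fibers, the state set being discrete), and a continuous, associative
partial composition defined on composable pairs of paths. -/
structure Flow : Type 1 where
  /-- the `0`-skeleton, i.e. the set of states -/
  State : Type
  /-- the space of non-constant execution paths -/
  Path : Type
  [topPath : TopologicalSpace Path]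
  /-- source map -/
  s : Path → State
  /-- target map -/
  t : Path → State
  isOpen_preimage_s : ∀ a : State, IsOpen (s ⁻¹' {a})
  isOpen_preimage_t : ∀ a : State, IsOpen (t ⁻¹' {a})
  /-- composition of composable paths -/
  comp : ∀ x y : Path, t x = s y → Path
  continuous_comp : Continuous (fun p : { p : Path × Path // t p.1 = s p.2 } =>
    comp p.1.1 p.1.2 p.2)
  s_comp : ∀ x y h, s (comp x y h) = s x
  t_comp : ∀ x y h, t (comp x y h) = t y
  comp_assoc : ∀ (x y z : Path) (hxy : t x = s y) (hyz : t y = s z)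
    (h₁ : t x = s (comp y z hyz)) (h₂ : t (comp x y hxy) = s z),
    comp x (comp y z hyz) h₁ = comp (comp x y hxy) z h₂

attribute [instance] Flow.topPath

/-- The state set of a flow carries the discrete topology. -/
instance Flow.topState (X : Flow) : TopologicalSpace X.State := ⊥

instance (X : Flow) : DiscreteTopology X.State := ⟨rfl⟩

/-- A morphism of flows: a map preserving states, paths, sources, targets and
composition, continuous on the path spaces (continuity on the discrete state part
being automatic). -/
structure FlowHom (X Y : Flow) : Type where
  toFun0 : X.State → Y.State
  toFunP : X.Path → Y.Path
  continuous_toFunP : Continuous toFunP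
  s_map : ∀ x, Y.s (toFunP x) = toFun0 (X.s x)
  t_map : ∀ x, Y.t (toFunP x) = toFun0 (X.t x)
  comp_map : ∀ x y (h : X.t x = X.s y) (h' : Y.t (toFunP x) = Y.s (toFunP y)),
    toFunP (X.comp x y h) = Y.comp (toFunP x) (toFunP y) h'

theorem FlowHom.ext {X Y : Flow} {f g : FlowHom X Y}
    (h0 : f.toFun0 = g.toFun0) (hP : f.toFunP = g.toFunP) : f = g := by
  cases f; cases g; cases h0; cases hP; rfl

/-- The identity morphism of flows. -/
def FlowHom.id (X : Flow) : FlowHom X X where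
  toFun0 := _root_.id
  toFunP := _root_.id
  continuous_toFunP := continuous_id
  s_map _ := rfl
  t_map _ := rfl
  comp_map _ _ _ _ := rfl

/-- Composition of morphisms of flows (`g.comp f` is `g ∘ f`). -/
def FlowHom.comp {X Y Z : Flow} (g : FlowHom Y Z) (f : FlowHom X Y) : FlowHom X Z where
  toFun0 := g.toFun0 ∘ f.toFun0
  toFunP := g.toFunP ∘ f.toFunP
  continuous_toFunP := g.continuous_toFunP.comp f.continuous_toFunP
  s_map x := by simp only [Function.comp_apply, g.s_map, f.s_map]
  t_map x := by simp only [Function.comp_apply, g.t_map, f.t_map]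
  comp_map x y h h' := by
    have hY : Y.t (f.toFunP x) = Y.s (f.toFunP y) := by
      rw [f.t_map, f.s_map, h]
    show g.toFunP (f.toFunP (X.comp x y h)) = _
    rw [f.comp_map x y h hY, g.comp_map _ _ hY h']
    rfl

/-- The category `Flow` of flows. -/
instance : Category Flow where
  Hom := FlowHom
  id := FlowHom.id
  comp f g := g.comp f
  id_comp f := FlowHom.ext rfl rfl
  comp_id f := FlowHom.ext rfl rfl
  assoc f g h := FlowHom.ext rfl rfl

theorem FlowHom.comp_assoc {W X Y Z : Flow} (h : FlowHom Y Z) (g : FlowHom X Y)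
    (f : FlowHom W X) : (h.comp g).comp f = h.comp (g.comp f) :=
  FlowHom.ext rfl rfl

/-- The flow `Glob Z` associated to a topological space `Z`: two states `0` and `1`,
path space `Z`, every path going from `0` to `1` (no two paths are composable). -/
def Glob (Z : Type) [TopologicalSpace Z] : Flow where
  State := Fin 2
  Path := Z
  s := fun _ => 0
  t := fun _ => 1
  isOpen_preimage_s := fun a => isOpen_preimage_const _ a
  isOpen_preimage_t := fun a => isOpen_preimage_const _ a
  comp := fun _ _ h => absurd (show (1 : Fin 2) = 0 from h) (by decide)
  continuous_comp := by
    haveI : IsEmpty { p : Z × Z // (fun _ : Z => (1 : Fin 2)) p.1 = (fun _ : Z => (0 : Fin 2)) p.2 } :=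
      ⟨fun p => absurd (show (1 : Fin 2) = 0 from p.2) (by decide)⟩
    exact continuous_of_isEmpty _
  s_comp := fun x y h => absurd (show (1 : Fin 2) = 0 from h) (by decide)
  t_comp := fun x y h => absurd (show (1 : Fin 2) = 0 from h) (by decide)
  comp_assoc := fun x y z hxy => absurd (show (1 : Fin 2) = 0 from hxy) (by decide)

/-- Functoriality of `Glob`. -/
def Glob.map {Z W : Type} [TopologicalSpace Z] [TopologicalSpace W] (f : C(Z, W)) :
    FlowHom (Glob Z) (Glob W) where
  toFun0 := _root_.id
  toFunP := f
  continuous_toFunP := f.continuous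
  s_map _ := rfl
  t_map _ := rfl
  comp_map x y h := absurd (show (1 : Fin 2) = 0 from h) (by decide)

/-- The directed segment `I⃗` is `Glob` of a one-point space. -/
def dirSegment : Flow := Glob PUnit

/-- The flow with exactly one state and no non-constant execution path. -/
def pointFlow : Flow where
  State := PUnit
  Path := Empty
  s := fun e => e.elim
  t := fun e => e.elim
  isOpen_preimage_s := fun a => by
    rw [Set.eq_empty_of_isEmpty (_ ⁻¹' {a})]; exact isOpen_empty
  isOpen_preimage_t := fun a => by
    rw [Set.eq_empty_of_isEmpty (_ ⁻¹' {a})]; exact isOpen_empty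
  comp := fun x _ _ => x.elim
  continuous_comp := continuous_of_isEmpty _
  s_comp := fun x => x.elim
  t_comp := fun x => x.elim
  comp_assoc := fun x => x.elim

-- PART B (appended after part A) : S-homotopy, weak homotopy equivalences

/-- Two morphisms of flows `f g : X → Y` are S-homotopic: there is a continuous map
`H : (X⁰ ⊔ ℙX) × [0,1] → Y⁰ ⊔ ℙY` such that every `H(-,u)` is a morphism of flows,
`H(-,0) = f` and `H(-,1) = g`.  (Continuity of `H` on the two summands `ℙX × [0,1]`
and `X⁰ × [0,1]` — the state sets carrying the discrete topology — is exactly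
continuity of the two maps below.) -/
def SHomotopy {X Y : Flow} (f g : FlowHom X Y) : Prop :=
  ∃ F : unitInterval → FlowHom X Y,
    F 0 = f ∧ F 1 = g ∧
    Continuous (fun p : X.Path × unitInterval => (F p.2).toFunP p.1) ∧
    Continuous (fun p : X.State × unitInterval => (F p.2).toFun0 p.1)

/-- A morphism of flows is an S-homotopy equivalence if it admits an inverse up to
S-homotopy. -/
def IsSHomotopyEquiv {X Y : Flow} (f : FlowHom X Y) : Prop :=
  ∃ g : FlowHom Y X, SHomotopy (f.comp g) (FlowHom.id Y) ∧ SHomotopy (g.comp f) (FlowHom.id X)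

/-- Two flows are S-homotopy equivalent. -/
def SHomotopyEquivalent (X Y : Flow) : Prop :=
  ∃ f : FlowHom X Y, IsSHomotopyEquiv f

/-- The underlying continuous map on path spaces of a morphism of flows. -/
def FlowHom.pathMap {X Y : Flow} (f : FlowHom X Y) : C(X.Path, Y.Path) :=
  ⟨f.toFunP, f.continuous_toFunP⟩

/-- The map induced by a continuous map on `π₀` (path components). -/
def pi0Map {A B : Type*} [TopologicalSpace A] [TopologicalSpace B] (h : C(A, B)) :
    ZerothHomotopy A → ZerothHomotopy B :=
  Quotient.map h (fun _ _ j => ⟨j.somePath.map h.continuous⟩)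

/-- Push forward a generalized loop along a continuous map. -/
def GenLoop.push {A B : Type*} [TopologicalSpace A] [TopologicalSpace B] (h : C(A, B))
    {N : Type*} {x : A} (p : GenLoop N A x) : GenLoop N B (h x) :=
  ⟨h.comp p.1, fun y hy => by
    simp only [ContinuousMap.comp_apply]
    exact congrArg h (p.2 y hy)⟩

/-- The map induced by a continuous map on the `N`-th homotopy group. -/
def piMap {A B : Type*} [TopologicalSpace A] [TopologicalSpace B] (h : C(A, B))
    (N : Type*) (x : A) : HomotopyGroup N A x → HomotopyGroup N B (h x) :=
  Quotient.map (GenLoop.push h) (fun _ _ H =>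
    ⟨(Nonempty.some H).compContinuousMap h⟩)

/-- A continuous map is a weak homotopy equivalence: it induces a bijection on path
components and, for every base point and every `n`, a bijection on `πₙ`. -/
def IsWeakHomotopyEquiv {A B : Type*} [TopologicalSpace A] [TopologicalSpace B]
    (h : C(A, B)) : Prop :=
  Function.Bijective (pi0Map h) ∧
    ∀ (x : A) (n : ℕ), Function.Bijective (piMap h (Fin n) x)

/-- A morphism of flows is a weak S-homotopy equivalence if it induces a bijection
on the `0`-skeletons and a weak homotopy equivalence on the path spaces. -/
def IsWeakSHomotopyEquiv {X Y : Flow} (f : FlowHom X Y) : Prop :=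
  Function.Bijective f.toFun0 ∧ IsWeakHomotopyEquiv f.pathMap

-- PART C : S-cofibrant flows

/-- The sphere `S^{n-1}`, boundary of the closed `n`-disk `D^n`. -/
abbrev diskBoundary (n : ℕ) : Type := Metric.sphere (0 : EuclideanSpace ℝ (Fin n)) 1

/-- The closed `n`-disk `D^n`. -/
abbrev closedDisk (n : ℕ) : Type := Metric.closedBall (0 : EuclideanSpace ℝ (Fin n)) 1

/-- The inclusion `S^{n-1} ⊆ D^n`. -/
noncomputable def diskBoundaryInclusion (n : ℕ) : C(diskBoundary n, closedDisk n) :=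
  ⟨fun p => ⟨p.1, Metric.sphere_subset_closedBall p.2⟩,
    Continuous.subtype_mk continuous_subtype_val _⟩

/-- The inclusion of flows `Glob (S^{n-1}) → Glob (D^n)`. -/
noncomputable def globBoundaryInclusion (n : ℕ) : FlowHom (Glob (diskBoundary n)) (Glob (closedDisk n)) :=
  Glob.map (diskBoundaryInclusion n)

/-- A witness that a flow `X` is S-cofibrant: a skeletal filtration `sk 0 → sk 1 → ⋯`
where `sk 0` has empty path space (it is purely a discrete set of states), where
`sk (n+1)` is obtained from `sk n` as the pushout (expressed by its universal property,
`attach_isPushout`) of `⊔ᵢ Glob (S^{n-1}) → ⊔ᵢ Glob (D^n)` along attaching morphisms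
`Glob (S^{n-1}) → sk n` (for `n = 0` this attaches copies of the directed segment
`I⃗ = Glob(D⁰)` along `Glob(S^{-1}) = Glob(∅)`), and where `X` is the colimit
(expressed by its universal property `isColimit`) of the `sk n`. -/
structure SCofibrantStructure (X : Flow) : Type 1 where
  sk : ℕ → Flow
  isEmpty_path_sk_zero : IsEmpty (sk 0).Path
  ι : ∀ n, FlowHom (sk n) (sk (n + 1))
  cells : ℕ → Type
  attachMap : ∀ n, cells n → FlowHom (Glob (diskBoundary n)) (sk n)
  cellMap : ∀ n, cells n → FlowHom (Glob (closedDisk n)) (sk (n + 1))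
  attach_comm : ∀ n (i : cells n),
    (cellMap n i).comp (globBoundaryInclusion n) = (ι n).comp (attachMap n i)
  attach_isPushout : ∀ n (Z : Flow) (g : FlowHom (sk n) Z)
    (k : cells n → FlowHom (Glob (closedDisk n)) Z),
    (∀ i, (k i).comp (globBoundaryInclusion n) = g.comp (attachMap n i)) →
    ∃! h : FlowHom (sk (n + 1)) Z, h.comp (ι n) = g ∧ ∀ i, h.comp (cellMap n i) = k i
  incl : ∀ n, FlowHom (sk n) X
  incl_comm : ∀ n, (incl (n + 1)).comp (ι n) = incl n
  isColimit : ∀ (Z : Flow) (d : ∀ n, FlowHom (sk n) Z),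
    (∀ n, (d (n + 1)).comp (ι n) = d n) →
    ∃! h : FlowHom X Z, ∀ n, h.comp (incl n) = d n

/-- A flow is S-cofibrant if it admits a skeletal filtration as above. -/
def SCofibrant (X : Flow) : Prop :=
  Nonempty (SCofibrantStructure X)

-- PART D : the flow U ⊠ X, S-cofibrations, NDR pairs, the space FLOW(X,Y)

/-- The data exhibiting a flow `B` as a candidate for `U ⊠ X` (`U` a topological
space, `X` a flow): the generators, i.e. the states of `X` and a continuous family
`η (u, x)` of paths indexed by `U × ℙX`, subject to the defining relations
`s(u ⊠ x) = s x`, `t(u ⊠ x) = t x` and `(u ⊠ x) * (u ⊠ y) = u ⊠ (x * y)`. -/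
structure BoxCocone (U : Type) [TopologicalSpace U] (X B : Flow) : Type where
  η0 : X.State → B.State
  η : U × X.Path → B.Path
  continuous_η : Continuous η
  s_η : ∀ u x, B.s (η (u, x)) = η0 (X.s x)
  t_η : ∀ u x, B.t (η (u, x)) = η0 (X.t x)
  comp_η : ∀ u x y (h : X.t x = X.s y) (h' : B.t (η (u, x)) = B.s (η (u, y))),
    B.comp (η (u, x)) (η (u, y)) h' = η (u, X.comp x y h)

/-- `B`, equipped with the data `c`, *is* the flow `U ⊠ X`, i.e. the free flow
generated by `X⁰ ⊔ (U × ℙX)` quotiented by the relations `s (u,x) = s x`,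
`t (u,x) = t x` and `(u,x) * (u,y) = (u, x*y)`: every flow `Z` equipped with such
data receives a unique morphism of flows from `B` compatible with the data. -/
def IsBoxTimes {U : Type} [TopologicalSpace U] {X B : Flow} (c : BoxCocone U X B) : Prop :=
  ∀ (Z : Flow) (d : BoxCocone U X Z),
    ∃! f : FlowHom B Z, f.toFun0 ∘ c.η0 = d.η0 ∧ f.toFunP ∘ c.η = d.η

/-- For `u ∈ U`, the morphism of flows `X → U ⊠ X`, `x ↦ u ⊠ x`. -/
def BoxCocone.atTime {U : Type} [TopologicalSpace U] {X B : Flow}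
    (c : BoxCocone U X B) (u : U) : FlowHom X B where
  toFun0 := c.η0
  toFunP := fun x => c.η (u, x)
  continuous_toFunP := c.continuous_η.comp (Continuous.prodMk_right u)
  s_map x := c.s_η u x
  t_map x := c.t_η u x
  comp_map x y h h' := (c.comp_η u x y h h').symm

/-- Given box-product data `c : BoxCocone U A BUA` and `c' : BoxCocone V X BVX`, a
continuous map `φ : U → V` and a morphism of flows `f : A → X`, this asserts that
`m : BUA → BVX` is the canonically induced morphism `φ ⊠ f`, i.e. `u ⊠ a ↦ φ u ⊠ f a`. -/
def IsInducedBoxHom {U V : Type} [TopologicalSpace U] [TopologicalSpace V]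
    {A X BUA BVX : Flow} (c : BoxCocone U A BUA) (c' : BoxCocone V X BVX)
    (φ : U → V) (f : FlowHom A X) (m : FlowHom BUA BVX) : Prop :=
  (∀ a, m.toFun0 (c.η0 a) = c'.η0 (f.toFun0 a)) ∧
  (∀ u x, m.toFunP (c.η (u, x)) = c'.η (φ u, f.toFunP x))

/-- A morphism of flows `i : A → X` is an S-cofibration if it satisfies the
S-homotopy extension property: for every realization of `[0,1] ⊠ A` and `[0,1] ⊠ X`,
every morphism `g : X → Z` and every S-homotopy `H : [0,1] ⊠ A → Z` starting at
`g ∘ i`, there is an S-homotopy `H̄ : [0,1] ⊠ X → Z` with `H̄(u ⊠ i x) = H(u ⊠ x)`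
and `H̄(0 ⊠ y) = g y`. -/
def IsSCofibration {A X : Flow} (i : FlowHom A X) : Prop :=
  ∀ (IA IX : Flow) (cA : BoxCocone unitInterval A IA) (cX : BoxCocone unitInterval X IX),
    IsBoxTimes cA → IsBoxTimes cX →
    ∀ (Z : Flow) (g : FlowHom X Z) (H : FlowHom IA Z),
      H.comp (cA.atTime 0) = g.comp i →
      ∃ Hbar : FlowHom IX Z,
        (∀ u : unitInterval, (Hbar.comp ((cX.atTime u).comp i)) = H.comp (cA.atTime u)) ∧
        Hbar.comp (cX.atTime 0) = g

/-- `(Y, B)` is an NDR pair: `B` is closed in `Y` and there are `u : Y → [0,1]` with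
`B = u⁻¹(0)` and a homotopy `h : Y × [0,1] → Y` with `h(y,0) = y`, `h(b,t) = b` for
`b ∈ B`, and `h(y,1) ∈ B` as soon as `u y < 1`. -/
def IsNDRPair {Y : Type} [TopologicalSpace Y] (B : Set Y) : Prop :=
  IsClosed B ∧ ∃ (u : C(Y, unitInterval)) (h : C(Y × unitInterval, Y)),
    B = {y | u y = 0} ∧
    (∀ y, h (y, 0) = y) ∧
    (∀ b ∈ B, ∀ t, h (b, t) = b) ∧
    (∀ y, (u y : ℝ) < 1 → h (y, 1) ∈ B)

/-- `(Y, B)` is a DR pair: as for an NDR pair, but with `u y < 1` everywhere, so that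
`B` is a deformation retract of `Y`. -/
def IsDRPair {Y : Type} [TopologicalSpace Y] (B : Set Y) : Prop :=
  IsClosed B ∧ ∃ (u : C(Y, unitInterval)) (h : C(Y × unitInterval, Y)),
    B = {y | u y = 0} ∧
    (∀ y, h (y, 0) = y) ∧
    (∀ b ∈ B, ∀ t, h (b, t) = b) ∧
    (∀ y, (u y : ℝ) < 1 → h (y, 1) ∈ B) ∧
    (∀ y, (u y : ℝ) < 1)

/-- A morphism of flows, as a continuous map `X⁰ ⊔ ℙX → Y⁰ ⊔ ℙY`. -/
def FlowHom.toSumMap {X Y : Flow} (f : FlowHom X Y) :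
    C(X.State ⊕ X.Path, Y.State ⊕ Y.Path) :=
  ⟨Sum.map f.toFun0 f.toFunP,
    (continuous_of_discreteTopology (α := X.State)).sumMap f.continuous_toFunP⟩

/-- The set of morphisms of flows from `X` to `Y` carries the topology induced, via
`FlowHom.toSumMap`, by the compact-open topology. -/
def flowHomInducedTop (X Y : Flow) : TopologicalSpace (FlowHom X Y) :=
  TopologicalSpace.induced FlowHom.toSumMap ContinuousMap.compactOpen

/-- The space `FLOW(X,Y)`: morphisms of flows with the Kelleyfication of the induced
compact-open topology. -/
instance FlowHom.topologicalSpace (X Y : Flow) : TopologicalSpace (FlowHom X Y) :=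
  @TopologicalSpace.compactlyGenerated.{0} (FlowHom X Y) (flowHomInducedTop X Y)

-- PART E : model structures, localization, limits machinery

/-- The class of weak S-homotopy equivalences, as a class of morphisms of the
category `Flow`. -/
def weakSHomotopyEquivalences : MorphismProperty Flow :=
  fun _ _ f => IsWeakSHomotopyEquiv f

/-- `f` is a retract of `g` in the arrow category. -/
def IsRetractOfHom {C : Type*} [Category C] {X Y Z W : C} (f : X ⟶ Y) (g : Z ⟶ W) : Prop :=
  ∃ (i : X ⟶ Z) (r : Z ⟶ X) (i' : Y ⟶ W) (r' : W ⟶ Y),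
    i ≫ r = 𝟙 X ∧ i' ≫ r' = 𝟙 Y ∧ i ≫ g = f ≫ i' ∧ g ≫ r' = r ≫ f

/-- A model category structure (Quillen) on a category `C`: three classes of
morphisms — weak equivalences, cofibrations and fibrations — satisfying
two-out-of-three, stability under retracts, the lifting axioms and the
factorization axioms. -/
structure ModelStructure (C : Type*) [Category C] where
  weq : MorphismProperty C
  cof : MorphismProperty C
  fib : MorphismProperty C
  weq_two_out_of_three : weq.HasTwoOutOfThreeProperty
  weq_retract : ∀ {X Y Z W : C} (f : X ⟶ Y) (g : Z ⟶ W),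
    IsRetractOfHom f g → weq g → weq f
  cof_retract : ∀ {X Y Z W : C} (f : X ⟶ Y) (g : Z ⟶ W),
    IsRetractOfHom f g → cof g → cof f
  fib_retract : ∀ {X Y Z W : C} (f : X ⟶ Y) (g : Z ⟶ W),
    IsRetractOfHom f g → fib g → fib f
  lift_cof_trivFib : ∀ {A B P Q : C} (i : A ⟶ B) (p : P ⟶ Q),
    cof i → fib p → weq p → HasLiftingProperty i p
  lift_trivCof_fib : ∀ {A B P Q : C} (i : A ⟶ B) (p : P ⟶ Q),
    cof i → weq i → fib p → HasLiftingProperty i p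
  fact_cof_trivFib : ∀ {X Y : C} (f : X ⟶ Y),
    ∃ (Z : C) (i : X ⟶ Z) (p : Z ⟶ Y), cof i ∧ fib p ∧ weq p ∧ i ≫ p = f
  fact_trivCof_fib : ∀ {X Y : C} (f : X ⟶ Y),
    ∃ (Z : C) (i : X ⟶ Z) (p : Z ⟶ Y), cof i ∧ weq i ∧ fib p ∧ i ≫ p = f

/-- The S-homotopy relation, as a relation on the morphisms of the full subcategory
of S-cofibrant flows. -/
def sHomotopyHomRel : HomRel (ObjectProperty.FullSubcategory SCofibrant) :=
  fun {_ _} f g => SHomotopy f.hom g.hom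

/-- The canonical map `FLOW(X, lim Yⱼ) → lim FLOW(X, Yⱼ)`, the target being realized
as the subspace of the product `Π j, FLOW(X, Yⱼ)` consisting of the compatible
families. -/
def canonicalMapToLimit (X : Flow) {J : Type} [SmallCategory J] (D : J ⥤ Flow)
    (c : Limits.Cone D) :
    FlowHom X c.pt →
      {p : ∀ j, FlowHom X (D.obj j) // ∀ ⦃j j' : J⦄ (φ : j ⟶ j'),
        (D.map φ).comp (p j) = p j'} :=
  fun g => ⟨fun j => (c.π.app j).comp g, by
    intro j j' φ
    have h := c.π.naturality φ
    have h2 : FlowHom.comp (D.map φ) (c.π.app j) = c.π.app j' := by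
      have h3 := h.symm.trans
        (show ((Functor.const J).obj c.pt).map φ ≫ c.π.app j' = c.π.app j' from
          FlowHom.ext rfl rfl)
      exact h3
    show FlowHom.comp (D.map φ) (FlowHom.comp (c.π.app j) g) = FlowHom.comp (c.π.app j') g
    rw [← FlowHom.comp_assoc, h2]⟩


set_option linter.all false
section PartA1
open Set Metric Topology

/-- A compact convex body is homeomorphic to the closed disk, boundary going to boundary. -/
theorem convexHomeo {F : Type*} [NormedAddCommGroup F] [NormedSpace ℝ F] [FiniteDimensional ℝ F]
    (n : ℕ) (hn : Module.finrank ℝ F = n) (s : Set F) (hc : Convex ℝ s) (hcl : IsClosed s)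
    (hb : Bornology.IsBounded s) (hne : (interior s).Nonempty) :
    ∃ Θ : s ≃ₜ closedDisk n, ∀ x, ‖(Θ x).1‖ = 1 ↔ x.1 ∉ interior s := by
  have hfr : Module.finrank ℝ F = Module.finrank ℝ (EuclideanSpace ℝ (Fin n)) := by simp [hn]
  let L : F ≃L[ℝ] EuclideanSpace ℝ (Fin n) := ContinuousLinearEquiv.ofFinrankEq hfr
  have hLi : interior (L '' s) = L '' interior s :=
    (L.toHomeomorph.image_interior s).symm
  obtain ⟨h, h1, h2, h3⟩ := exists_homeomorph_image_interior_closure_frontier_eq_unitBall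
    (s := L '' s) (hc.linear_image L.toLinearMap)
    (by rw [hLi]; exact hne.image _) (L.lipschitz.isBounded_image hb)
  have hLcl : IsClosed (L '' s) := L.toHomeomorph.isClosedMap s hcl
  rw [hLcl.closure_eq] at h2
  rw [hLi] at h1
  let e : F ≃ₜ EuclideanSpace ℝ (Fin n) := L.toHomeomorph.trans h
  have he : ∀ x, e x = h (L x) := fun _ => rfl
  have e2 : ∀ x, x ∈ s ↔ e x ∈ closedBall (0 : EuclideanSpace ℝ (Fin n)) 1 := by
    intro x
    rw [← h2, he, h.injective.mem_set_image, L.injective.mem_set_image]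
  have e1 : ∀ x, x ∈ interior s ↔ e x ∈ ball (0 : EuclideanSpace ℝ (Fin n)) 1 := by
    intro x
    rw [← h1, he, h.injective.mem_set_image, L.injective.mem_set_image]
  refine ⟨e.subtype e2, fun x => ?_⟩
  rw [e1]
  have hx := (e2 x.1).1 x.2
  change ‖e x.1‖ = 1 ↔ _
  simp only [mem_closedBall, mem_ball, dist_zero_right, not_lt] at hx ⊢
  exact ⟨fun h => h.ge, fun h => le_antisymm hx h⟩

theorem exists_cubeHomeo (n : ℕ) :
    ∃ Θ : (Fin n → unitInterval) ≃ₜ closedDisk n,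
      ∀ x, ‖(Θ x).1‖ = 1 ↔ x ∈ Cube.boundary (Fin n) := by
  obtain ⟨Θ, hΘ⟩ := convexHomeo n (F := Fin n → ℝ) (by simp) (Set.pi univ fun _ => Icc (0:ℝ) 1)
    (convex_pi fun _ _ => convex_Icc 0 1) (isClosed_set_pi fun _ _ => isClosed_Icc)
    (Bornology.IsBounded.pi fun _ => isBounded_Icc 0 1)
    ⟨fun _ => 1/2, by rw [interior_pi_set finite_univ]; intro i _; simp [interior_Icc]; norm_num⟩
  let e : (Fin n → unitInterval) ≃ₜ (Set.pi univ fun _ : Fin n => Icc (0:ℝ) 1) :=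
    { toFun := fun x => ⟨fun i => x i, fun i _ => (x i).2⟩
      invFun := fun x i => ⟨x.1 i, x.2 i trivial⟩
      left_inv := fun x => rfl
      right_inv := fun x => rfl
      continuous_toFun := by fun_prop
      continuous_invFun := continuous_pi fun i =>
        Continuous.subtype_mk ((continuous_apply i).comp continuous_subtype_val) _ }
  refine ⟨e.trans Θ, fun x => ?_⟩
  change ‖(Θ (e x)).1‖ = 1 ↔ _
  rw [hΘ, interior_pi_set finite_univ]
  simp only [interior_Icc, mem_pi, mem_univ, true_imp_iff, not_forall, Cube.boundary, mem_ofPred_eq]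
  refine exists_congr fun i => ?_
  change (x i : ℝ) ∉ Ioo (0:ℝ) 1 ↔ _
  have h0 := (x i).2.1
  have h1 := (x i).2.2
  simp only [mem_Ioo, not_and_or, not_lt]
  constructor
  · rintro (h | h)
    · exact Or.inl (Subtype.ext (le_antisymm h h0))
    · exact Or.inr (Subtype.ext (le_antisymm h1 h))
  · rintro (h | h)
    · left; rw [h]; simp
    · right; rw [h]; simp

theorem exists_prismHomeo (n : ℕ) :
    ∃ Θ : (closedDisk n × unitInterval) ≃ₜ closedDisk (n+1),
      ∀ x, ‖(Θ x).1‖ = 1 ↔ (‖x.1.1‖ = 1 ∨ x.2 = 0 ∨ x.2 = 1) := by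
  obtain ⟨Θ, hΘ⟩ := convexHomeo (n+1) (F := EuclideanSpace ℝ (Fin n) × ℝ) (by simp)
    (closedBall 0 1 ×ˢ Icc (0:ℝ) 1)
    ((convex_closedBall _ _).prod (convex_Icc 0 1)) (isClosed_closedBall.prod isClosed_Icc)
    (isBounded_closedBall.prod (isBounded_Icc 0 1))
    ⟨(0, 1/2), by rw [interior_prod_eq, interior_closedBall _ one_ne_zero]; simp; norm_num⟩
  refine ⟨(Homeomorph.Set.prod _ _).symm.trans Θ, fun x => ?_⟩
  change ‖(Θ _).1‖ = 1 ↔ _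
  rw [hΘ, interior_prod_eq, interior_closedBall _ one_ne_zero, interior_Icc, mem_prod, not_and_or]
  change x.1.1 ∉ ball _ _ ∨ (x.2 : ℝ) ∉ Ioo (0:ℝ) 1 ↔ _
  have h0 := x.2.2.1
  have h1 := x.2.2.2
  have hx := x.1.2
  simp only [mem_closedBall, mem_ball, dist_zero_right, not_lt, mem_Ioo, not_and_or] at hx ⊢
  refine or_congr ⟨fun h => le_antisymm hx h, fun h => h.ge⟩ (or_congr ?_ ?_)
  · exact ⟨fun h => Subtype.ext (le_antisymm h h0), fun h => by rw [h]; simp⟩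
  · exact ⟨fun h => Subtype.ext (le_antisymm h1 h), fun h => by rw [h]; simp⟩

end PartA1

section PartA2
open Set Metric Topology

local notation "II" => unitInterval

/-- Descend a map along a continuous surjection from a compact space to a Hausdorff space. -/
theorem descend {K L B : Type*} [TopologicalSpace K] [TopologicalSpace L] [TopologicalSpace B]
    [CompactSpace K] [T2Space L] (q : K → L) (hq : Continuous q) (hs : Function.Surjective q)
    (f : K → B) (hf : Continuous f) (h : ∀ a b, q a = q b → f a = f b) :
    ∃ f' : C(L, B), ∀ a, f' (q a) = f a := by
  have hQ : IsQuotientMap q := hq.isClosedMap.isQuotientMap hq hs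
  have hval : ∀ a, f (Function.surjInv hs (q a)) = f a := fun a =>
    h _ _ (Function.surjInv_eq hs (q a))
  refine ⟨⟨fun y => f (Function.surjInv hs y), ?_⟩, hval⟩
  rw [hQ.continuous_iff]
  convert hf using 1
  funext a
  exact hval a

theorem disk_norm_le {n : ℕ} (x : closedDisk n) : ‖x.1‖ ≤ 1 :=
  mem_closedBall_zero_iff.1 x.2

theorem sph_norm {n : ℕ} (x : diskBoundary n) : ‖x.1‖ = 1 :=
  mem_sphere_zero_iff_norm.1 x.2

/-- constructor for disk elements -/
def mkD {n : ℕ} (x : EuclideanSpace ℝ (Fin n)) (h : ‖x‖ ≤ 1) : closedDisk n :=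
  ⟨x, by simpa using h⟩

/-- constructor for sphere elements -/
def mkS {n : ℕ} (x : EuclideanSpace ℝ (Fin n)) (h : ‖x‖ = 1) : diskBoundary n :=
  ⟨x, by simpa using h⟩

@[simp] theorem incl_val {n : ℕ} (x : diskBoundary n) : (diskBoundaryInclusion n x).1 = x.1 := rfl

theorem incl_mkS {n : ℕ} (x : closedDisk n) (h : ‖x.1‖ = 1) :
    diskBoundaryInclusion n (mkS x.1 h) = x := rfl

instance {n : ℕ} : CompactSpace (closedDisk n) := isCompact_iff_compactSpace.1
  (isCompact_closedBall _ _)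

theorem glue {n : ℕ} {B : Type*} [TopologicalSpace B] (b : C(closedDisk n, B))
    (k : C(diskBoundary n × II, B)) (hk : ∀ x, k (x, 1) = b (diskBoundaryInclusion n x)) :
    ∃ b1 : C(closedDisk n, B),
      (∀ x y : closedDisk n, y.1 = (1/2 : ℝ) • x.1 → b1 y = b x) ∧
      (∀ (x : diskBoundary n) (t : II) (y : closedDisk n),
        y.1 = (1 - (t:ℝ)/2) • x.1 → b1 y = k (x, t)) := by
  let q : closedDisk n ⊕ (diskBoundary n × II) → closedDisk n := Sum.elim
    (fun x => mkD ((1/2 : ℝ) • x.1) (by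
      rw [norm_smul]; have := disk_norm_le x; norm_num; linarith))
    (fun p => mkD ((1 - (p.2:ℝ)/2) • p.1.1) (by
      rw [norm_smul, sph_norm, Real.norm_eq_abs, mul_one, abs_le]
      constructor <;> linarith [p.2.2.1, p.2.2.2]))
  have hq : Continuous q := by
    refine Continuous.sumElim ?_ ?_
    · exact Continuous.subtype_mk (by fun_prop) _
    · exact Continuous.subtype_mk (by fun_prop) _
  have hs : Function.Surjective q := by
    intro y
    by_cases hy : ‖y.1‖ ≤ 1/2
    · refine ⟨Sum.inl (mkD ((2:ℝ) • y.1) (by rw [norm_smul]; norm_num; linarith)), ?_⟩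
      apply Subtype.ext
      change (1/2:ℝ) • (2:ℝ) • y.1 = y.1
      rw [smul_smul]; norm_num
    · have h0 : ‖y.1‖ ≠ 0 := by intro h; rw [h] at hy; norm_num at hy
      have h1 := disk_norm_le y
      refine ⟨Sum.inr (mkS (‖y.1‖⁻¹ • y.1) (by
        rw [norm_smul, norm_inv, norm_norm, inv_mul_cancel₀ h0]),
        ⟨2 - 2 * ‖y.1‖, by constructor <;> linarith⟩), ?_⟩
      apply Subtype.ext
      change (1 - (2 - 2 * ‖y.1‖)/2) • ‖y.1‖⁻¹ • y.1 = y.1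
      rw [smul_smul, show 1 - (2 - 2 * ‖y.1‖)/2 = ‖y.1‖ by ring, mul_inv_cancel₀ h0, one_smul]
  have key : ∀ (x : closedDisk n) (p : diskBoundary n × II),
      (1/2 : ℝ) • x.1 = (1 - (p.2:ℝ)/2) • p.1.1 → b x = k p := by
    intro x p h
    have hn := congrArg norm h
    rw [norm_smul, norm_smul, sph_norm, Real.norm_eq_abs, Real.norm_eq_abs,
      abs_of_pos (by norm_num), abs_of_nonneg (by linarith [p.2.2.2])] at hn
    have ht : (p.2 : ℝ) = 1 := by linarith [p.2.2.2, disk_norm_le x]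
    have ht' : p.2 = 1 := Subtype.ext ht
    rw [ht] at h
    have hx : x.1 = p.1.1 := by
      have := congrArg (fun v => (2:ℝ) • v) h
      simp only [smul_smul] at this
      norm_num at this
      exact this
    have : p = (p.1, 1) := by rw [← ht']
    rw [this, hk]
    exact congrArg b (Subtype.ext hx)
  obtain ⟨b1, hb1⟩ := descend q hq hs (Sum.elim b k) (Continuous.sumElim b.continuous k.continuous) (by
    rintro (x | p) (x' | p') h
    · have h : (1/2 : ℝ) • x.1 = (1/2 : ℝ) • x'.1 := congrArg Subtype.val h
      have := smul_right_injective _ (by norm_num : (1/2:ℝ) ≠ 0) h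
      exact congrArg b (Subtype.ext this)
    · exact key x p' (congrArg Subtype.val h)
    · exact (key x' p (congrArg Subtype.val h.symm)).symm
    · have h : (1 - (p.2:ℝ)/2) • p.1.1 = (1 - (p'.2:ℝ)/2) • p'.1.1 := congrArg Subtype.val h
      have hn := congrArg norm h
      rw [norm_smul, norm_smul, sph_norm, sph_norm, Real.norm_eq_abs, Real.norm_eq_abs,
        abs_of_nonneg (by linarith [p.2.2.2]), abs_of_nonneg (by linarith [p'.2.2.2])] at hn
      have ht : p.2 = p'.2 := Subtype.ext (by linarith)
      rw [ht] at h
      have h2 := smul_right_injective _ (show (1 - (p'.2:ℝ)/2) ≠ 0 by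
        have := p'.2.2.2; intro h; linarith) h
      exact congrArg k (Prod.ext (Subtype.ext h2) ht))
  refine ⟨b1, fun x y h => ?_, fun x t y h => ?_⟩
  · rw [← show q (Sum.inl x) = y from Subtype.ext h.symm]; exact hb1 (Sum.inl x)
  · rw [← show q (Sum.inr (x, t)) = y from Subtype.ext h.symm]; exact hb1 (Sum.inr (x, t))

theorem concat {Z B : Type*} [TopologicalSpace Z] [TopologicalSpace B] (u v : C(Z × II, B))
    (h : ∀ z, u (z, 1) = v (z, 0)) :
    ∃ k : C(Z × II, B), (∀ z (s s' : II), (s' : ℝ) = s / 2 → k (z, s') = u (z, s)) ∧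
      (∀ z (s s' : II), (s' : ℝ) = (1 + s) / 2 → k (z, s') = v (z, s)) := by
  let f : Z × II → B := fun p => if (p.2 : ℝ) ≤ 1/2
    then u (p.1, projIcc 0 1 zero_le_one (2 * (p.2:ℝ)))
    else v (p.1, projIcc 0 1 zero_le_one (2 * (p.2:ℝ) - 1))
  have hf : Continuous f := by
    refine Continuous.if_le ?_ ?_ (by fun_prop) (by fun_prop) ?_
    · exact u.continuous.comp (continuous_fst.prodMk (continuous_projIcc.comp (by fun_prop)))
    · exact v.continuous.comp (continuous_fst.prodMk (continuous_projIcc.comp (by fun_prop)))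
    · intro p hp
      rw [hp]
      rw [projIcc_of_right_le _ (by norm_num), projIcc_of_le_left _ (by norm_num)]
      exact h p.1
  refine ⟨⟨f, hf⟩, fun z s s' hs => ?_, fun z s s' hs => ?_⟩
  · change f (z, s') = _
    have : (s' : ℝ) ≤ 1/2 := by rw [hs]; linarith [s.2.2]
    simp only [f, this, if_true]
    congr 2
    rw [hs, show 2 * ((s:ℝ)/2) = s by ring]
    exact projIcc_val _ s
  · change f (z, s') = _
    by_cases h0 : (s : ℝ) = 0
    · have : (s' : ℝ) ≤ 1/2 := by rw [hs, h0]; norm_num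
      simp only [f, this, if_true]
      rw [projIcc_of_right_le _ (by rw [hs, h0]; norm_num)]
      rw [show s = 0 from Subtype.ext h0]
      exact h z
    · have : ¬ (s' : ℝ) ≤ 1/2 := by
        rw [hs]; have := s.2.1
        have : 0 < (s:ℝ) := lt_of_le_of_ne this (Ne.symm h0)
        linarith
      simp only [f, this, if_false]
      congr 2
      rw [hs, show 2 * ((1 + (s:ℝ))/2) - 1 = s by ring]
      exact projIcc_val _ s

/-- The homotopy extension and lifting property for `h` at the sphere map `g`. -/
def HelpAt {A B : Type*} [TopologicalSpace A] [TopologicalSpace B] (h : C(A, B)) (n : ℕ)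
    (g : C(diskBoundary n, A)) : Prop :=
  ∀ (k : C(diskBoundary n × II, B)) (b : C(closedDisk n, B)),
    (∀ x, k (x, 0) = h (g x)) → (∀ x, k (x, 1) = b (diskBoundaryInclusion n x)) →
    ∃ (a : C(closedDisk n, A)) (κ : C(closedDisk n × II, B)),
      (∀ x, a (diskBoundaryInclusion n x) = g x) ∧
      (∀ x t, κ (diskBoundaryInclusion n x, t) = k (x, t)) ∧
      (∀ x, κ (x, 0) = h (a x)) ∧ (∀ x, κ (x, 1) = b x)

theorem relHelp {A B : Type*} [TopologicalSpace A] [TopologicalSpace B] (h : C(A, B)) (n : ℕ)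
    (g : C(diskBoundary n, A))
    (H : ∀ b1 : C(closedDisk n, B), (∀ x, b1 (diskBoundaryInclusion n x) = h (g x)) →
      ∃ (a : C(closedDisk n, A)) (M : C(closedDisk n × II, B)),
        (∀ x, a (diskBoundaryInclusion n x) = g x) ∧
        (∀ x t, M (diskBoundaryInclusion n x, t) = h (g x)) ∧
        (∀ x, M (x, 0) = h (a x)) ∧ (∀ x, M (x, 1) = b1 x)) :
    HelpAt h n g := by
  intro k b hk0 hk1
  obtain ⟨b1, hb1, hb1'⟩ := glue b k hk1
  obtain ⟨a, M, ha, hM, hM0, hM1⟩ := H b1 (fun x => by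
    rw [hb1' x 0 _ (by simp), hk0])
  let lens := {p : closedDisk n × II // (p.2 : ℝ) ≤ 1 - ‖p.1.1‖}
  let ql : closedDisk n × II → lens := fun p => ⟨(p.1, ⟨p.2 * (1 - ‖p.1.1‖), by
      have h1 := disk_norm_le p.1
      exact ⟨mul_nonneg p.2.2.1 (by linarith), mul_le_one₀ p.2.2.2 (by linarith)
        (by linarith [norm_nonneg p.1.1])⟩⟩), by
      have h1 := disk_norm_le p.1
      exact mul_le_of_le_one_left (by linarith) p.2.2.2⟩
  have hql : Continuous ql := by
    refine Continuous.subtype_mk (continuous_fst.prodMk (Continuous.subtype_mk (by fun_prop) _)) _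
  have hqls : Function.Surjective ql := by
    rintro ⟨⟨x, t⟩, hp⟩
    by_cases hx : ‖x.1‖ = 1
    · refine ⟨(x, 0), Subtype.ext (Prod.ext rfl (Subtype.ext ?_))⟩
      simp only [hx, sub_self] at hp
      have : (t:ℝ) = 0 := le_antisymm hp t.2.1
      simp [ql, this]
    · have h1 : ‖x.1‖ < 1 := lt_of_le_of_ne (disk_norm_le x) hx
      refine ⟨(x, ⟨t / (1 - ‖x.1‖), div_nonneg t.2.1 (by linarith),
        (div_le_one (by linarith)).2 hp⟩), Subtype.ext (Prod.ext rfl (Subtype.ext ?_))⟩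
      change (t : ℝ) / (1 - ‖x.1‖) * (1 - ‖x.1‖) = t
      rw [div_mul_cancel₀]; linarith
  obtain ⟨Mt, hMt⟩ := descend ql hql hqls M M.continuous (by
    rintro ⟨x, t⟩ ⟨x', t'⟩ hh
    have h1 : x = x' := congrArg (fun z => z.1.1) hh
    subst h1
    have h2 : (t:ℝ) * (1 - ‖x.1‖) = t' * (1 - ‖x.1‖) := congrArg (fun z => (z.1.2 : ℝ)) hh
    by_cases hx : ‖x.1‖ = 1
    · rw [← incl_mkS x hx, hM, hM]
    · have : t = t' := Subtype.ext (mul_right_cancel₀ (by intro h; apply hx; linarith) h2)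
      rw [this])
  let Q : closedDisk n × II → lens := fun p => ⟨(mkD ((1 - (p.2:ℝ)/2) • p.1.1) (by
      have h1 := disk_norm_le p.1
      rw [norm_smul, Real.norm_eq_abs, abs_of_nonneg (by linarith [p.2.2.2])]
      exact mul_le_one₀ (by linarith [p.2.2.1]) (norm_nonneg _) h1),
      ⟨p.2 * (1 - ‖p.1.1‖/2), by
        have h1 := disk_norm_le p.1
        exact ⟨mul_nonneg p.2.2.1 (by linarith), mul_le_one₀ p.2.2.2 (by linarith)
          (by linarith [norm_nonneg p.1.1])⟩⟩), by
      have h1 := disk_norm_le p.1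
      have h2 := norm_nonneg p.1.1
      change (p.2:ℝ) * (1 - ‖p.1.1‖/2) ≤ 1 - ‖(1 - (p.2:ℝ)/2) • p.1.1‖
      rw [norm_smul, Real.norm_eq_abs, abs_of_nonneg (by linarith [p.2.2.2])]
      nlinarith [p.2.2.1, p.2.2.2]⟩
  have hQ : Continuous Q := by
    refine Continuous.subtype_mk (Continuous.prodMk (Continuous.subtype_mk (by fun_prop) _)
      (Continuous.subtype_mk (by fun_prop) _)) _
  refine ⟨a, ⟨fun p => Mt (Q p), Mt.continuous.comp hQ⟩, ha, fun x t => ?_, fun x => ?_, fun x => ?_⟩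
  · change Mt (Q _) = _
    have : Q (diskBoundaryInclusion n x, t) = ql (mkD ((1 - (t:ℝ)/2) • x.1) (by
        rw [norm_smul, Real.norm_eq_abs, abs_of_nonneg (by linarith [t.2.2]), sph_norm]
        linarith [t.2.1]), 1) := by
      refine Subtype.ext (Prod.ext rfl (Subtype.ext ?_))
      change (t:ℝ) * (1 - ‖x.1‖/2) = ((1 : II) : ℝ) * (1 - ‖(1 - (t:ℝ)/2) • x.1‖)
      rw [norm_smul, Real.norm_eq_abs, abs_of_nonneg (by linarith [t.2.2]), sph_norm]
      simp; ring
    rw [this, hMt, hM1]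
    exact hb1' x t _ rfl
  · change Mt (Q _) = _
    have : Q (x, 0) = ql (x, 0) := by
      refine Subtype.ext (Prod.ext (Subtype.ext ?_) (Subtype.ext ?_))
      · simp [Q, ql, mkD]
      · simp [Q, ql]
    rw [this, hMt, hM0]
  · change Mt (Q _) = _
    have : Q (x, 1) = ql (mkD ((1/2:ℝ) • x.1) (by
        have := disk_norm_le x; rw [norm_smul]; norm_num; linarith), 1) := by
      refine Subtype.ext (Prod.ext (Subtype.ext ?_) (Subtype.ext ?_))
      · simp [Q, ql, mkD]; norm_num
      · change ((1 : II) : ℝ) * (1 - ‖x.1‖/2) = ((1 : II) : ℝ) * (1 - ‖(1/2:ℝ) • x.1‖)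
        rw [norm_smul]; norm_num; ring
    rw [this, hMt, hM1]
    exact hb1 x _ rfl

theorem helpDrag {A B : Type*} [TopologicalSpace A] [TopologicalSpace B] (h : C(A, B)) (n : ℕ)
    (g g1 : C(diskBoundary n, A)) (c : C(diskBoundary n × II, A))
    (hc0 : ∀ x, c (x, 0) = g x) (hc1 : ∀ x, c (x, 1) = g1 x) (H : HelpAt h n g1) :
    HelpAt h n g := by
  intro k b hk0 hk1
  obtain ⟨k1, hk1u, hk1v⟩ := concat
    (⟨fun p => h (c (p.1, unitInterval.symm p.2)), by fun_prop⟩ : C(diskBoundary n × II, B)) k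
    (by intro z; simp [hc0, hk0])
  obtain ⟨a1, κ1, ha1, hκ, hκ0, hκ1⟩ := H k1 b
    (fun x => by rw [hk1u x 0 0 (by simp)]; simp [hc1])
    (fun x => by rw [hk1v x 1 1 (by norm_num), hk1])
  obtain ⟨a, ha, ha'⟩ := glue a1 c (fun x => by rw [hc1, ha1])
  have hpos : ∀ p : closedDisk n × II, 0 < max ‖p.1.1‖ ((1 + (p.2:ℝ))/2) := fun p =>
    lt_max_of_lt_right (by linarith [p.2.2.1])
  let Q : closedDisk n × II → closedDisk n × II := fun p =>
    (mkD ((max ‖p.1.1‖ ((1 + (p.2:ℝ))/2))⁻¹ • p.1.1) (by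
      rw [norm_smul, norm_inv, Real.norm_eq_abs, abs_of_pos (hpos p), inv_mul_le_iff₀ (hpos p),
        mul_one]
      exact le_max_left _ _),
     ⟨max 0 (‖p.1.1‖ - 1/2) * (1 - p.2) + p.2, by
      have h1 := disk_norm_le p.1
      have h2 := p.2.2.1
      have h3 := p.2.2.2
      have h4 : (0:ℝ) ≤ max 0 (‖p.1.1‖ - 1/2) := le_max_left _ _
      have h5 : max 0 (‖p.1.1‖ - 1/2) ≤ (1:ℝ) := max_le (by norm_num) (by linarith)
      constructor
      · nlinarith
      · nlinarith⟩)
  have hQ : Continuous Q := by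
    refine Continuous.prodMk (Continuous.subtype_mk (Continuous.smul (Continuous.inv₀ (by fun_prop)
      fun p => (hpos p).ne') (by fun_prop)) _) (Continuous.subtype_mk (by fun_prop) _)
  refine ⟨a, ⟨fun p => κ1 (Q p), κ1.continuous.comp hQ⟩, fun x => ?_, fun x t => ?_, fun x => ?_,
    fun x => ?_⟩
  · rw [ha' x 0 _ (by simp), hc0]
  · change κ1 (Q _) = _
    have : Q (diskBoundaryInclusion n x, t) = (diskBoundaryInclusion n x,
        ⟨(1 + (t:ℝ))/2, by constructor <;> linarith [t.2.1, t.2.2]⟩) := by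
      refine Prod.ext (Subtype.ext ?_) (Subtype.ext ?_)
      · simp only [Q, mkD, incl_val, sph_norm]
        rw [max_eq_left (by linarith [t.2.2])]; simp
      · simp only [Q, mkD, incl_val, sph_norm]
        rw [max_eq_right (by norm_num)]; ring
    rw [this, hκ, hk1v x t _ rfl]
  · change κ1 (Q _) = _
    by_cases hx : ‖x.1‖ ≤ 1/2
    · have : Q (x, 0) = (mkD ((2:ℝ) • x.1) (by rw [norm_smul]; norm_num; linarith), 0) := by
        refine Prod.ext (Subtype.ext ?_) (Subtype.ext ?_)
        · simp only [Q, mkD]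
          rw [max_eq_right (by simpa using hx)]; simp
        · simp only [Q]
          rw [max_eq_left (by linarith)]; simp
      rw [this, hκ0]
      congr 1
      symm
      apply ha
      simp [mkD, smul_smul]
    · have hx0 : ‖x.1‖ ≠ 0 := by intro h; rw [h] at hx; norm_num at hx
      have hx1 := disk_norm_le x
      have hS : ‖‖x.1‖⁻¹ • x.1‖ = 1 := by
        rw [norm_smul, norm_inv, norm_norm, inv_mul_cancel₀ hx0]
      have : Q (x, 0) = (diskBoundaryInclusion n (mkS _ hS), ⟨‖x.1‖ - 1/2, by
          constructor <;> linarith⟩) := by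
        refine Prod.ext (Subtype.ext ?_) (Subtype.ext ?_)
        · simp only [Q, mkD, mkS, incl_val]
          rw [max_eq_left (by simp; linarith)]
        · simp only [Q]
          rw [max_eq_right (by linarith)]; simp
      rw [this, hκ, hk1u _ ⟨2 * ‖x.1‖ - 1, by constructor <;> linarith⟩ _ (by simp; ring)]
      change h (c (_, _)) = _
      congr 1
      symm
      apply ha'
      simp only [unitInterval.coe_symm_eq, mkS]
      rw [smul_smul, show 1 - (1 - (2 * ‖x.1‖ - 1))/2 = ‖x.1‖ by ring, mul_inv_cancel₀ hx0, one_smul]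
  · change κ1 (Q _) = _
    have hx1 := disk_norm_le x
    have : Q (x, 1) = (x, 1) := by
      refine Prod.ext (Subtype.ext ?_) (Subtype.ext ?_)
      · simp only [Q, mkD]
        rw [max_eq_right (by simpa using hx1)]; simp
      · simp [Q]
    rw [this, hκ1]

end PartA2

section PartA3
open Set Metric Topology

local notation "II" => unitInterval

/-- right lifting property against `S^{n-1} → D^n`. -/
def RLPn {E B : Type*} [TopologicalSpace E] [TopologicalSpace B] (p : E → B) (n : ℕ) : Prop :=
  ∀ (g : C(diskBoundary n, E)) (b : C(closedDisk n, B)),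
    (∀ x, p (g x) = b (diskBoundaryInclusion n x)) →
    ∃ a : C(closedDisk n, E), (∀ x, a (diskBoundaryInclusion n x) = g x) ∧ ∀ x, p (a x) = b x

/-- the mapping path space -/
def PF {A B : Type*} [TopologicalSpace A] [TopologicalSpace B] (h : A → B) : Type _ :=
  {q : A × C(II, B) // h q.1 = q.2 0}

instance {A B : Type*} [TopologicalSpace A] [TopologicalSpace B] (h : A → B) :
    TopologicalSpace (PF h) := instTopologicalSpaceSubtype

/-- the end point map -/
def PF.ev1 {A B : Type*} [TopologicalSpace A] [TopologicalSpace B] (h : A → B) (q : PF h) : B :=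
  q.1.2 1

theorem rlp_of_help {A B : Type*} [TopologicalSpace A] [TopologicalSpace B] (h : C(A, B)) (n : ℕ)
    (H : ∀ g, HelpAt h n g) : RLPn (PF.ev1 h) n := by
  intro g b hg
  have hc1 : Continuous fun x => (g x).1 := continuous_subtype_val.comp g.continuous
  obtain ⟨a, κ, ha, hκ, h0, h1⟩ := H ⟨fun x => (g x).1.1, continuous_fst.comp hc1⟩
    ⟨fun p => (g p.1).1.2 p.2, by
      have : Continuous fun p : diskBoundary n × II => ((g p.1).1.2, p.2) :=
        (continuous_snd.comp (hc1.comp continuous_fst)).prodMk continuous_snd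
      exact continuous_eval.comp this⟩ b
    (fun x => (g x).2.symm) hg
  refine ⟨⟨fun x => ⟨(a x, κ.curry x), (h0 x).symm⟩, ?_⟩, fun x => ?_, fun x => h1 x⟩
  · exact Continuous.subtype_mk (a.continuous.prodMk κ.curry.continuous) _
  · refine Subtype.ext (Prod.ext (ha x) (ContinuousMap.ext fun t => ?_))
    exact hκ x t

theorem prismLift {E B : Type*} [TopologicalSpace E] [TopologicalSpace B] (p : E → B) (n : ℕ)
    (H : RLPn p (n+1)) (f : C(closedDisk n × II, B)) (e0 e1 : C(closedDisk n, E))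
    (w : C(diskBoundary n × II, E)) (h0 : ∀ x, p (e0 x) = f (x, 0)) (h1 : ∀ x, p (e1 x) = f (x, 1))
    (hw : ∀ x t, p (w (x, t)) = f (diskBoundaryInclusion n x, t))
    (w0 : ∀ x, w (x, 0) = e0 (diskBoundaryInclusion n x))
    (w1 : ∀ x, w (x, 1) = e1 (diskBoundaryInclusion n x)) :
    ∃ F : C(closedDisk n × II, E), (∀ x, F (x, 0) = e0 x) ∧ (∀ x, F (x, 1) = e1 x) ∧
      (∀ x t, F (diskBoundaryInclusion n x, t) = w (x, t)) ∧ ∀ y, p (F y) = f y := by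
  obtain ⟨Θ, hΘ⟩ := exists_prismHomeo n
  let K := (closedDisk n ⊕ closedDisk n) ⊕ (diskBoundary n × II)
  let r : K → closedDisk n × II := Sum.elim (Sum.elim (fun x => (x, 0)) (fun x => (x, 1)))
    (fun p => (diskBoundaryInclusion n p.1, p.2))
  have hr : Continuous r := by
    refine Continuous.sumElim (Continuous.sumElim ?_ ?_) ?_ <;> fun_prop
  let v : K → E := Sum.elim (Sum.elim e0 e1) w
  have hv : Continuous v := by
    refine Continuous.sumElim (Continuous.sumElim ?_ ?_) ?_ <;> fun_prop
  have hr1 : ∀ y, ‖(Θ (r y)).1‖ = 1 := by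
    rintro ((x | x) | ⟨x, t⟩) <;> rw [hΘ] <;> simp [r, sph_norm]
  have hpv : ∀ y, p (v y) = f (r y) := by
    rintro ((x | x) | ⟨x, t⟩)
    · exact h0 x
    · exact h1 x
    · exact hw x t
  have hrv : ∀ a b, r a = r b → v a = v b := by
    rintro ((x | x) | ⟨x, t⟩) ((x' | x') | ⟨x', t'⟩) hh <;> rw [Prod.ext_iff] at hh <;>
      simp only [r, Sum.elim_inl, Sum.elim_inr] at hh <;> obtain ⟨ha, hb⟩ := hh <;>
      simp only [v, Sum.elim_inl, Sum.elim_inr]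
    · rw [ha]
    · exact absurd hb (by simp)
    · rw [ha, ← hb, w0]
    · exact absurd hb (by simp)
    · rw [ha]
    · rw [ha, ← hb, w1]
    · rw [← ha, hb, w0]
    · rw [← ha, hb, w1]
    · have : x = x' := Subtype.ext (congrArg (fun z : closedDisk n => z.1) ha)
      rw [this, hb]
  obtain ⟨g, hg⟩ := descend (K := K) (L := diskBoundary (n+1)) (fun y => mkS _ (hr1 y))
    (Continuous.subtype_mk (continuous_subtype_val.comp (Θ.continuous.comp hr)) _) (by
      intro y
      let z := Θ.symm (diskBoundaryInclusion _ y)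
      have hz : Θ z = diskBoundaryInclusion _ y := Θ.apply_symm_apply _
      have hzr : ∃ k, r k = z := by
        rcases (hΘ z).1 (by rw [hz]; exact sph_norm y) with h | h | h
        · exact ⟨Sum.inr (mkS z.1.1 h, z.2), rfl⟩
        · exact ⟨Sum.inl (Sum.inl z.1), Prod.ext rfl h.symm⟩
        · exact ⟨Sum.inl (Sum.inr z.1), Prod.ext rfl h.symm⟩
      obtain ⟨k, hk⟩ := hzr
      refine ⟨k, Subtype.ext ?_⟩
      change (Θ (r k)).1 = y.1
      rw [hk, hz]; rfl) v hv (by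
      intro a b hab
      have : Θ (r a) = Θ (r b) := Subtype.ext (congrArg (fun z : diskBoundary (n+1) => z.1) hab)
      exact hrv a b (Θ.injective this))
  have hsurj : ∀ y : diskBoundary (n+1), ∃ k, r k = Θ.symm (diskBoundaryInclusion _ y) := by
    intro y
    let z := Θ.symm (diskBoundaryInclusion _ y)
    have hz : Θ z = diskBoundaryInclusion _ y := Θ.apply_symm_apply _
    rcases (hΘ z).1 (by rw [hz]; exact sph_norm y) with h | h | h
    · exact ⟨Sum.inr (mkS z.1.1 h, z.2), rfl⟩
    · exact ⟨Sum.inl (Sum.inl z.1), Prod.ext rfl h.symm⟩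
    · exact ⟨Sum.inl (Sum.inr z.1), Prod.ext rfl h.symm⟩
  have hgy : ∀ y k, r k = Θ.symm (diskBoundaryInclusion _ y) → g y = v k := by
    intro y k hk
    rw [← hg k]
    congr 1
    refine Subtype.ext ?_
    change y.1 = (Θ (r k)).1
    rw [hk, Θ.apply_symm_apply]; rfl
  obtain ⟨a, ha, hpa⟩ := H g (f.comp ⟨Θ.symm, Θ.symm.continuous⟩) (by
    intro y
    obtain ⟨k, hk⟩ := hsurj y
    rw [hgy y k hk, hpv, hk]; rfl)
  have hak : ∀ k, a (Θ (r k)) = v k := by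
    intro k
    have := ha (mkS _ (hr1 k))
    rw [incl_mkS (Θ (r k)) (hr1 k)] at this
    rw [this, hg]
  refine ⟨a.comp ⟨Θ, Θ.continuous⟩, fun x => hak (Sum.inl (Sum.inl x)),
    fun x => hak (Sum.inl (Sum.inr x)), fun x t => hak (Sum.inr (x, t)), fun y => ?_⟩
  change p (a (Θ y)) = _
  rw [hpa]
  change f (Θ.symm (Θ y)) = f y
  rw [Θ.symm_apply_apply]

/-- Help for all spheres -/
def HelpAll {A B : Type*} [TopologicalSpace A] [TopologicalSpace B] (h : C(A, B)) : Prop :=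
  ∀ n g, HelpAt h n g

theorem relInj {A B : Type*} [TopologicalSpace A] [TopologicalSpace B] (h : C(A, B))
    (H : HelpAll h) (n : ℕ) (a0 a1 : C(closedDisk n, A)) (G : C(closedDisk n × II, B))
    (h0 : ∀ x, G (x, 0) = h (a0 x)) (h1 : ∀ x, G (x, 1) = h (a1 x))
    (hb : ∀ x t, G (diskBoundaryInclusion n x, t) = h (a0 (diskBoundaryInclusion n x)))
    (hab : ∀ x, a0 (diskBoundaryInclusion n x) = a1 (diskBoundaryInclusion n x)) :
    ∃ F : C(closedDisk n × II, A), (∀ x, F (x, 0) = a0 x) ∧ (∀ x, F (x, 1) = a1 x) ∧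
      ∀ x t, F (diskBoundaryInclusion n x, t) = a0 (diskBoundaryInclusion n x) := by
  have hconst : Continuous (fun y : B => ContinuousMap.const II y) := ContinuousMap.continuous_const'
  obtain ⟨F, F0, F1, Fw, -⟩ := prismLift (PF.ev1 h) n (rlp_of_help h (n+1) (H (n+1)))
    ⟨fun p => h (a1 p.1), by fun_prop⟩
    ⟨fun x => ⟨(a0 x, G.curry x), (h0 x).symm⟩,
      Continuous.subtype_mk (a0.continuous.prodMk G.curry.continuous) _⟩
    ⟨fun x => ⟨(a1 x, ContinuousMap.const II (h (a1 x))), rfl⟩,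
      Continuous.subtype_mk (a1.continuous.prodMk (hconst.comp (by fun_prop))) _⟩
    ⟨fun p => ⟨(a0 (diskBoundaryInclusion n p.1),
        ContinuousMap.const II (h (a0 (diskBoundaryInclusion n p.1)))), rfl⟩,
      Continuous.subtype_mk (Continuous.prodMk (by fun_prop) (hconst.comp (by fun_prop))) _⟩
    (fun x => h1 x) (fun x => rfl) (fun x t => by
      change h (a0 (diskBoundaryInclusion n x)) = _; rw [hab]; rfl)
    (fun x => Subtype.ext (Prod.ext rfl (ContinuousMap.ext fun t => (hb x t).symm)))
    (fun x => Subtype.ext (Prod.ext (hab x) (by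
      change ContinuousMap.const II (h (a0 _)) = ContinuousMap.const II (h (a1 _)); rw [hab])))
  refine ⟨⟨fun p => (F p).1.1, continuous_fst.comp (continuous_subtype_val.comp F.continuous)⟩,
    fun x => ?_, fun x => ?_, fun x t => ?_⟩
  · change (F (x, 0)).1.1 = _; rw [F0]; rfl
  · change (F (x, 1)).1.1 = _; rw [F1]; rfl
  · change (F (_, t)).1.1 = _; rw [Fw]; rfl

theorem weq_of_help {A B : Type*} [TopologicalSpace A] [TopologicalSpace B] (h : C(A, B))
    (H : HelpAll h) : IsWeakHomotopyEquiv h := by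
  have hS0 : IsEmpty (diskBoundary 0) := ⟨fun x => by
    have := sph_norm x
    rw [Subsingleton.elim x.1 0] at this; simp at this⟩
  let o : closedDisk 0 := mkD 0 (by simp)
  refine ⟨⟨?_, ?_⟩, fun x n => ⟨?_, ?_⟩⟩
  · intro a b
    induction a using _root_.Quotient.inductionOn with | _ a =>
    induction b using _root_.Quotient.inductionOn with | _ b =>
    intro hab
    obtain ⟨γ⟩ := _root_.Quotient.exact hab
    obtain ⟨F, F0, F1, -⟩ := relInj h H 0 (.const _ a) (.const _ b)
      ⟨fun p => γ p.2, by fun_prop⟩ (fun x => γ.source) (fun x => γ.target)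
      (fun x => hS0.elim x) (fun x => hS0.elim x)
    exact _root_.Quotient.sound ⟨⟨⟨fun t => F (o, t), by fun_prop⟩, F0 o, F1 o⟩⟩
  · intro b
    induction b using _root_.Quotient.inductionOn with | _ b =>
    obtain ⟨a, κ, -, -, h0, h1⟩ := H 0 ⟨fun x => hS0.elim x, continuous_of_isEmpty _⟩
      ⟨fun x => hS0.elim x.1, continuous_of_isEmpty _⟩ (.const _ b) (fun x => hS0.elim x)
      (fun x => hS0.elim x)
    refine ⟨_root_.Quotient.mk _ (a o), _root_.Quotient.sound
      ⟨⟨⟨fun t => κ (o, t), by fun_prop⟩, h0 o, h1 o⟩⟩⟩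
  · obtain ⟨Θ, hΘ⟩ := exists_cubeHomeo n
    have hbd : ∀ z : diskBoundary n, Θ.symm (diskBoundaryInclusion n z) ∈ Cube.boundary (Fin n) := by
      intro z; rw [← hΘ, Θ.apply_symm_apply]; exact sph_norm z
    intro a b
    induction a using _root_.Quotient.inductionOn with | _ a =>
    induction b using _root_.Quotient.inductionOn with | _ b =>
    intro hab
    obtain ⟨G⟩ := _root_.Quotient.exact hab
    obtain ⟨F, F0, F1, Fb⟩ := relInj h H n (a.1.comp ⟨Θ.symm, Θ.symm.continuous⟩)
      (b.1.comp ⟨Θ.symm, Θ.symm.continuous⟩)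
      ⟨fun p => G (p.2, Θ.symm p.1), by fun_prop⟩
      (fun z => G.apply_zero _) (fun z => G.apply_one _)
      (fun z t => (G.eq_fst t (hbd z)))
      (fun z => (a.2 _ (hbd z)).trans (b.2 _ (hbd z)).symm)
    refine _root_.Quotient.sound ⟨⟨⟨⟨fun p => F (Θ p.2, p.1), by fun_prop⟩, fun z => ?_, fun z => ?_⟩, ?_⟩⟩
    · change F (Θ z, 0) = _
      rw [F0]; change a.1 (Θ.symm (Θ z)) = _; rw [Θ.symm_apply_apply]
    · change F (Θ z, 1) = _
      rw [F1]; change b.1 (Θ.symm (Θ z)) = _; rw [Θ.symm_apply_apply]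
    · intro t z hz
      have hz' := (hΘ z).2 hz
      change F (Θ z, t) = a.1 z
      rw [← incl_mkS _ hz', Fb, incl_mkS]
      change a.1 (Θ.symm (Θ z)) = _; rw [Θ.symm_apply_apply]
  · obtain ⟨Θ, hΘ⟩ := exists_cubeHomeo n
    have hbd : ∀ z : diskBoundary n, Θ.symm (diskBoundaryInclusion n z) ∈ Cube.boundary (Fin n) := by
      intro z; rw [← hΘ, Θ.apply_symm_apply]; exact sph_norm z
    intro b
    induction b using _root_.Quotient.inductionOn with | _ b =>
    obtain ⟨a, κ, ha, hκ, h0, h1⟩ := H n (.const _ x) (.const _ (h x))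
      (b.1.comp ⟨Θ.symm, Θ.symm.continuous⟩) (fun z => rfl) (fun z => (b.2 _ (hbd z)).symm)
    have hab : ∀ z ∈ Cube.boundary (Fin n), a (Θ z) = x := by
      intro z hz
      rw [← incl_mkS _ ((hΘ z).2 hz), ha]; rfl
    refine ⟨_root_.Quotient.mk _ ⟨a.comp ⟨Θ, Θ.continuous⟩, hab⟩, _root_.Quotient.sound
      ⟨⟨⟨⟨fun p => κ (Θ p.2, p.1), by fun_prop⟩, fun z => ?_, fun z => ?_⟩, ?_⟩⟩⟩
    · change κ (Θ z, 0) = _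
      rw [h0]; rfl
    · change κ (Θ z, 1) = _
      rw [h1]; change b.1 (Θ.symm (Θ z)) = _; rw [Θ.symm_apply_apply]
    · intro t z hz
      change κ (Θ z, t) = h (a (Θ z))
      rw [← incl_mkS _ ((hΘ z).2 hz), hκ, ha]; rfl

end PartA3

section PartA4
open Set Metric Topology

local notation "II" => unitInterval

/-- auxiliary vector -/
noncomputable def thetaVec {m : ℕ} (x : EuclideanSpace ℝ (Fin m)) : EuclideanSpace ℝ (Fin (m+1)) :=
  WithLp.toLp 2 (Fin.cons (2 * ‖x‖^2 - 1) (fun i => 2 * Real.sqrt (1 - ‖x‖^2) * x i) : Fin (m+1) → ℝ)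

theorem norm_sq_cons {m : ℕ} (c : ℝ) (v : Fin m → ℝ) :
    ‖(WithLp.toLp 2 (Fin.cons c v : Fin (m+1) → ℝ) : EuclideanSpace ℝ (Fin (m+1)))‖^2
      = c^2 + ∑ i, (v i)^2 := by
  rw [EuclideanSpace.norm_sq_eq, Fin.sum_univ_succ]
  simp

theorem norm_thetaVec {m : ℕ} (x : EuclideanSpace ℝ (Fin m)) (hx : ‖x‖ ≤ 1) : ‖thetaVec x‖ = 1 := by
  have h : ‖thetaVec x‖^2 = 1 := by
    unfold thetaVec
    rw [norm_sq_cons]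
    have h1 : 0 ≤ 1 - ‖x‖^2 := by nlinarith [norm_nonneg x]
    have h2 : ∑ i, (2 * Real.sqrt (1 - ‖x‖^2) * x i)^2 = 4 * (1 - ‖x‖^2) * ‖x‖^2 := by
      rw [EuclideanSpace.norm_sq_eq x]
      rw [Finset.mul_sum]
      refine Finset.sum_congr rfl fun i _ => ?_
      rw [mul_pow, mul_pow, Real.sq_sqrt (by rwa [← EuclideanSpace.norm_sq_eq]), Real.norm_eq_abs, sq_abs]
      ring
    rw [h2]; ring
  nlinarith [norm_nonneg (thetaVec x)]

theorem continuous_thetaVec {m : ℕ} : Continuous (thetaVec (m := m)) := by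
  unfold thetaVec
  refine (PiLp.continuous_toLp 2 _).comp (continuous_pi fun i => ?_)
  refine Fin.cases ?_ (fun i => ?_) i
  · simp only [Fin.cons_zero]; fun_prop
  · simp only [Fin.cons_succ]; fun_prop

/-- north pole -/
noncomputable def northPole (m : ℕ) : EuclideanSpace ℝ (Fin (m+1)) :=
  WithLp.toLp 2 (Fin.cons 1 (fun i => 0) : Fin (m+1) → ℝ)

theorem norm_northPole (m : ℕ) : ‖northPole m‖ = 1 := by
  have h : ‖northPole m‖^2 = 1 := by unfold northPole; rw [norm_sq_cons]; simp
  nlinarith [norm_nonneg (northPole m)]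

theorem thetaVec_of_norm {m : ℕ} (x : EuclideanSpace ℝ (Fin m)) (hx : ‖x‖ = 1) :
    thetaVec x = northPole m := by
  unfold thetaVec northPole
  rw [hx]; norm_num

/-- the collapse `D^m → S^m` -/
noncomputable def theta {m : ℕ} (x : closedDisk m) : diskBoundary (m+1) :=
  mkS (thetaVec x.1) (norm_thetaVec x.1 (disk_norm_le x))

theorem continuous_theta {m : ℕ} : Continuous (theta (m := m)) :=
  Continuous.subtype_mk (continuous_thetaVec.comp continuous_subtype_val) _

theorem thetaVec_inj {m : ℕ} (x y : EuclideanSpace ℝ (Fin m)) (hx : ‖x‖ ≤ 1)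
    (h : thetaVec x = thetaVec y) : ‖x‖ = ‖y‖ ∧ (‖x‖ < 1 → x = y) := by
  have h0 := congrArg (fun v : EuclideanSpace ℝ (Fin (m+1)) => v 0) h
  simp only [thetaVec, PiLp.toLp_apply, Fin.cons_zero] at h0
  have hn : ‖x‖ = ‖y‖ := by
    have h1 : ‖x‖^2 = ‖y‖^2 := by linarith
    exact (sq_eq_sq₀ (norm_nonneg _) (norm_nonneg _)).1 h1
  refine ⟨hn, fun hlt => ?_⟩
  ext i
  have hi := congrArg (fun v : EuclideanSpace ℝ (Fin (m+1)) => v i.succ) h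
  simp only [thetaVec, PiLp.toLp_apply, Fin.cons_succ] at hi
  rw [← hn] at hi
  have hpos : 0 < Real.sqrt (1 - ‖x‖^2) := Real.sqrt_pos.2 (by nlinarith [norm_nonneg x])
  exact mul_left_cancel₀ (by positivity) hi

theorem thetaVec_eq_north {m : ℕ} (x : EuclideanSpace ℝ (Fin m))
    (h : thetaVec x = northPole m) : ‖x‖ = 1 := by
  have h0 := congrArg (fun v : EuclideanSpace ℝ (Fin (m+1)) => v 0) h
  simp only [thetaVec, northPole, PiLp.toLp_apply, Fin.cons_zero] at h0
  nlinarith [norm_nonneg x]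

theorem theta_surj {m : ℕ} (y : diskBoundary (m+1)) :
    y.1 = northPole m ∨ ∃ x, theta x = y := by
  have hy : ‖y.1‖^2 = 1 := by rw [sph_norm]; norm_num
  set c : ℝ := y.1 0 with hc
  have hyc : y.1 = WithLp.toLp 2 (Fin.cons c (fun i => y.1 (Fin.succ i)) : Fin (m+1) → ℝ) := by
    ext i
    refine Fin.cases ?_ (fun i => ?_) i <;> simp [hc]
  have hsum : c^2 + ∑ i : Fin m, (y.1 i.succ)^2 = 1 := by
    rw [← norm_sq_cons c (fun i => y.1 (Fin.succ i)), ← hyc, hy]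
  have hsn : 0 ≤ ∑ i : Fin m, (y.1 i.succ)^2 := Finset.sum_nonneg fun i _ => sq_nonneg _
  by_cases hc1 : c = 1
  · left
    rw [hyc, northPole, hc1]
    congr 1
    have h0 : ∑ i : Fin m, (y.1 i.succ)^2 = 0 := by rw [hc1] at hsum; linarith
    rw [Finset.sum_eq_zero_iff_of_nonneg (fun i _ => sq_nonneg _)] at h0
    congr 1
    funext i
    exact pow_eq_zero_iff (two_ne_zero) |>.1 (h0 i (Finset.mem_univ i))
  · right
    have hcle : c < 1 := lt_of_le_of_ne (by nlinarith) hc1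
    have hcge : -1 ≤ c := by nlinarith
    set ρ := Real.sqrt ((1 - c)/2) with hρ
    have hρ2 : ρ^2 = (1 - c)/2 := Real.sq_sqrt (by linarith)
    have hρp : 0 < ρ := Real.sqrt_pos.2 (by linarith)
    let x : EuclideanSpace ℝ (Fin m) := WithLp.toLp 2 (fun i => y.1 i.succ / (2 * ρ))
    have hx : ‖x‖^2 = (1 + c)/2 := by
      rw [EuclideanSpace.norm_sq_eq]
      have : ∀ i, ‖x i‖^2 = (y.1 i.succ)^2 / (4 * ((1-c)/2)) := by
        intro i
        simp only [x, PiLp.toLp_apply, Real.norm_eq_abs, sq_abs]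
        rw [div_pow, mul_pow, hρ2]; norm_num
      simp_rw [this]
      rw [← Finset.sum_div, show ∑ i : Fin m, (y.1 i.succ)^2 = (1 - c) * (1 + c) by linarith]
      have : 1 - c ≠ 0 := by linarith
      field_simp; ring
    refine ⟨mkD x (by nlinarith [norm_nonneg x]), Subtype.ext ?_⟩
    change thetaVec x = y.1
    rw [hyc, thetaVec, hx]
    congr 1
    rw [show 1 - (1 + c)/2 = (1-c)/2 by ring, ← hρ, show 2 * ((1+c)/2) - 1 = c by ring]
    congr 1
    funext i
    simp only [x, PiLp.toLp_apply]
    field_simp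

theorem help_const {A B : Type*} [TopologicalSpace A] [TopologicalSpace B] (h : C(A, B))
    (hw : IsWeakHomotopyEquiv h) (n : ℕ) (x0 : A) : HelpAt h n (.const _ x0) := by
  obtain ⟨Θ, hΘ⟩ := exists_cubeHomeo n
  refine relHelp h n _ fun b1 hb1 => ?_
  have hbd : ∀ z : diskBoundary n, Θ.symm (diskBoundaryInclusion n z) ∈ Cube.boundary (Fin n) := by
    intro z; rw [← hΘ, Θ.apply_symm_apply]; exact sph_norm z
  obtain ⟨f, hf⟩ := (hw.2 x0 n).2 (_root_.Quotient.mk _ ⟨b1.comp ⟨Θ, Θ.continuous⟩, fun z hz => by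
    change b1 (Θ z) = _
    rw [← incl_mkS _ ((hΘ z).2 hz), hb1]; rfl⟩)
  induction f using _root_.Quotient.inductionOn with | _ f =>
  obtain ⟨G⟩ := _root_.Quotient.exact hf
  refine ⟨f.1.comp ⟨Θ.symm, Θ.symm.continuous⟩, ⟨fun p => G (p.2, Θ.symm p.1), by fun_prop⟩,
    fun z => f.2 _ (hbd z), fun z t => ?_, fun z => G.apply_zero _, fun z => ?_⟩
  · change G (t, _) = _
    refine (G.eq_fst t (hbd z)).trans ?_
    change h (f.1 _) = _
    rw [f.2 _ (hbd z)]; rfl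
  · refine (G.apply_one _).trans ?_
    change b1 (Θ (Θ.symm z)) = _
    rw [Θ.apply_symm_apply]

theorem help_of_weq {A B : Type*} [TopologicalSpace A] [TopologicalSpace B] (h : C(A, B))
    (hw : IsWeakHomotopyEquiv h) : HelpAll h := by
  intro n g
  cases n with
  | zero =>
    have hS0 : IsEmpty (diskBoundary 0) := ⟨fun x => by
      have := sph_norm x
      rw [Subsingleton.elim x.1 0] at this; simp at this⟩
    let o : closedDisk 0 := mkD 0 (by simp)
    refine relHelp h 0 g fun b1 _ => ?_
    obtain ⟨a, ha⟩ := hw.1.2 (_root_.Quotient.mk _ (b1 o))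
    induction a using _root_.Quotient.inductionOn with | _ a =>
    obtain ⟨γ⟩ := _root_.Quotient.exact ha
    refine ⟨.const _ a, ⟨fun p => γ p.2, by fun_prop⟩, fun x => hS0.elim x, fun x => hS0.elim x,
      fun x => γ.source, fun x => ?_⟩
    have : x = o := Subtype.ext (Subsingleton.elim _ _)
    rw [this]; exact γ.target
  | succ m =>
    intro k b hk0 hk1
    obtain ⟨b1, -, hb1'⟩ := glue b k hk1
    have hb1 : ∀ x, b1 (diskBoundaryInclusion _ x) = h (g x) := fun x => by
      rw [hb1' x 0 _ (by simp), hk0]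
    obtain ⟨Θ, hΘ⟩ := exists_cubeHomeo m
    let pt : diskBoundary (m+1) := mkS _ (norm_northPole m)
    have hθpt : ∀ x : closedDisk m, ‖x.1‖ = 1 → theta x = pt := fun x hx =>
      Subtype.ext (thetaVec_of_norm _ hx)
    let f : GenLoop (Fin m) A (g pt) := ⟨⟨fun y => g (theta (Θ y)),
      g.continuous.comp (continuous_theta.comp Θ.continuous)⟩, fun y hy => by
        change g (theta (Θ y)) = _
        rw [hθpt _ ((hΘ y).2 hy)]⟩
    let cst : GenLoop (Fin m) A (g pt) := ⟨.const _ (g pt), fun y hy => rfl⟩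
    have hnull : piMap h (Fin m) (g pt) (_root_.Quotient.mk _ f)
        = piMap h (Fin m) (g pt) (_root_.Quotient.mk _ cst) := by
      refine _root_.Quotient.sound ⟨⟨⟨⟨fun p => b1 (mkD ((1 - (p.1:ℝ)) • (theta (Θ p.2)).1 +
        (p.1:ℝ) • pt.1) ?_), ?_⟩, ?_, ?_⟩, ?_⟩⟩
      · refine (norm_add_le _ _).trans ?_
        rw [norm_smul, norm_smul, sph_norm, sph_norm, Real.norm_eq_abs, Real.norm_eq_abs,
          abs_of_nonneg (by linarith [p.1.2.2]), abs_of_nonneg p.1.2.1]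
        linarith
      · refine b1.continuous.comp (Continuous.subtype_mk ?_ _)
        have : Continuous fun p : II × (Fin m → II) => (theta (Θ p.2)).1 :=
          continuous_subtype_val.comp (continuous_theta.comp (Θ.continuous.comp continuous_snd))
        fun_prop
      · intro y
        change b1 _ = h (g (theta (Θ y)))
        rw [← hb1]
        congr 1
        refine Subtype.ext ?_
        simp [mkD]
      · intro y
        change b1 _ = h (g pt)
        rw [← hb1]
        congr 1
        refine Subtype.ext ?_
        simp [mkD]
      · intro t y hy
        change b1 _ = h (g (theta (Θ y)))
        rw [← hb1]
        congr 1
        refine Subtype.ext ?_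
        change (1 - (t:ℝ)) • (theta (Θ y)).1 + (t:ℝ) • pt.1 = (theta (Θ y)).1
        rw [hθpt _ ((hΘ y).2 hy), ← add_smul]; simp
    obtain ⟨Γ⟩ := _root_.Quotient.exact ((hw.2 (g pt) m).1 hnull)
    let K := (closedDisk m ⊕ Unit) × II
    let q : K → diskBoundary (m+1) × II := fun p => (Sum.elim theta (fun _ => pt) p.1, p.2)
    let vv : (closedDisk m ⊕ Unit) → C(II, A) :=
      Sum.elim (fun x => ContinuousMap.curry (⟨fun p => Γ (p.2, Θ.symm p.1), by fun_prop⟩ :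
        C(closedDisk m × II, A)) x) (fun _ => .const _ (g pt))
    have hvv : Continuous vv := Continuous.sumElim (ContinuousMap.continuous _) continuous_const
    have hΓb : ∀ (x : closedDisk m) (t : II), ‖x.1‖ = 1 → Γ (t, Θ.symm x) = g pt := by
      intro x t hx
      have hx' : Θ.symm x ∈ Cube.boundary (Fin m) := by
        rw [← hΘ, Θ.apply_symm_apply]; exact hx
      exact (Γ.eq_fst t hx').trans (f.2 _ hx')
    obtain ⟨c, hc⟩ := descend q
      ((Continuous.sumElim continuous_theta continuous_const).prodMap continuous_id)
      (by
        rintro ⟨y, t⟩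
        rcases theta_surj y with h | ⟨x, hx⟩
        · exact ⟨(Sum.inr (), t), Prod.ext (Subtype.ext h.symm) rfl⟩
        · exact ⟨(Sum.inl x, t), Prod.ext hx rfl⟩)
      (fun p => vv p.1 p.2)
      (continuous_eval.comp ((hvv.comp continuous_fst).prodMk continuous_snd))
      (by
        rintro ⟨x | u, t⟩ ⟨x' | u', t'⟩ hh <;> rw [Prod.ext_iff] at hh <;>
          simp only [q, Sum.elim_inl, Sum.elim_inr] at hh <;> obtain ⟨ha, rfl⟩ := hh
        · obtain ⟨hn, hlt⟩ := thetaVec_inj x.1 x'.1 (disk_norm_le x)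
            (congrArg (fun z : diskBoundary (m+1) => z.1) ha)
          rcases (disk_norm_le x).lt_or_eq with h1 | h1
          · have : x = x' := Subtype.ext (hlt h1)
            rw [this]
          · change Γ (t, Θ.symm x) = Γ (t, Θ.symm x')
            rw [hΓb x t h1, hΓb x' t (by rw [← hn, h1])]
        · exact hΓb x t (thetaVec_eq_north x.1 (congrArg (fun z : diskBoundary (m+1) => z.1) ha))
        · exact (hΓb x' t (thetaVec_eq_north x'.1
            (congrArg (fun z : diskBoundary (m+1) => z.1) ha.symm))).symm
        · rfl)
    refine helpDrag h (m+1) g (.const _ (g pt)) c (fun y => ?_) (fun y => ?_)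
      (help_const h hw (m+1) (g pt)) k b hk0 hk1
    · rcases theta_surj y with h | ⟨x, rfl⟩
      · have : y = pt := Subtype.ext h
        rw [this]; exact hc (Sum.inr (), 0)
      · refine (hc (Sum.inl x, 0)).trans ?_
        refine (Γ.apply_zero _).trans ?_
        change g (theta (Θ (Θ.symm x))) = _
        rw [Θ.apply_symm_apply]
    · rcases theta_surj y with h | ⟨x, rfl⟩
      · have : y = pt := Subtype.ext h
        rw [this]; exact hc (Sum.inr (), 1)
      · exact (hc (Sum.inl x, 1)).trans (Γ.apply_one _)

end PartA4

section PartA5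
open Set Metric Topology

local notation "II" => unitInterval

/-- every map `K → V` can be perturbed off the origin -/
def SmallFor (K V : Type*) [TopologicalSpace K] [NormedAddCommGroup V] : Prop :=
  ∀ (a : C(K, V)) (ε : ℝ), 0 < ε → ∃ a' : C(K, V), (∀ k, ‖a' k - a k‖ < ε) ∧ ∀ k, a' k ≠ 0

theorem small_sphere (n : ℕ) (V : Type*) [NormedAddCommGroup V] [NormedSpace ℝ V]
    [FiniteDimensional ℝ V] (hn : n ≤ Module.finrank ℝ V) : SmallFor (diskBoundary n) V := by
  intro a ε hε
  obtain ⟨σ, hσ⟩ := (finrank_le_iff_exists_linearMap (R := ℝ) (M := EuclideanSpace ℝ (Fin n))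
    (M' := V)).1 (by simpa using hn)
  obtain ⟨π, hπ⟩ := σ.exists_leftInverse_of_injective (LinearMap.ker_eq_bot.2 hσ)
  obtain ⟨A, hA⟩ := ContinuousMap.exists_restrict_eq
    (s := sphere (0 : EuclideanSpace ℝ (Fin n)) 1) isClosed_sphere a
  obtain ⟨f, hf, hfA, -⟩ := A.continuous.exists_contDiff_approx 1 (ε := fun _ => ε/2)
    continuous_const (fun _ => half_pos hε)
  let f' : EuclideanSpace ℝ (Fin n) → EuclideanSpace ℝ (Fin n) := fun x => π (f x)
  have hf' : Differentiable ℝ f' :=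
    (LinearMap.toContinuousLinearMap π).differentiable.comp (hf.differentiable (by simp))
  have hnull := MeasureTheory.addHaar_image_eq_zero_of_differentiableOn_of_addHaar_eq_zero
    MeasureTheory.volume (s := sphere (0 : EuclideanSpace ℝ (Fin n)) 1) hf'.differentiableOn
    (MeasureTheory.Measure.addHaar_sphere_of_ne_zero _ 0 one_ne_zero)
  have hintr := MeasureTheory.Measure.interior_eq_empty_of_null hnull
  have hcont : Continuous σ := LinearMap.continuous_of_finiteDimensional σ
  have hU : IsOpen {w | ‖σ w‖ < ε/2} := isOpen_lt (by fun_prop) continuous_const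
  have hex : ∃ w, ‖σ w‖ < ε/2 ∧ w ∉ Set.image f' (sphere (0 : EuclideanSpace ℝ (Fin n)) 1) := by
    by_contra hcon
    push Not at hcon
    have h1 : {w | ‖σ w‖ < ε/2} ⊆ interior (Set.image f' (sphere (0 : EuclideanSpace ℝ (Fin n)) 1)) :=
      interior_maximal hcon hU
    rw [hintr] at h1
    exact h1 (show (0 : EuclideanSpace ℝ (Fin n)) ∈ {w | ‖σ w‖ < ε/2} by simp [hε])
  obtain ⟨w, hw1, hw2⟩ := hex
  have hfc : Continuous f := hf.continuous
  refine ⟨⟨fun x => f x.1 - σ w, by fun_prop⟩, fun k => ?_, fun k hk => ?_⟩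
  · have h1 := hfA k.1
    have h2 : A k.1 = a k := congrArg (fun z => z k) hA
    rw [h2, dist_eq_norm] at h1
    change ‖f k.1 - σ w - a k‖ < ε
    calc ‖f k.1 - σ w - a k‖ = ‖(f k.1 - a k) - σ w‖ := by congr 1; abel
      _ ≤ ‖f k.1 - a k‖ + ‖σ w‖ := norm_sub_le _ _
      _ < ε := by linarith
  · apply hw2
    refine ⟨k.1, k.2, ?_⟩
    have : f k.1 = σ w := sub_eq_zero.1 hk
    change π (f k.1) = w
    rw [this]
    exact congrArg (fun l => l w) hπ

theorem pushOff {P K V : Type*} [TopologicalSpace P] [T2Space P] [TopologicalSpace K]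
    [CompactSpace K] [T2Space K] [NormedAddCommGroup V] [NormedSpace ℝ V] [FiniteDimensional ℝ V]
    (χ : C(closedBall (0 : V) 1, P)) (hinj : ∀ v w, ‖v.1‖ < 1 → χ v = χ w → v = w)
    (T : Set P) (hT : IsClosed T) (hdis : ∀ v, ‖v.1‖ < 1 → χ v ∉ T)
    (g : C(K, P)) (hg : ∀ k, g k ∈ T ∨ ∃ v, χ v = g k) (hK : SmallFor K V) :
    ∃ H : C(K × II, P), (∀ k, H (k, 0) = g k) ∧
      ∀ k, H (k, 1) ∈ T ∨ ∃ v, ‖v.1‖ = 1 ∧ χ v = H (k, 1) := by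
  haveI : CompactSpace (closedBall (0 : V) 1) := isCompact_iff_compactSpace.1
    (isCompact_closedBall _ _)
  have hle : ∀ v : closedBall (0 : V) 1, ‖v.1‖ ≤ 1 := fun v => mem_closedBall_zero_iff.1 v.2
  let K1 := {p : K × closedBall (0 : V) 1 // g p.1 = χ p.2}
  have hK1 : IsClosed {p : K × closedBall (0 : V) 1 | g p.1 = χ p.2} :=
    isClosed_eq (by fun_prop) (by fun_prop)
  haveI : CompactSpace K1 := isCompact_iff_compactSpace.1 hK1.isCompact
  have ck : Continuous fun p : K1 => p.1.1 := continuous_fst.comp continuous_subtype_val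
  have cv : Continuous fun p : K1 => p.1.2.1 :=
    continuous_subtype_val.comp (continuous_snd.comp continuous_subtype_val)
  let K2 := {p : K1 // ‖p.1.2.1‖ ≤ 3/4}
  have hK2 : IsClosed {p : K1 | ‖p.1.2.1‖ ≤ 3/4} := isClosed_le (by fun_prop) continuous_const
  haveI : CompactSpace K2 := isCompact_iff_compactSpace.1 hK2.isCompact
  have hcl : IsClosedEmbedding (fun p : K2 => p.1.1.1) := by
    refine Continuous.isClosedEmbedding (ck.comp continuous_subtype_val) ?_
    intro p p' h
    have h : p.1.1.1 = p'.1.1.1 := h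
    refine Subtype.ext (Subtype.ext (Prod.ext h ?_))
    refine hinj _ _ (lt_of_le_of_lt p.2 (by norm_num)) ?_
    rw [← p.1.2, ← p'.1.2, h]
  obtain ⟨a, ha⟩ := ContinuousMap.exists_extension' hcl
    (⟨fun p => p.1.1.2.1, cv.comp continuous_subtype_val⟩ : C(K2, V))
  have ha : ∀ (p : K1), ‖p.1.2.1‖ ≤ 3/4 → a p.1.1 = p.1.2.1 := fun p hp => congrFun ha ⟨p, hp⟩
  obtain ⟨a', haa', ha'⟩ := hK a (1/4) (by norm_num)
  let μ : V → ℝ := fun v => max 0 (min 1 (3 - 4 * ‖v‖))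
  have hμ : Continuous μ := by fun_prop
  have hμ0 : ∀ v, 3/4 ≤ ‖v‖ → μ v = 0 := fun v hv => by
    simp only [μ]; rw [min_eq_right (by linarith), max_eq_left (by linarith)]
  have hμ1 : ∀ v, ‖v‖ ≤ 1/2 → μ v = 1 := fun v hv => by
    simp only [μ]; rw [min_eq_left (by linarith), max_eq_right (by linarith)]
  have hμn : ∀ v, 0 ≤ μ v := fun v => le_max_left _ _
  have hμle : ∀ v, μ v ≤ 1 := fun v => max_le (by norm_num) (min_le_left _ _)
  let v1 : K1 → V := fun p => p.1.2.1 + μ p.1.2.1 • (a' p.1.1 - p.1.2.1)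
  have hv1c : Continuous v1 := by fun_prop
  have hv1 : ∀ p, v1 p ≠ 0 := by
    intro p
    by_cases h1 : ‖p.1.2.1‖ ≤ 1/2
    · have : v1 p = a' p.1.1 := by simp only [v1]; rw [hμ1 _ h1]; simp
      rw [this]; exact ha' _
    · by_cases h2 : ‖p.1.2.1‖ ≤ 3/4
      · intro h0
        have h3 : p.1.2.1 = - (μ p.1.2.1 • (a' p.1.1 - p.1.2.1)) := eq_neg_of_add_eq_zero_left h0
        have h4 : ‖p.1.2.1‖ ≤ 1/4 := by
          rw [h3, norm_neg, norm_smul, ← ha p h2, Real.norm_eq_abs, abs_of_nonneg (hμn _)]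
          have := haa' p.1.1
          nlinarith [hμn (a p.1.1), hμle (a p.1.1), norm_nonneg (a' p.1.1 - a p.1.1)]
        linarith
      · have : v1 p = p.1.2.1 := by simp only [v1]; rw [hμ0 _ (by linarith)]; simp
        rw [this]
        intro h0; rw [h0] at h2; simp at h2; linarith
  have hv1' : ∀ p : K1, ‖p.1.2.1‖ = 1 → v1 p = p.1.2.1 := by
    intro p hp; simp only [v1]; rw [hμ0 _ (by rw [hp]; norm_num)]; simp
  let F : K1 × II → closedBall (0 : V) 1 := fun q =>
    ⟨(1 - (q.2:ℝ)) • q.1.1.2.1 + (q.2:ℝ) • (‖v1 q.1‖⁻¹ • v1 q.1), by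
      rw [mem_closedBall_zero_iff]
      refine (norm_add_le _ _).trans ?_
      rw [norm_smul, norm_smul, norm_smul, norm_inv, norm_norm,
        inv_mul_cancel₀ (norm_ne_zero_iff.2 (hv1 _)), Real.norm_eq_abs, Real.norm_eq_abs,
        abs_of_nonneg (by linarith [q.2.2.2]), abs_of_nonneg q.2.2.1]
      nlinarith [hle q.1.1.2, q.2.2.1, q.2.2.2]⟩
  have hF : Continuous F := by
    refine Continuous.subtype_mk ?_ _
    have c1 : Continuous fun q : K1 × II => v1 q.1 := hv1c.comp continuous_fst
    have c2 : Continuous fun q : K1 × II => (q.2 : ℝ) := continuous_subtype_val.comp continuous_snd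
    have c3 : Continuous fun q : K1 × II => q.1.1.2.1 := cv.comp continuous_fst
    exact ((continuous_const.sub c2).smul c3).add (c2.smul ((c1.norm.inv₀ fun q =>
      norm_ne_zero_iff.2 (hv1 _)).smul c1))
  have hF1 : ∀ (p : K1) t, ‖p.1.2.1‖ = 1 → F (p, t) = p.1.2 := by
    intro p t hp
    refine Subtype.ext ?_
    simp only [F]
    rw [hv1' p hp, hp]
    simp [← add_smul]
  let KT := {k : K // g k ∈ T}
  haveI : CompactSpace KT := isCompact_iff_compactSpace.1 (hT.preimage g.continuous).isCompact
  obtain ⟨H, hH⟩ := descend (K := (KT × II) ⊕ (K1 × II)) (L := K × II)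
    (Sum.elim (fun p => (p.1.1, p.2)) (fun p => (p.1.1.1, p.2)))
    (Continuous.sumElim ((continuous_subtype_val.comp continuous_fst).prodMk continuous_snd)
      ((ck.comp continuous_fst).prodMk continuous_snd)) (by
      rintro ⟨k, t⟩
      rcases hg k with h | ⟨v, hv⟩
      · exact ⟨Sum.inl (⟨k, h⟩, t), rfl⟩
      · exact ⟨Sum.inr (⟨(k, v), hv.symm⟩, t), rfl⟩)
    (Sum.elim (fun p => g p.1.1) (fun p => χ (F p)))
    (Continuous.sumElim (g.continuous.comp (continuous_subtype_val.comp continuous_fst))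
      (χ.continuous.comp hF)) (by
      have key : ∀ (k : KT) (p : K1) (t : II), k.1 = p.1.1 → g k.1 = χ (F (p, t)) := by
        intro k p t h
        have h1 : ‖p.1.2.1‖ = 1 := by
          by_contra hne
          refine hdis p.1.2 (lt_of_le_of_ne (hle _) hne) ?_
          rw [← p.2, ← h]; exact k.2
        rw [hF1 p t h1, ← p.2, h]
      rintro (⟨k, t⟩ | ⟨p, t⟩) (⟨k', t'⟩ | ⟨p', t'⟩) hh <;> rw [Prod.ext_iff] at hh <;>
        simp only [Sum.elim_inl, Sum.elim_inr] at hh ⊢ <;> obtain ⟨hh, rfl⟩ := hh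
      · rw [hh]
      · exact key k p' t hh
      · exact (key k' p t hh.symm).symm
      · have h2 : χ p.1.2 = χ p'.1.2 := by rw [← p.2, ← p'.2, hh]
        by_cases h3 : ‖p.1.2.1‖ = 1 ∧ ‖p'.1.2.1‖ = 1
        · rw [hF1 p t h3.1, hF1 p' t h3.2, h2]
        · have h4 : p.1.2 = p'.1.2 := by
            rw [not_and_or] at h3
            rcases h3 with h3 | h3
            · exact hinj _ _ (lt_of_le_of_ne (hle _) h3) h2
            · exact (hinj _ _ (lt_of_le_of_ne (hle _) h3) h2.symm).symm
          have : p = p' := Subtype.ext (Prod.ext hh h4)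
          rw [this])
  refine ⟨H, fun k => ?_, fun k => ?_⟩
  · rcases hg k with h | ⟨v, hv⟩
    · exact hH (Sum.inl (⟨k, h⟩, 0))
    · refine (hH (Sum.inr (⟨(k, v), hv.symm⟩, 0))).trans ?_
      change χ (F _) = g k
      refine Eq.trans ?_ hv
      congr 1
      refine Subtype.ext ?_
      simp [F]
  · rcases hg k with h | ⟨v, hv⟩
    · left
      rw [show H (k, 1) = g k from hH (Sum.inl (⟨k, h⟩, 1))]; exact h
    · right
      refine ⟨F (⟨(k, v), hv.symm⟩, 1), ?_, (hH (Sum.inr (⟨(k, v), hv.symm⟩, 1))).symm⟩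
      simp only [F]
      simp [norm_smul, hv1]

end PartA5

section PartB1
open Set Metric Topology
local notation "II" => unitInterval

theorem Flow.cont_comp (X : Flow) {Z : Type*} [TopologicalSpace Z] {f g : Z → X.Path}
    (hf : Continuous f) (hg : Continuous g) (h : ∀ z, X.t (f z) = X.s (g z)) :
    Continuous fun z => X.comp (f z) (g z) (h z) :=
  X.continuous_comp.comp (Continuous.subtype_mk (hf.prodMk hg) h)

theorem Flow.cont_s (X : Flow) : Continuous X.s :=
  continuous_discrete_rng.2 X.isOpen_preimage_s

theorem Flow.cont_t (X : Flow) : Continuous X.t :=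
  continuous_discrete_rng.2 X.isOpen_preimage_t

theorem Flow.isOpen_pre_s (X : Flow) {Z : Type*} [TopologicalSpace Z] {f : Z → X.Path}
    (hf : Continuous f) (a : X.State) : IsOpen ((fun z => X.s (f z)) ⁻¹' {a}) :=
  (X.isOpen_preimage_s a).preimage hf

theorem Flow.isOpen_pre_t (X : Flow) {Z : Type*} [TopologicalSpace Z] {f : Z → X.Path}
    (hf : Continuous f) (a : X.State) : IsOpen ((fun z => X.t (f z)) ⁻¹' {a}) :=
  (X.isOpen_preimage_t a).preimage hf

theorem Flow.s_path (X : Flow) (γ : C(II, X.Path)) (u v : II) : X.s (γ u) = X.s (γ v) :=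
  PreconnectedSpace.constant inferInstance (X.cont_s.comp γ.continuous)

theorem Flow.t_path (X : Flow) (γ : C(II, X.Path)) (u v : II) : X.t (γ u) = X.t (γ v) :=
  PreconnectedSpace.constant inferInstance (X.cont_t.comp γ.continuous)

theorem FlowHom.cong_comp {X : Flow} {x x' y y' : X.Path} (h : X.t x = X.s y) (h' : X.t x' = X.s y')
    (hx : x = x') (hy : y = y') : X.comp x y h = X.comp x' y' h' := by
  subst hx; subst hy; rfl

theorem FlowHom.composable {X Y : Flow} (f : FlowHom X Y) {x y : X.Path} (h : X.t x = X.s y) :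
    Y.t (f.toFunP x) = Y.s (f.toFunP y) := by rw [f.t_map, f.s_map, h]

/-- The flow of paths in path spaces. -/
def PathFlow (X : Flow) : Flow where
  State := X.State
  Path := C(II, X.Path)
  s γ := X.s (γ 0)
  t γ := X.t (γ 0)
  isOpen_preimage_s a := X.isOpen_pre_s (continuous_eval_const (0 : II)) a
  isOpen_preimage_t a := X.isOpen_pre_t (continuous_eval_const (0 : II)) a
  comp γ δ h := ⟨fun u => X.comp (γ u) (δ u) (by rw [X.t_path γ u 0, h, X.s_path δ 0 u]),
    X.cont_comp γ.continuous δ.continuous _⟩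
  continuous_comp := by
    refine ContinuousMap.continuous_of_continuous_uncurry _ ?_
    refine X.cont_comp (f := fun z : {p : C(II, X.Path) × C(II, X.Path) //
        X.t (p.1 0) = X.s (p.2 0)} × II => z.1.1.1 z.2) (g := fun z => z.1.1.2 z.2) ?_ ?_ ?_
    · exact continuous_eval.comp ((continuous_fst.comp (continuous_subtype_val.comp
        continuous_fst)).prodMk continuous_snd)
    · exact continuous_eval.comp ((continuous_snd.comp (continuous_subtype_val.comp
        continuous_fst)).prodMk continuous_snd)
  s_comp γ δ h := X.s_comp _ _ _
  t_comp γ δ h := X.t_comp _ _ _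
  comp_assoc x y z hxy hyz h1 h2 := ContinuousMap.ext fun u => X.comp_assoc _ _ _ _ _ _ _

/-- evaluation at a time -/
def evF (X : Flow) (u : II) : FlowHom (PathFlow X) X where
  toFun0 := _root_.id
  toFunP γ := (show C(II, X.Path) from γ) u
  continuous_toFunP := continuous_eval_const (F := C(II, X.Path)) u
  s_map γ := X.s_path γ u 0
  t_map γ := X.t_path γ u 0
  comp_map x y h h' := rfl

/-- constant paths -/
def constF (X : Flow) : FlowHom X (PathFlow X) where
  toFun0 := _root_.id
  toFunP x := ContinuousMap.const II x
  continuous_toFunP := ContinuousMap.continuous_const'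
  s_map γ := rfl
  t_map γ := rfl
  comp_map x y h h' := rfl

/-- functoriality -/
def mapF {X Y : Flow} (f : FlowHom X Y) : FlowHom (PathFlow X) (PathFlow Y) where
  toFun0 := f.toFun0
  toFunP γ := f.pathMap.comp γ
  continuous_toFunP := ContinuousMap.continuous_postcomp _
  s_map γ := f.s_map _
  t_map γ := f.t_map _
  comp_map x y h h' := ContinuousMap.ext fun u => f.comp_map _ _ _ _

/-- S-homotopy as right homotopy -/
theorem sHomotopy_iff {X Y : Flow} {f g : FlowHom X Y} :
    SHomotopy f g ↔ ∃ H : FlowHom X (PathFlow Y), (evF Y 0).comp H = f ∧ (evF Y 1).comp H = g := by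
  constructor
  · rintro ⟨F, rfl, rfl, hP, h0⟩
    have hst : ∀ u v, (F u).toFun0 = (F v).toFun0 := fun u v => by
      funext x
      exact PreconnectedSpace.constant (f := fun u : II => (F u).toFun0 x) inferInstance
        (h0.comp (Continuous.prodMk_right x))
    refine ⟨⟨(F 0).toFun0, fun x => ⟨fun u => (F u).toFunP x, hP.comp (Continuous.prodMk_right x)⟩,
      ContinuousMap.continuous_of_continuous_uncurry _ hP, fun x => (F 0).s_map x,
      fun x => (F 0).t_map x, fun x y h h' => ContinuousMap.ext fun u => (F u).comp_map _ _ _ _⟩,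
      rfl, FlowHom.ext (hst 0 1) rfl⟩
  · rintro ⟨H, rfl, rfl⟩
    refine ⟨fun u => (evF Y u).comp H, rfl, rfl, ?_, ?_⟩
    · have : Continuous fun p : X.Path × II => ((show C(II, Y.Path) from H.toFunP p.1), p.2) :=
        (H.continuous_toFunP.comp continuous_fst).prodMk continuous_snd
      exact continuous_eval.comp this
    · exact (continuous_of_discreteTopology (f := H.toFun0)).comp continuous_fst

theorem sHomotopy_refl {X Y : Flow} (f : FlowHom X Y) : SHomotopy f f :=
  sHomotopy_iff.2 ⟨(constF Y).comp f, rfl, rfl⟩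

theorem sHomotopy_symm {X Y : Flow} {f g : FlowHom X Y} (h : SHomotopy f g) : SHomotopy g f := by
  obtain ⟨F, h0, h1, hP, hS⟩ := h
  refine ⟨fun u => F (unitInterval.symm u), by simpa using h1, by simpa using h0, ?_, ?_⟩
  · exact hP.comp (continuous_fst.prodMk (unitInterval.continuous_symm.comp continuous_snd))
  · exact hS.comp (continuous_fst.prodMk (unitInterval.continuous_symm.comp continuous_snd))

theorem sHomotopy_trans {X Y : Flow} {f g k : FlowHom X Y} (h : SHomotopy f g)
    (h' : SHomotopy g k) : SHomotopy f k := by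
  obtain ⟨F, F0, F1, FP, FS⟩ := h
  obtain ⟨G, G0, G1, GP, GS⟩ := h'
  obtain ⟨W, hW1, hW2⟩ := concat (⟨fun p => (F p.2).toFunP p.1, FP⟩ : C(X.Path × II, Y.Path))
    ⟨fun p => (G p.2).toFunP p.1, GP⟩ (by intro z; simp [F1, G0])
  obtain ⟨W', hW1', hW2'⟩ := concat (⟨fun p => (F p.2).toFun0 p.1, FS⟩ : C(X.State × II, Y.State))
    ⟨fun p => (G p.2).toFun0 p.1, GS⟩ (by intro z; simp [F1, G0])
  have key : ∀ u : II, ∃ K : FlowHom X Y, (∀ x, K.toFunP x = W (x, u)) ∧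
      ∀ x, K.toFun0 x = W' (x, u) := by
    intro u
    have hu := u.2
    rcases le_total (u : ℝ) (1/2) with hle | hle
    · have e : (u : ℝ) = ((⟨2 * u, by linarith [hu.1], by linarith⟩ : II) : ℝ) / 2 := by
        show (u : ℝ) = 2 * u / 2
        ring
      exact ⟨F _, fun x => (hW1 x _ u e).symm, fun x => (hW1' x _ u e).symm⟩
    · have e : (u : ℝ) = (1 + ((⟨2 * u - 1, by linarith, by linarith [hu.2]⟩ : II) : ℝ)) / 2 := by
        show (u : ℝ) = (1 + (2 * u - 1)) / 2
        ring
      exact ⟨G _, fun x => (hW2 x _ u e).symm, fun x => (hW2' x _ u e).symm⟩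
  choose K hKP hK0 using key
  refine ⟨K, ?_, ?_, ?_, ?_⟩
  · rw [← F0]
    exact FlowHom.ext (funext fun x => (hK0 0 x).trans (hW1' x 0 0 (by simp)))
      (funext fun x => (hKP 0 x).trans (hW1 x 0 0 (by simp)))
  · rw [← G1]
    exact FlowHom.ext (funext fun x => (hK0 1 x).trans (hW2' x 1 1 (by norm_num)))
      (funext fun x => (hKP 1 x).trans (hW2 x 1 1 (by norm_num)))
  · simp only [hKP]; exact W.continuous
  · simp only [hK0]; exact W'.continuous

theorem sHomotopy_post {X Y Z : Flow} {f g : FlowHom X Y} (h : SHomotopy f g) (k : FlowHom Y Z) :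
    SHomotopy (k.comp f) (k.comp g) := by
  obtain ⟨H, rfl, rfl⟩ := sHomotopy_iff.1 h
  exact sHomotopy_iff.2 ⟨(mapF k).comp H, rfl, rfl⟩

theorem sHomotopy_pre {X Y Z : Flow} {f g : FlowHom Y Z} (h : SHomotopy f g) (k : FlowHom X Y) :
    SHomotopy (f.comp k) (g.comp k) := by
  obtain ⟨H, rfl, rfl⟩ := sHomotopy_iff.1 h
  exact sHomotopy_iff.2 ⟨H.comp k, rfl, rfl⟩

/-- pullback flow -/
def PB {X Y Z : Flow} (f : FlowHom X Z) (g : FlowHom Y Z) (r : X.State → Y.State)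
    (hg : Function.Injective g.toFun0) (hr : ∀ x, g.toFun0 (r x) = f.toFun0 x) : Flow where
  State := X.State
  Path := {p : X.Path × Y.Path // f.toFunP p.1 = g.toFunP p.2}
  s p := X.s p.1.1
  t p := X.t p.1.1
  isOpen_preimage_s a := X.isOpen_pre_s (continuous_fst.comp continuous_subtype_val) a
  isOpen_preimage_t a := X.isOpen_pre_t (continuous_fst.comp continuous_subtype_val) a
  comp p q h := by
    have h' : Y.t p.1.2 = Y.s q.1.2 := by
      apply hg
      rw [← g.t_map, ← g.s_map, ← p.2, ← q.2, f.t_map, f.s_map, h]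
    refine ⟨(X.comp p.1.1 q.1.1 h, Y.comp p.1.2 q.1.2 h'), ?_⟩
    show f.toFunP (X.comp p.1.1 q.1.1 h) = g.toFunP (Y.comp p.1.2 q.1.2 h')
    rw [f.comp_map _ _ h (f.composable h), g.comp_map _ _ h' (g.composable h')]
    exact FlowHom.cong_comp _ _ p.2 q.2
  continuous_comp := by
    refine Continuous.subtype_mk (Continuous.prodMk ?_ ?_) _
    · refine X.cont_comp (continuous_fst.comp (continuous_subtype_val.comp
        (continuous_fst.comp continuous_subtype_val))) (continuous_fst.comp (continuous_subtype_val.comp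
        (continuous_snd.comp continuous_subtype_val))) _
    · refine Y.cont_comp (continuous_snd.comp (continuous_subtype_val.comp
        (continuous_fst.comp continuous_subtype_val))) (continuous_snd.comp (continuous_subtype_val.comp
        (continuous_snd.comp continuous_subtype_val))) _
  s_comp _ _ _ := X.s_comp _ _ _
  t_comp _ _ _ := X.t_comp _ _ _
  comp_assoc x y z _ _ _ _ := Subtype.ext (Prod.ext (X.comp_assoc _ _ _ _ _ _ _)
    (Y.comp_assoc _ _ _ _ _ _ _))

section
variable {X Y Z : Flow} (f : FlowHom X Z) (g : FlowHom Y Z) (r : X.State → Y.State)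
    (hg : Function.Injective g.toFun0) (hr : ∀ x, g.toFun0 (r x) = f.toFun0 x)

/-- first projection -/
def PB.fst : FlowHom (PB f g r hg hr) X where
  toFun0 := _root_.id
  toFunP p := p.1.1
  continuous_toFunP := continuous_fst.comp continuous_subtype_val
  s_map _ := rfl
  t_map _ := rfl
  comp_map _ _ _ _ := rfl

/-- second projection -/
def PB.snd : FlowHom (PB f g r hg hr) Y where
  toFun0 := r
  toFunP p := p.1.2
  continuous_toFunP := continuous_snd.comp continuous_subtype_val
  s_map p := by
    apply hg
    exact (g.s_map _).symm.trans ((congrArg Z.s p.2.symm).trans ((f.s_map _).trans (hr _).symm))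
  t_map p := by
    apply hg
    exact (g.t_map _).symm.trans ((congrArg Z.t p.2.symm).trans ((f.t_map _).trans (hr _).symm))
  comp_map _ _ _ _ := rfl

/-- induced map -/
def PB.lift {W : Flow} (a : FlowHom W X) (b : FlowHom W Y) (hab : f.comp a = g.comp b) :
    FlowHom W (PB f g r hg hr) where
  toFun0 := a.toFun0
  toFunP w := ⟨(a.toFunP w, b.toFunP w), congrFun (congrArg FlowHom.toFunP hab) w⟩
  continuous_toFunP := Continuous.subtype_mk (a.continuous_toFunP.prodMk b.continuous_toFunP) _
  s_map w := a.s_map w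
  t_map w := a.t_map w
  comp_map x y h h' := Subtype.ext (Prod.ext (a.comp_map _ _ _ _) (b.comp_map _ _ _ (b.composable h)))

end
end PartB1

section PartC1
open Set Metric Topology
local notation "II" => unitInterval

/-- a morphism from a flow without paths -/
def homOfEmpty {A : Flow} (hA : IsEmpty A.Path) (Z : Flow) (f : A.State → Z.State) : FlowHom A Z where
  toFun0 := f
  toFunP x := (hA.false x).elim
  continuous_toFunP := continuous_of_isEmpty _
  s_map x := (hA.false x).elim
  t_map x := (hA.false x).elim
  comp_map x := (hA.false x).elim

theorem SCofibrantStructure.recur {X : Flow} (S : SCofibrantStructure X) (Z : Flow)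
    (I : ∀ n, FlowHom (S.sk n) Z → Prop) (h0 : ∃ g, I 0 g)
    (hs : ∀ n g, I n g → ∃ g' : FlowHom (S.sk (n+1)) Z, g'.comp (S.ι n) = g ∧ I (n+1) g') :
    ∃ h : FlowHom X Z, ∀ n, I n (h.comp (S.incl n)) := by
  choose nx hnx1 hnx2 using hs
  obtain ⟨g0, hg0⟩ := h0
  let d : ∀ n, {g : FlowHom (S.sk n) Z // I n g} :=
    fun n => Nat.rec ⟨g0, hg0⟩ (fun n g => ⟨nx n g.1 g.2, hnx2 n g.1 g.2⟩) n
  obtain ⟨h, hh, -⟩ := S.isColimit Z (fun n => (d n).1) (fun n => hnx1 n _ (d n).2)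
  exact ⟨h, fun n => by simp only [hh]; exact (d n).2⟩

theorem SCofibrantStructure.homExt {X : Flow} (S : SCofibrantStructure X) {Z : Flow}
    {f g : FlowHom X Z} (h : ∀ n, f.comp (S.incl n) = g.comp (S.incl n)) : f = g :=
  (S.isColimit Z (fun n => g.comp (S.incl n)) (fun n => by
    rw [FlowHom.comp_assoc, S.incl_comm])).unique h (fun n => rfl)

theorem SCofibrantStructure.homExt_sk {X : Flow} (S : SCofibrantStructure X) {Z : Flow} {n : ℕ}
    {f g : FlowHom (S.sk (n+1)) Z} (h : f.comp (S.ι n) = g.comp (S.ι n))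
    (h' : ∀ i, f.comp (S.cellMap n i) = g.comp (S.cellMap n i)) : f = g :=
  (S.attach_isPushout n Z (g.comp (S.ι n)) (fun i => g.comp (S.cellMap n i)) (fun i => by
    rw [FlowHom.comp_assoc, S.attach_comm, FlowHom.comp_assoc])).unique ⟨h, h'⟩ ⟨rfl, fun _ => rfl⟩

/-- morphisms out of globes -/
def globHom {D : Type} [TopologicalSpace D] {Z : Flow} (f : Fin 2 → Z.State) (c : C(D, Z.Path))
    (hs : ∀ x, Z.s (c x) = f 0) (ht : ∀ x, Z.t (c x) = f 1) : FlowHom (Glob D) Z where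
  toFun0 := f
  toFunP := c
  continuous_toFunP := c.continuous
  s_map := hs
  t_map := ht
  comp_map x y h := absurd (show (1 : Fin 2) = 0 from h) (by decide)

theorem liftCof {X E B : Flow} (hX : SCofibrant X) (p : FlowHom E B)
    (hp0 : Function.Bijective p.toFun0) (hp : ∀ n, RLPn p.toFunP n) (f : FlowHom X B) :
    ∃ f' : FlowHom X E, p.comp f' = f := by
  obtain ⟨S⟩ := hX
  suffices hh : ∃ h : FlowHom X E, ∀ n, p.comp (h.comp (S.incl n)) = f.comp (S.incl n) by
    obtain ⟨h, hh⟩ := hh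
    refine ⟨h, S.homExt fun n => ?_⟩
    rw [FlowHom.comp_assoc]; exact hh n
  refine S.recur E (fun n g => p.comp g = f.comp (S.incl n)) ?_ ?_
  · choose r hr using hp0.2
    refine ⟨homOfEmpty S.isEmpty_path_sk_zero _ fun x => r (f.toFun0 ((S.incl 0).toFun0 x)), ?_⟩
    exact FlowHom.ext (funext fun x => hr _)
      (funext fun x => (S.isEmpty_path_sk_zero.false x).elim)
  · intro n g hg
    have key : ∀ i, ∃ k : FlowHom (Glob (closedDisk n)) E,
        k.comp (globBoundaryInclusion n) = g.comp (S.attachMap n i) ∧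
        p.comp k = f.comp ((S.incl (n+1)).comp (S.cellMap n i)) := by
      intro i
      let F := f.comp ((S.incl (n+1)).comp (S.cellMap n i))
      let G := g.comp (S.attachMap n i)
      have hGF : p.comp G = F.comp (globBoundaryInclusion n) := by
        show p.comp (g.comp (S.attachMap n i)) =
          (f.comp ((S.incl (n+1)).comp (S.cellMap n i))).comp (globBoundaryInclusion n)
        rw [← FlowHom.comp_assoc, hg, FlowHom.comp_assoc, FlowHom.comp_assoc, FlowHom.comp_assoc,
          S.attach_comm, ← S.incl_comm n, FlowHom.comp_assoc]
      obtain ⟨a, ha1, ha2⟩ := hp n G.pathMap F.pathMap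
        (fun x => congrFun (congrArg FlowHom.toFunP hGF) x)
      have e0 : ∀ j, p.toFun0 (G.toFun0 j) = F.toFun0 j :=
        fun j => congrFun (congrArg FlowHom.toFun0 hGF) j
      refine ⟨globHom G.toFun0 a (fun x => ?_) (fun x => ?_), ?_, ?_⟩
      · apply hp0.1
        exact (p.s_map _).symm.trans ((congrArg B.s (ha2 x)).trans ((F.s_map x).trans (e0 _).symm))
      · apply hp0.1
        exact (p.t_map _).symm.trans ((congrArg B.t (ha2 x)).trans ((F.t_map x).trans (e0 _).symm))
      · exact FlowHom.ext rfl (funext fun x => ha1 x)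
      · exact FlowHom.ext (funext e0) (funext fun x => ha2 x)
    choose k hk1 hk2 using key
    obtain ⟨g', ⟨hg1, hg2⟩, -⟩ := S.attach_isPushout n E g k hk1
    refine ⟨g', hg1, S.homExt_sk ?_ ?_⟩
    · rw [FlowHom.comp_assoc, hg1, hg, FlowHom.comp_assoc, S.incl_comm]
    · intro i
      rw [FlowHom.comp_assoc, hg2, hk2, FlowHom.comp_assoc]

section
variable {A B : Flow} (h : FlowHom A B)

/-- mapping path flow -/
def EF : Flow := PB h (evF B 0) h.toFun0 (fun _ _ e => e) (fun _ => rfl)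

/-- its endpoint projection -/
def EFp : FlowHom (EF h) B := (evF B 1).comp (PB.snd h (evF B 0) h.toFun0 (fun _ _ e => e) (fun _ => rfl))

theorem EFp_rlp (hw : IsWeakSHomotopyEquiv h) (n : ℕ) : RLPn (EFp h).toFunP n :=
  rlp_of_help h.pathMap n (help_of_weq h.pathMap hw.2 n)

theorem EFp_bij (hw : IsWeakSHomotopyEquiv h) : Function.Bijective (EFp h).toFun0 := hw.1

theorem whiteheadSurj {X : Flow} (hX : SCofibrant X) (hw : IsWeakSHomotopyEquiv h) (f : FlowHom X B) :
    ∃ f' : FlowHom X A, SHomotopy (h.comp f') f := by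
  obtain ⟨f', hf'⟩ := liftCof hX (EFp h) (EFp_bij h hw) (EFp_rlp h hw) f
  refine ⟨(PB.fst _ _ _ _ _).comp f', sHomotopy_iff.2 ⟨(PB.snd _ _ _ _ _).comp f', ?_, hf'⟩⟩
  refine FlowHom.ext rfl (funext fun x => ?_)
  exact (Subtype.property (p := fun q : A.Path × C(II, B.Path) => h.toFunP q.1 = q.2 0)
    (f'.toFunP x)).symm

theorem whiteheadInj {X : Flow} (hX : SCofibrant X) (hw : IsWeakSHomotopyEquiv h)
    (f0 f1 : FlowHom X A) (hf : SHomotopy (h.comp f0) (h.comp f1)) : SHomotopy f0 f1 := by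
  obtain ⟨K, hK0, hK1⟩ := sHomotopy_iff.1 hf
  let p := EFp h
  have hinj : Function.Injective p.toFun0 := (EFp_bij h hw).1
  let e0 : FlowHom X (EF h) := PB.lift _ _ _ _ _ f0 K hK0.symm
  let e1 : FlowHom X (EF h) := PB.lift _ _ _ _ _ f1 ((constF B).comp (h.comp f1)) rfl
  have he : p.comp e0 = p.comp e1 := by
    have k0 := congrArg FlowHom.toFun0 hK0
    have k1 := congrArg FlowHom.toFun0 hK1
    have k2 := congrArg FlowHom.toFunP hK1
    exact FlowHom.ext (k0.symm.trans k1) k2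
  let T := PB p p _root_.id hinj (fun _ => rfl)
  let V := PB (mapF p) (constF B) p.toFun0 (fun _ _ e => e) (fun _ => rfl)
  let v1 : FlowHom V (PathFlow (EF h)) := PB.fst _ _ _ _ _
  have hv : ((p.comp ((evF _ 0).comp v1)) = p.comp ((evF _ 1).comp v1)) := by
    refine FlowHom.ext rfl (funext fun x => ?_)
    have := Subtype.property (p := fun q : C(II, (EF h).Path) × B.Path =>
      p.pathMap.comp q.1 = ContinuousMap.const II q.2) x
    exact (DFunLike.congr_fun this 0).trans (DFunLike.congr_fun this 1).symm
  let q : FlowHom V T := PB.lift _ _ _ _ _ ((evF _ 0).comp v1) ((evF _ 1).comp v1) hv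
  suffices HR : ∀ n, RLPn q.toFunP n by
    obtain ⟨w, hw'⟩ := liftCof hX q (B := T) (Function.bijective_id) HR (PB.lift _ _ _ _ _ e0 e1 he)
    refine sHomotopy_iff.2 ⟨(mapF (PB.fst _ _ _ _ _)).comp (v1.comp w), ?_, ?_⟩
    · have := congrArg (fun z : FlowHom X T => (PB.fst h (evF B 0) h.toFun0 (fun _ _ e => e) (fun _ => rfl)).comp
        ((PB.fst p p _root_.id hinj (fun _ => rfl)).comp z)) hw'
      exact this
    · have hp01 : f0.toFun0 = f1.toFun0 := by
        funext x
        exact hinj (congrFun (congrArg FlowHom.toFun0 he) x)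
      have := congrArg (fun z : FlowHom X T => (PB.fst h (evF B 0) h.toFun0 (fun _ _ e => e) (fun _ => rfl)).comp
        ((PB.snd p p _root_.id hinj (fun _ => rfl)).comp z)) hw'
      have k0 := congrArg FlowHom.toFun0 hw'
      have k1 := congrArg FlowHom.toFunP this
      exact FlowHom.ext (k0.trans hp01) k1
  · intro n g b hgb
    let g1 : C(diskBoundary n, C(II, (EF h).Path)) := ⟨fun x => v1.toFunP (g x),
      v1.continuous_toFunP.comp g.continuous⟩
    let b0 : C(closedDisk n, (EF h).Path) := ⟨fun x => (b x).1.1,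
      continuous_fst.comp (continuous_subtype_val.comp b.continuous)⟩
    let b1 : C(closedDisk n, (EF h).Path) := ⟨fun x => (b x).1.2,
      continuous_snd.comp (continuous_subtype_val.comp b.continuous)⟩
    have hb01 : ∀ x, p.toFunP (b0 x) = p.toFunP (b1 x) := fun x => (b x).2
    have hg1 : ∀ x t, p.toFunP (g1 x t) = p.toFunP (g1 x 0) := fun x t => by
      have := Subtype.property (p := fun q : C(II, (EF h).Path) × B.Path =>
        p.pathMap.comp q.1 = ContinuousMap.const II q.2) (g x)
      exact (DFunLike.congr_fun this t).trans (DFunLike.congr_fun this 0).symm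
    have hg0' : ∀ x, g1 x 0 = b0 (diskBoundaryInclusion n x) := fun x =>
      congrArg (fun z : T.Path => z.1.1) (hgb x)
    have hg1' : ∀ x, g1 x 1 = b1 (diskBoundaryInclusion n x) := fun x =>
      congrArg (fun z : T.Path => z.1.2) (hgb x)
    obtain ⟨F, F0, F1, Fw, Fp⟩ := prismLift p.toFunP n (EFp_rlp h hw (n+1))
      ⟨fun y => p.toFunP (b0 y.1), p.continuous_toFunP.comp (b0.continuous.comp continuous_fst)⟩
      b0 b1 g1.uncurry (fun x => rfl) (fun x => (hb01 x).symm)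
      (fun x t => (hg1 x t).trans (congrArg p.toFunP (hg0' x))) hg0' hg1'
    have hFc : ∀ x, p.pathMap.comp (F.curry x) = ContinuousMap.const II (p.toFunP (b0 x)) :=
      fun x => ContinuousMap.ext fun t => Fp (x, t)
    refine ⟨⟨fun x => ⟨(F.curry x, p.toFunP (b0 x)), hFc x⟩, ?_⟩, fun x => ?_, fun x => ?_⟩
    · exact Continuous.subtype_mk (F.curry.continuous.prodMk
        (p.continuous_toFunP.comp b0.continuous)) _
    · refine Subtype.ext (Prod.ext (ContinuousMap.ext fun t => Fw x t) ?_)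
      have := Subtype.property (p := fun q : C(II, (EF h).Path) × B.Path =>
        p.pathMap.comp q.1 = ContinuousMap.const II q.2) (g x)
      exact (congrArg p.toFunP (hg0' x).symm).trans (DFunLike.congr_fun this 0)
    · exact Subtype.ext (Prod.ext (F0 x) (F1 x))
end
end PartC1

section PartE1
open Set Metric Topology
local notation "II" => unitInterval

theorem constF_weq (Y : Flow) : IsWeakSHomotopyEquiv (constF Y) := by
  refine ⟨Function.bijective_id, weq_of_help _ fun n g => relHelp _ n g fun b1 hb1 => ?_⟩
  let b : C(closedDisk n, C(II, Y.Path)) := b1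
  have hb : ∀ x, b (diskBoundaryInclusion n x) = ContinuousMap.const II (g x) := hb1
  let m : C((closedDisk n × II) × II, Y.Path) := ⟨fun p => b p.1.1 (p.2 * p.1.2), by
    have : Continuous fun p : (closedDisk n × II) × II => (b p.1.1, p.2 * p.1.2) := by fun_prop
    exact continuous_eval.comp this⟩
  refine ⟨⟨fun x => b x 0, by fun_prop⟩, m.curry, fun x => ?_, fun x t => ?_, fun x => ?_, fun x => ?_⟩
  · show b _ 0 = _
    rw [hb]; rfl
  · refine ContinuousMap.ext fun u => ?_
    show b _ _ = g x
    rw [hb]; rfl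
  · refine ContinuousMap.ext fun u => ?_
    show b x (u * 0) = b x 0
    simp
  · refine ContinuousMap.ext fun u => ?_
    show b x (u * 1) = b x u
    simp

abbrev WW := weakSHomotopyEquivalences

theorem Q_map_eq {X Y : Flow} {f g : X ⟶ Y} (h : SHomotopy f g) : WW.Q.map f = WW.Q.map g := by
  obtain ⟨H, rfl, rfl⟩ := sHomotopy_iff.1 h
  have hc : IsIso (WW.Q.map (show Y ⟶ PathFlow Y from constF Y)) :=
    WW.Q_inverts _ (constF_weq Y)
  have e : ∀ u, WW.Q.map (show PathFlow Y ⟶ Y from evF Y u) =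
      inv (WW.Q.map (show Y ⟶ PathFlow Y from constF Y)) := fun u => by
    apply IsIso.eq_inv_of_hom_inv_id
    rw [← WW.Q.map_comp, ← WW.Q.map_id]; rfl
  have e2 : ∀ u, WW.Q.map (show X ⟶ Y from (evF Y u).comp H) =
      WW.Q.map (show X ⟶ PathFlow Y from H) ≫ WW.Q.map (show PathFlow Y ⟶ Y from evF Y u) := fun u => by
    rw [← WW.Q.map_comp]; rfl
  exact (e2 0).trans (((e 0).trans (e 1).symm ▸ rfl : _ = _).trans (e2 1).symm)

/-- homotopy classes -/
def hsetoid (X Y : Flow) : Setoid (FlowHom X Y) where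
  r := SHomotopy
  iseqv := ⟨sHomotopy_refl, sHomotopy_symm, sHomotopy_trans⟩

/-- the functor of homotopy classes -/
def hFunctor (X : Flow) : Flow ⥤ Type where
  obj Y := _root_.Quotient (hsetoid X Y)
  map {Y Z} k := TypeCat.ofHom (fun q => _root_.Quotient.map (sa := hsetoid X Y) (sb := hsetoid X Z)
    (fun f => FlowHom.comp k f) (fun _ _ h => sHomotopy_post h k) q)
  map_id Y := by
    ext q
    induction q using _root_.Quotient.inductionOn with | _ f => rfl
  map_comp k l := by
    ext q
    induction q using _root_.Quotient.inductionOn with | _ f => rfl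

theorem hFunctor_inverts {X : Flow} (hX : SCofibrant X) : WW.IsInvertedBy (hFunctor X) := by
  intro Y Z k hk
  rw [isIso_iff_bijective]
  constructor
  · intro a b
    induction a using _root_.Quotient.inductionOn with | _ f =>
    induction b using _root_.Quotient.inductionOn with | _ g =>
    intro hfg
    have := _root_.Quotient.exact (s := hsetoid X Z) hfg
    exact _root_.Quotient.sound (s := hsetoid X Y) (whiteheadInj k hX hk f g this)
  · intro a
    induction a using _root_.Quotient.inductionOn with | _ f =>
    obtain ⟨f', hf'⟩ := whiteheadSurj k hX hk f
    exact ⟨_root_.Quotient.mk (hsetoid X Y) f', _root_.Quotient.sound (s := hsetoid X Z) hf'⟩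

theorem sHomotopy_of_Q {X Y : Flow} (hX : SCofibrant X) {f g : X ⟶ Y} (h : WW.Q.map f = WW.Q.map g) :
    SHomotopy f g := by
  have hfac := Localization.Construction.fac (hFunctor X) (hFunctor_inverts hX)
  have e : (hFunctor X).map f = (hFunctor X).map g := by
    rw [← hfac]
    simp only [Functor.comp_map, h]
  have := congrArg (fun k => k (_root_.Quotient.mk (hsetoid X X) (FlowHom.id X))) e
  exact _root_.Quotient.exact (s := hsetoid X Y) this

/-- morphisms coming from actual morphisms -/
def Img (X : Flow) (A : WW.Localization) (v : WW.Q.obj X ⟶ A) : Prop :=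
  ∃ (Y : Flow) (e : WW.Q.obj Y = A) (f : X ⟶ Y), v = WW.Q.map f ≫ eqToHom e

theorem Img_obj {X Y : Flow} (v : WW.Q.obj X ⟶ WW.Q.obj Y) (h : Img X _ v) :
    ∃ f : X ⟶ Y, v = WW.Q.map f := by
  obtain ⟨Y', e, f, rfl⟩ := h
  obtain rfl : Y' = Y := (Localization.Construction.objEquiv WW).injective e
  exact ⟨f, by simp⟩

theorem Q_full {X Y : Flow} (hX : SCofibrant X) (v : WW.Q.obj X ⟶ WW.Q.obj Y) :
    ∃ f : X ⟶ Y, v = WW.Q.map f := by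
  let P : MorphismProperty WW.Localization := fun A B u => ∀ v, Img X A v → Img X B (v ≫ u)
  have hPc : P.IsStableUnderComposition := ⟨fun f g hf hg v hv => by
    rw [← Category.assoc]; exact hg _ (hf _ hv)⟩
  have htop : P = ⊤ := by
    refine Localization.Construction.morphismProperty_eq_top P ?_ ?_
    · intro A B f v hv
      obtain ⟨g, rfl⟩ := Img_obj v hv
      exact ⟨B, rfl, g ≫ f, by simp⟩
    · intro A B w hw v hv
      obtain ⟨g, rfl⟩ := Img_obj v hv
      obtain ⟨f', hf'⟩ := whiteheadSurj w hX hw g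
      refine ⟨A, rfl, f', ?_⟩
      have : WW.Q.map g = WW.Q.map (show X ⟶ A from f') ≫ WW.Q.map w := by
        rw [← WW.Q.map_comp]
        exact (Q_map_eq hf').symm
      rw [this, Category.assoc]
      have e : WW.Q.map w ≫ Localization.Construction.wInv w hw = 𝟙 _ :=
        (Localization.Construction.wIso w hw).hom_inv_id
      rw [e]; simp
  have : P v := by rw [htop]; trivial
  obtain ⟨f, hf⟩ := Img_obj _ (this (𝟙 _) ⟨X, rfl, 𝟙 X, by simp⟩)
  exact ⟨f, by simpa using hf⟩

instance : Congruence sHomotopyHomRel where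
  comp_left f g g' h := sHomotopy_pre h f.hom
  comp_right g h := sHomotopy_post h g.hom
  equivalence := ⟨fun f => sHomotopy_refl _, fun h => sHomotopy_symm h, fun h h' => sHomotopy_trans h h'⟩

theorem mainOfReplacement (hrep : ∀ Y : Flow, ∃ (X : Flow) (q : FlowHom X Y), SCofibrant X ∧
    IsWeakSHomotopyEquiv q) :
    ∃ F : CategoryTheory.Quotient sHomotopyHomRel ⥤ weakSHomotopyEquivalences.Localization,
      CategoryTheory.Quotient.functor sHomotopyHomRel ⋙ F =
        ObjectProperty.ι SCofibrant ⋙ weakSHomotopyEquivalences.Q ∧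
      F.IsEquivalence := by
  let F := CategoryTheory.Quotient.lift sHomotopyHomRel
    (ObjectProperty.ι SCofibrant ⋙ weakSHomotopyEquivalences.Q)
    (fun X Y f g h => Q_map_eq (f := f.hom) (g := g.hom) h)
  refine ⟨F, CategoryTheory.Quotient.lift_spec _ _ _, ?_⟩
  have hfull : F.Full := ⟨fun {A B} v => by
    obtain ⟨f, hf⟩ := Q_full A.as.2 (show WW.Q.obj A.as.1 ⟶ WW.Q.obj B.as.1 from v)
    exact ⟨(CategoryTheory.Quotient.functor sHomotopyHomRel).map (ObjectProperty.homMk f), hf.symm⟩⟩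
  have hfaith : F.Faithful := ⟨fun {A B} f g h => by
    obtain ⟨f, rfl⟩ := (CategoryTheory.Quotient.functor sHomotopyHomRel).map_surjective f
    obtain ⟨g, rfl⟩ := (CategoryTheory.Quotient.functor sHomotopyHomRel).map_surjective g
    exact CategoryTheory.Quotient.sound _ (sHomotopy_of_Q A.as.2 h)⟩
  have hess : F.EssSurj := ⟨fun A => by
    obtain ⟨X, q, hX, hq⟩ := hrep ((Localization.Construction.objEquiv WW).symm A)
    exact ⟨⟨⟨X, hX⟩⟩, ⟨Localization.Construction.wIso (W := WW) q hq⟩⟩⟩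
  exact {}
end PartE1

section PartD1
open Set Metric Topology
local notation "II" => unitInterval

/-- Data of generators and identifications of a flow. -/
structure Pres : Type 1 where
  J : Type
  F : J → Flow
  O : Type
  r : ∀ j, (F j).State → O
  R : (Σ j, (F j).Path) → (Σ j, (F j).Path) → Prop
  hRs : ∀ a b, R a b → r a.1 ((F a.1).s a.2) = r b.1 ((F b.1).s b.2)
  hRt : ∀ a b, R a b → r a.1 ((F a.1).t a.2) = r b.1 ((F b.1).t b.2)

/-- A cocone for the data. -/
structure Pres.Cocone (D : Pres) : Type 1 where
  Z : Flow
  z : D.O → Z.State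
  f : ∀ j, FlowHom (D.F j) Z
  hz : ∀ j x, (f j).toFun0 x = z (D.r j x)
  hR : ∀ a b, D.R a b → (f a.1).toFunP a.2 = (f b.1).toFunP b.2

/-- Formal words. -/
inductive Pres.W (D : Pres) : D.O → D.O → Type
  | gen (j : D.J) (x : (D.F j).Path) : Pres.W D (D.r j ((D.F j).s x)) (D.r j ((D.F j).t x))
  | mul {a b c : D.O} : Pres.W D a b → Pres.W D b c → Pres.W D a c

/-- Evaluation of formal words. -/
def Pres.Cocone.evl {D : Pres} (c : D.Cocone) : ∀ {a b : D.O}, D.W a b →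
    {p : c.Z.Path // c.Z.s p = c.z a ∧ c.Z.t p = c.z b}
  | _, _, .gen j x => ⟨(c.f j).toFunP x, by rw [(c.f j).s_map, c.hz], by rw [(c.f j).t_map, c.hz]⟩
  | _, _, .mul u v => ⟨c.Z.comp (c.evl u).1 (c.evl v).1 ((c.evl u).2.2.trans (c.evl v).2.1.symm),
      (c.Z.s_comp _ _ _).trans (c.evl u).2.1, (c.Z.t_comp _ _ _).trans (c.evl v).2.2⟩

/-- words with endpoints -/
structure Pres.T (D : Pres) : Type where
  a : D.O
  b : D.O
  w : D.W a b

/-- words having the same value in all cocones -/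
def Pres.setoid (D : Pres) : Setoid D.T where
  r x y := x.a = y.a ∧ x.b = y.b ∧ ∀ c : D.Cocone, (c.evl x.w).1 = (c.evl y.w).1
  iseqv := ⟨fun x => ⟨rfl, rfl, fun _ => rfl⟩, fun h => ⟨h.1.symm, h.2.1.symm, fun c => (h.2.2 c).symm⟩,
    fun h h' => ⟨h.1.trans h'.1, h.2.1.trans h'.2.1, fun c => (h.2.2 c).trans (h'.2.2 c)⟩⟩

/-- the paths of the universal flow -/
def Pres.UP (D : Pres) : Type := _root_.Quotient D.setoid

variable {D : Pres}

noncomputable def Pres.UP.out (x : D.UP) : D.T := _root_.Quotient.out x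

def Pres.T.mk' (x : D.T) : D.UP := _root_.Quotient.mk D.setoid x

theorem Pres.out_mk (x : D.T) : D.setoid.r x.mk'.out x := _root_.Quotient.mk_out (s := D.setoid) x

noncomputable def Pres.UP.s (x : D.UP) : D.O := x.out.a
noncomputable def Pres.UP.t (x : D.UP) : D.O := x.out.b
noncomputable def Pres.UP.ev (x : D.UP) (c : D.Cocone) : c.Z.Path := (c.evl x.out.w).1

theorem Pres.s_mk (x : D.T) : x.mk'.s = x.a := (Pres.out_mk x).1
theorem Pres.t_mk (x : D.T) : x.mk'.t = x.b := (Pres.out_mk x).2.1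
theorem Pres.ev_mk (x : D.T) (c : D.Cocone) : x.mk'.ev c = (c.evl x.w).1 := (Pres.out_mk x).2.2 c

theorem Pres.UP.ext {x y : D.UP} (hs : x.s = y.s) (ht : x.t = y.t) (h : ∀ c, x.ev c = y.ev c) :
    x = y := by
  have : D.setoid.r x.out y.out := ⟨hs, ht, h⟩
  have h2 := _root_.Quotient.sound (s := D.setoid) this
  rwa [show _root_.Quotient.mk D.setoid x.out = x from _root_.Quotient.out_eq _,
    show _root_.Quotient.mk D.setoid y.out = y from _root_.Quotient.out_eq _] at h2

theorem Pres.UP.s_ev (x : D.UP) (c : D.Cocone) : c.Z.s (x.ev c) = c.z x.s := (c.evl x.out.w).2.1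
theorem Pres.UP.t_ev (x : D.UP) (c : D.Cocone) : c.Z.t (x.ev c) = c.z x.t := (c.evl x.out.w).2.2

theorem Pres.UP.comp_ev {x y : D.UP} (h : x.t = y.s) (c : D.Cocone) :
    c.Z.t (x.ev c) = c.Z.s (y.ev c) := by rw [x.t_ev, y.s_ev, h]

/-- composition -/
noncomputable def Pres.UP.comp (x y : D.UP) (h : x.t = y.s) : D.UP :=
  Pres.T.mk' ⟨x.out.a, y.out.b, .mul x.out.w ((show y.out.a = x.out.b from h.symm) ▸ y.out.w)⟩

theorem Pres.eval_cast (c : D.Cocone) {a a' b : D.O} (h : a = a') (w : D.W a b) :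
    (c.evl (h ▸ w : D.W a' b)).1 = (c.evl w).1 := by
  subst h; rfl

theorem Pres.UP.s_comp (x y : D.UP) (h : x.t = y.s) : (x.comp y h).s = x.s := Pres.s_mk _
theorem Pres.UP.t_comp (x y : D.UP) (h : x.t = y.s) : (x.comp y h).t = y.t := Pres.t_mk _
theorem Pres.UP.ev_comp (x y : D.UP) (h : x.t = y.s) (c : D.Cocone) :
    (x.comp y h).ev c = c.Z.comp (x.ev c) (y.ev c) (Pres.UP.comp_ev h c) := by
  refine (Pres.ev_mk _ c).trans ?_
  exact FlowHom.cong_comp _ _ rfl (Pres.eval_cast c _ _)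

/-- the topology -/
instance Pres.UP.top : TopologicalSpace D.UP :=
  sInf {τ | (∃ c : D.Cocone, τ = TopologicalSpace.induced (fun x : D.UP => x.ev c) inferInstance) ∨
    τ = TopologicalSpace.induced (fun x : D.UP => x.s) ⊥ ∨
    τ = TopologicalSpace.induced (fun x : D.UP => x.t) ⊥}

theorem Pres.UP.cont_iff {K : Type*} [TopologicalSpace K] (f : K → D.UP) :
    Continuous f ↔ (∀ c, Continuous fun k => (f k).ev c) ∧ (∀ a, IsOpen {k | (f k).s = a}) ∧
      (∀ a, IsOpen {k | (f k).t = a}) := by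
  unfold Pres.UP.top
  rw [continuous_sInf_rng]
  constructor
  · intro h
    refine ⟨fun c => continuous_induced_rng.1 (h _ (Or.inl ⟨c, rfl⟩)), fun a => ?_, fun a => ?_⟩
    · have h1 := h _ (Or.inr (Or.inl rfl))
      letI : TopologicalSpace D.O := ⊥
      haveI : DiscreteTopology D.O := ⟨rfl⟩
      exact (isOpen_discrete {a}).preimage (continuous_induced_rng.1 h1)
    · have h1 := h _ (Or.inr (Or.inr rfl))
      letI : TopologicalSpace D.O := ⊥
      haveI : DiscreteTopology D.O := ⟨rfl⟩
      exact (isOpen_discrete {a}).preimage (continuous_induced_rng.1 h1)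
  · rintro ⟨h1, h2, h3⟩ τ (⟨c, rfl⟩ | rfl | rfl)
    · exact continuous_induced_rng.2 (h1 c)
    · letI : TopologicalSpace D.O := ⊥
      haveI : DiscreteTopology D.O := ⟨rfl⟩
      exact continuous_induced_rng.2 (continuous_discrete_rng.2 h2)
    · letI : TopologicalSpace D.O := ⊥
      haveI : DiscreteTopology D.O := ⟨rfl⟩
      exact continuous_induced_rng.2 (continuous_discrete_rng.2 h3)

variable (D) in
/-- the universal flow -/
noncomputable def Pres.U : Flow where
  State := D.O
  Path := D.UP
  s := Pres.UP.s
  t := Pres.UP.t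
  isOpen_preimage_s a := ((Pres.UP.cont_iff (_root_.id : D.UP → D.UP)).1 continuous_id).2.1 a
  isOpen_preimage_t a := ((Pres.UP.cont_iff (_root_.id : D.UP → D.UP)).1 continuous_id).2.2 a
  comp := Pres.UP.comp
  continuous_comp := by
    have hid := (Pres.UP.cont_iff (_root_.id : D.UP → D.UP)).1 continuous_id
    rw [Pres.UP.cont_iff]
    refine ⟨fun c => ?_, fun a => ?_, fun a => ?_⟩
    · simp only [Pres.UP.ev_comp]
      exact c.Z.cont_comp ((hid.1 c).comp (continuous_fst.comp continuous_subtype_val))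
        ((hid.1 c).comp (continuous_snd.comp continuous_subtype_val)) _
    · simp only [Pres.UP.s_comp]
      exact (hid.2.1 a).preimage (continuous_fst.comp continuous_subtype_val)
    · simp only [Pres.UP.t_comp]
      exact (hid.2.2 a).preimage (continuous_snd.comp continuous_subtype_val)
  s_comp := Pres.UP.s_comp
  t_comp := Pres.UP.t_comp
  comp_assoc x y z hxy hyz h1 h2 := by
    refine Pres.UP.ext ?_ ?_ fun c => ?_
    · simp only [Pres.UP.s_comp]
    · simp only [Pres.UP.t_comp]
    · simp only [Pres.UP.ev_comp]
      exact c.Z.comp_assoc _ _ _ _ _ _ _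

variable (D) in
/-- generators -/
def Pres.gen (j : D.J) (x : (D.F j).Path) : D.T := ⟨_, _, .gen j x⟩

variable (D) in
/-- the structural maps -/
noncomputable def Pres.inj (j : D.J) : FlowHom (D.F j) D.U where
  toFun0 := D.r j
  toFunP x := Pres.T.mk' (D.gen j x)
  continuous_toFunP := by
    refine (Pres.UP.cont_iff _).2 ⟨fun c => ?_, fun a => ?_, fun a => ?_⟩
    · simp only [Pres.ev_mk]
      exact (c.f j).continuous_toFunP
    · simp only [Pres.s_mk]
      exact (isOpen_discrete {y | D.r j y = a}).preimage (D.F j).cont_s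
    · simp only [Pres.t_mk]
      exact (isOpen_discrete {y | D.r j y = a}).preimage (D.F j).cont_t
  s_map x := Pres.s_mk _
  t_map x := Pres.t_mk _
  comp_map x y h h' := by
    refine Pres.UP.ext ?_ ?_ fun c => ?_
    · refine (Pres.s_mk _).trans (Eq.trans ?_ ((Pres.UP.s_comp _ _ h').trans
        (Pres.s_mk (D.gen j x))).symm)
      exact congrArg (D.r j) ((D.F j).s_comp x y h)
    · refine (Pres.t_mk _).trans (Eq.trans ?_ ((Pres.UP.t_comp _ _ h').trans
        (Pres.t_mk (D.gen j y))).symm)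
      exact congrArg (D.r j) ((D.F j).t_comp x y h)
    · refine (Pres.ev_mk _ c).trans ?_
      refine Eq.trans ?_ (Pres.UP.ev_comp _ _ h' c).symm
      refine ((c.f j).comp_map x y h ((c.f j).composable h)).trans ?_
      exact FlowHom.cong_comp _ _ (Pres.ev_mk (D.gen j x) c).symm (Pres.ev_mk (D.gen j y) c).symm

theorem Pres.inj_rel (a b : Σ j, (D.F j).Path) (h : D.R a b) :
    (D.inj a.1).toFunP a.2 = (D.inj b.1).toFunP b.2 := by
  refine Pres.UP.ext ?_ ?_ fun c => ?_
  · exact (Pres.s_mk _).trans ((D.hRs a b h).trans (Pres.s_mk (D.gen b.1 b.2)).symm)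
  · exact (Pres.t_mk _).trans ((D.hRt a b h).trans (Pres.t_mk (D.gen b.1 b.2)).symm)
  · exact (Pres.ev_mk _ c).trans ((c.hR a b h).trans (Pres.ev_mk (D.gen b.1 b.2) c).symm)

/-- the map to a cocone -/
noncomputable def Pres.desc (c : D.Cocone) : FlowHom D.U c.Z where
  toFun0 := c.z
  toFunP x := Pres.UP.ev x c
  continuous_toFunP := ((Pres.UP.cont_iff (_root_.id : D.UP → D.UP)).1 continuous_id).1 c
  s_map x := Pres.UP.s_ev x c
  t_map x := Pres.UP.t_ev x c
  comp_map x y h h' := Pres.UP.ev_comp x y h c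

theorem Pres.desc_inj (c : D.Cocone) (j : D.J) : (Pres.desc c).comp (D.inj j) = c.f j :=
  FlowHom.ext (funext fun x => (c.hz j x).symm) (funext fun x => Pres.ev_mk _ c)

theorem Pres.gen_induct (P : D.U.Path → Prop) (h1 : ∀ j x, P ((D.inj j).toFunP x))
    (h2 : ∀ x y h, P x → P y → P (D.U.comp x y h)) (x : D.U.Path) : P x := by
  have key : ∀ {a b : D.O} (w : D.W a b), P (Pres.T.mk' ⟨a, b, w⟩) := by
    intro a b w
    induction w with
    | gen j x => exact h1 j x
    | @mul a b c u v hu hv =>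
      have hc : (Pres.T.mk' ⟨a, b, u⟩ : D.UP).t = (Pres.T.mk' ⟨b, c, v⟩ : D.UP).s :=
        (Pres.t_mk (⟨a, b, u⟩ : D.T)).trans (Pres.s_mk (⟨b, c, v⟩ : D.T)).symm
      have := h2 _ _ hc hu hv
      have e : (Pres.T.mk' ⟨a, c, u.mul v⟩ : D.UP) = Pres.UP.comp _ _ hc := by
       refine Pres.UP.ext ?_ ?_ fun k => ?_
       · exact (Pres.s_mk _).trans ((Pres.UP.s_comp _ _ hc).trans (Pres.s_mk _)).symm
       · exact (Pres.t_mk _).trans ((Pres.UP.t_comp _ _ hc).trans (Pres.t_mk _)).symm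
       · refine (Pres.ev_mk _ k).trans (Eq.trans ?_ (Pres.UP.ev_comp _ _ hc k).symm)
         exact FlowHom.cong_comp _ _ (Pres.ev_mk ⟨a, b, u⟩ k).symm (Pres.ev_mk ⟨b, c, v⟩ k).symm
      exact e ▸ this
  have hx : x = Pres.T.mk' (Pres.UP.out x) := (_root_.Quotient.out_eq (s := D.setoid) x).symm
  rw [hx]
  exact key _

theorem Pres.desc_uniq {Z : Flow} (g g' : FlowHom D.U Z) (h0 : g.toFun0 = g'.toFun0)
    (h : ∀ j, g.comp (D.inj j) = g'.comp (D.inj j)) : g = g' := by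
  refine FlowHom.ext h0 (funext fun x => ?_)
  refine Pres.gen_induct (fun x => g.toFunP x = g'.toFunP x) ?_ ?_ x
  · intro j x
    exact congrFun (congrArg FlowHom.toFunP (h j)) x
  · intro x y hxy hx hy
    show g.toFunP _ = g'.toFunP _
    rw [g.comp_map x y hxy (g.composable hxy), g'.comp_map x y hxy (g'.composable hxy)]
    exact FlowHom.cong_comp _ _ hx hy

end PartD1

section PartD2
open Set Metric Topology
local notation "II" => unitInterval

/-- one-state flow of a topological semigroup -/
def semiFlow (M : Type) [TopologicalSpace M] (op : M → M → M)
    (hc : Continuous fun p : M × M => op p.1 p.2) (ha : ∀ x y z, op x (op y z) = op (op x y) z) : Flow where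
  State := Unit
  Path := M
  s _ := ()
  t _ := ()
  isOpen_preimage_s a := isOpen_preimage_const _ a
  isOpen_preimage_t a := isOpen_preimage_const _ a
  comp x y _ := op x y
  continuous_comp := hc.comp continuous_subtype_val
  s_comp _ _ _ := rfl
  t_comp _ _ _ := rfl
  comp_assoc x y z _ _ _ _ := ha x y z

/-- indiscrete version of a type -/
def Ind (M : Type) : Type := M

instance (M : Type) : TopologicalSpace (Ind M) := ⊤

/-- one-state flow of an abstract semigroup with the indiscrete topology -/
def indFlow (M : Type) (op : M → M → M) (ha : ∀ x y z, op x (op y z) = op (op x y) z) : Flow :=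
  semiFlow (Ind M) op continuous_top ha

/-- the additive natural numbers -/
def dimFlow : Flow := indFlow ℕ (· + ·) (fun x y z => (Nat.add_assoc x y z).symm)

/-- the empty flow on a set -/
def discFlow (O : Type) : Flow where
  State := O
  Path := Empty
  s := fun e => e.elim
  t := fun e => e.elim
  isOpen_preimage_s := fun a => by
    rw [Set.eq_empty_of_isEmpty (_ ⁻¹' {a})]; exact isOpen_empty
  isOpen_preimage_t := fun a => by
    rw [Set.eq_empty_of_isEmpty (_ ⁻¹' {a})]; exact isOpen_empty
  comp := fun x _ _ => x.elim
  continuous_comp := continuous_of_isEmpty _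
  s_comp := fun x => x.elim
  t_comp := fun x => x.elim
  comp_assoc := fun x => x.elim

/-- A stage of the construction of a cofibrant replacement. -/
structure Stage (Y : Flow) : Type 1 where
  A : Flow
  q : FlowHom A Y
  δ : FlowHom A dimFlow
  hq : Function.Bijective q.toFun0

variable {Y : Flow}

/-- the dimension -/
def Stage.dim (T : Stage Y) (x : T.A.Path) : ℕ := T.δ.toFunP x

/-- the cells to attach -/
def Stage.cells (T : Stage Y) (n : ℕ) : Type :=
  {p : FlowHom (Glob (diskBoundary n)) T.A × FlowHom (Glob (closedDisk n)) Y //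
    T.q.comp p.1 = p.2.comp (globBoundaryInclusion n) ∧
    ∀ x : diskBoundary n, T.dim (p.1.toFunP x) < n}

/-- the pushout presentation -/
def Stage.pres (T : Stage Y) (n : ℕ) : Pres where
  J := Option (T.cells n)
  F j := match j with
    | none => T.A
    | some _ => Glob (closedDisk n)
  O := T.A.State
  r j := match j with
    | none => _root_.id
    | some i => i.1.1.toFun0
  R a b := ∃ (i : T.cells n) (x : diskBoundary n), a = ⟨some i, diskBoundaryInclusion n x⟩ ∧
    b = ⟨none, i.1.1.toFunP x⟩
  hRs := by
    rintro _ _ ⟨i, x, rfl, rfl⟩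
    exact (i.1.1.s_map x).symm
  hRt := by
    rintro _ _ ⟨i, x, rfl, rfl⟩
    exact (i.1.1.t_map x).symm

/-- cocones on the pushout presentation -/
def Stage.coc (T : Stage Y) (n : ℕ) (Z : Flow) (g : FlowHom T.A Z)
    (k : T.cells n → FlowHom (Glob (closedDisk n)) Z)
    (h : ∀ i, (k i).comp (globBoundaryInclusion n) = g.comp i.1.1) : (T.pres n).Cocone where
  Z := Z
  z := g.toFun0
  f j := match j with
    | none => g
    | some i => k i
  hz j := match j with
    | none => fun x => rfl
    | some i => fun x => by
      have := congrArg FlowHom.toFun0 (h i)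
      exact congrFun this x
  hR := by
    rintro _ _ ⟨i, x, rfl, rfl⟩
    have := congrArg FlowHom.toFunP (h i)
    exact congrFun this x

/-- dimension on a cell -/
noncomputable def Stage.cellDim (T : Stage Y) (n : ℕ) (i : T.cells n) (x : closedDisk n) : ℕ :=
  open Classical in if h : ‖x.1‖ = 1 then T.dim (i.1.1.toFunP (mkS x.1 h)) else n

/-- the cocone to the target -/
def Stage.cocQ (T : Stage Y) (n : ℕ) : (T.pres n).Cocone :=
  T.coc n Y T.q (fun i => i.1.2) (fun i => i.2.1.symm)

/-- the dimension cocone -/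
noncomputable def Stage.cocD (T : Stage Y) (n : ℕ) : (T.pres n).Cocone :=
  T.coc n dimFlow T.δ (fun i => globHom (Z := dimFlow) (fun _ => ())
    ⟨fun x => (T.cellDim n i x : Ind ℕ), continuous_top⟩ (fun _ => rfl) (fun _ => rfl))
    (fun i => FlowHom.ext rfl (funext fun x => by
      show T.cellDim n i (diskBoundaryInclusion n x) = _
      have : ‖(diskBoundaryInclusion n x).1‖ = 1 := sph_norm x
      rw [Stage.cellDim, dif_pos this]; rfl))

/-- the next stage -/
noncomputable def Stage.next (T : Stage Y) (n : ℕ) : Stage Y where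
  A := (T.pres n).U
  q := Pres.desc (T.cocQ n)
  δ := Pres.desc (T.cocD n)
  hq := T.hq

/-- the structural map -/
noncomputable def Stage.ι (T : Stage Y) (n : ℕ) : FlowHom T.A (T.next n).A := (T.pres n).inj none

/-- the cells -/
noncomputable def Stage.cellMap (T : Stage Y) (n : ℕ) (i : T.cells n) :
    FlowHom (Glob (closedDisk n)) (T.next n).A := (T.pres n).inj (some i)

theorem Stage.q_ι (T : Stage Y) (n : ℕ) : (T.next n).q.comp (T.ι n) = T.q :=
  Pres.desc_inj (D := T.pres n) (T.cocQ n) none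
theorem Stage.δ_ι (T : Stage Y) (n : ℕ) : (T.next n).δ.comp (T.ι n) = T.δ :=
  Pres.desc_inj (D := T.pres n) (T.cocD n) none
theorem Stage.q_cell (T : Stage Y) (n : ℕ) (i : T.cells n) : (T.next n).q.comp (T.cellMap n i) = i.1.2 :=
  Pres.desc_inj (D := T.pres n) (T.cocQ n) (some i)
theorem Stage.δ_cell (T : Stage Y) (n : ℕ) (i : T.cells n) (x : closedDisk n) :
    (T.next n).dim ((T.cellMap n i).toFunP x) = T.cellDim n i x := by
  have := congrArg FlowHom.toFunP (Pres.desc_inj (D := T.pres n) (T.cocD n) (some i))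
  exact congrFun this x

theorem Stage.attach_comm (T : Stage Y) (n : ℕ) (i : T.cells n) :
    (T.cellMap n i).comp (globBoundaryInclusion n) = (T.ι n).comp i.1.1 :=
  FlowHom.ext rfl (funext fun x => Pres.inj_rel (D := T.pres n)
    ⟨some i, diskBoundaryInclusion n x⟩ ⟨none, i.1.1.toFunP x⟩ ⟨i, x, rfl, rfl⟩)

theorem Stage.pushout (T : Stage Y) (n : ℕ) (Z : Flow) (g : FlowHom T.A Z)
    (k : T.cells n → FlowHom (Glob (closedDisk n)) Z)
    (h : ∀ i, (k i).comp (globBoundaryInclusion n) = g.comp i.1.1) :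
    ∃! h : FlowHom (T.next n).A Z, h.comp (T.ι n) = g ∧ ∀ i, h.comp (T.cellMap n i) = k i := by
  refine ⟨Pres.desc (T.coc n Z g k h), ⟨Pres.desc_inj (T.coc n Z g k h) none, fun i => Pres.desc_inj (T.coc n Z g k h) (some i)⟩, ?_⟩
  rintro u ⟨hu1, hu2⟩
  refine Pres.desc_uniq (D := T.pres n) u (Pres.desc (T.coc n Z g k h)) ?_ ?_
  · have := congrArg FlowHom.toFun0 hu1
    exact this
  · rintro (_ | i)
    · exact hu1.trans (Pres.desc_inj (T.coc n Z g k h) none).symm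
    · exact (hu2 i).trans (Pres.desc_inj (T.coc n Z g k h) (some i)).symm

variable (Y) in
/-- the stages -/
noncomputable def stg : ℕ → Stage Y
  | 0 => ⟨discFlow Y.State, homOfEmpty (A := discFlow Y.State) (inferInstanceAs (IsEmpty Empty)) Y _root_.id,
      homOfEmpty (A := discFlow Y.State) (inferInstanceAs (IsEmpty Empty)) dimFlow (fun _ => ()), Function.bijective_id⟩
  | n+1 => (stg n).next n

variable (Y) in
/-- the colimit presentation -/
noncomputable def colPres : Pres where
  J := ℕ
  F n := (stg Y n).A
  O := Y.State
  r n := (stg Y n).q.toFun0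
  R a b := ∃ (n : ℕ) (x : (stg Y n).A.Path), a = ⟨n, x⟩ ∧ b = ⟨n+1, ((stg Y n).ι n).toFunP x⟩
  hRs := by
    rintro _ _ ⟨n, x, rfl, rfl⟩
    exact congrArg (stg Y n).q.toFun0 (((stg Y n).ι n).s_map x).symm
  hRt := by
    rintro _ _ ⟨n, x, rfl, rfl⟩
    exact congrArg (stg Y n).q.toFun0 (((stg Y n).ι n).t_map x).symm

variable (Y) in
theorem colState (Z : Flow) (d : ∀ n, FlowHom (stg Y n).A Z)
    (hd : ∀ n, (d (n+1)).comp ((stg Y n).ι n) = d n) (n : ℕ) :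
    ∀ x, (d n).toFun0 x = (d 0).toFun0 ((stg Y n).q.toFun0 x) := by
  induction n with
  | zero => intro x; rfl
  | succ n ih =>
    intro x
    have := congrArg FlowHom.toFun0 (hd n)
    exact (congrFun this x).trans (ih x)

variable (Y) in
/-- cocones on it -/
noncomputable def colCoc (Z : Flow) (d : ∀ n, FlowHom (stg Y n).A Z)
    (hd : ∀ n, (d (n+1)).comp ((stg Y n).ι n) = d n) : (colPres Y).Cocone where
  Z := Z
  z := (d 0).toFun0
  f := d
  hz n := colState Y Z d hd n
  hR := by
    rintro _ _ ⟨n, x, rfl, rfl⟩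
    have := congrArg FlowHom.toFunP (hd n)
    exact (congrFun this x).symm

variable (Y) in
/-- the cofibrant structure -/
noncomputable def colStr : SCofibrantStructure (colPres Y).U where
  sk n := (stg Y n).A
  isEmpty_path_sk_zero := inferInstanceAs (IsEmpty Empty)
  ι n := (stg Y n).ι n
  cells n := (stg Y n).cells n
  attachMap n i := i.1.1
  cellMap n i := (stg Y n).cellMap n i
  attach_comm n i := (stg Y n).attach_comm n i
  attach_isPushout n := (stg Y n).pushout n
  incl n := (colPres Y).inj n
  incl_comm n := FlowHom.ext rfl (funext fun x => (Pres.inj_rel (D := colPres Y) ⟨n, x⟩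
    ⟨(show ℕ from n+1), ((stg Y n).ι n).toFunP x⟩ ⟨n, x, rfl, rfl⟩).symm)
  isColimit Z d hd := by
    refine ⟨Pres.desc (colCoc Y Z d hd), fun n => Pres.desc_inj (colCoc Y Z d hd) n, ?_⟩
    intro u hu
    refine Pres.desc_uniq (D := colPres Y) u (Pres.desc (colCoc Y Z d hd)) ?_ ?_
    · have := congrArg FlowHom.toFun0 (hu 0)
      exact this
    · intro n
      exact (hu n).trans (Pres.desc_inj (colCoc Y Z d hd) n).symm

/-- Output of the construction. -/
structure Repl (Y : Flow) : Type 1 where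
  X : Flow
  S : SCofibrantStructure X
  q : FlowHom X Y
  δ : X.Path → ℕ
  hδ : ∀ x y h, δ (X.comp x y h) = δ x + δ y
  hq : Function.Bijective q.toFun0
  hqn : ∀ n, Function.Bijective (q.comp (S.incl n)).toFun0
  h1 : ∀ n e (x : closedDisk n), ‖x.1‖ < 1 →
    δ ((S.incl (n+1)).toFunP ((S.cellMap n e).toFunP x)) = n
  h2 : ∀ n e (x : diskBoundary n),
    δ ((S.incl n).toFunP ((S.attachMap n e).toFunP x)) < n
  h4 : ∀ n (φ : FlowHom (Glob (diskBoundary n)) (S.sk n)) (ψ : FlowHom (Glob (closedDisk n)) Y),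
    (q.comp (S.incl n)).comp φ = ψ.comp (globBoundaryInclusion n) →
    (∀ x : diskBoundary n, δ ((S.incl n).toFunP (φ.toFunP x)) < n) →
    ∃ e, S.attachMap n e = φ ∧ (q.comp (S.incl (n+1))).comp (S.cellMap n e) = ψ

theorem exists_repl (Y : Flow) : Nonempty (Repl Y) := by
  let cq := colCoc Y Y (fun n => (stg Y n).q) (fun n => Stage.q_ι _ _)
  let cd := colCoc Y dimFlow (fun n => (stg Y n).δ) (fun n => Stage.δ_ι _ _)
  let Q : FlowHom (colPres Y).U Y := Pres.desc cq
  let dl : FlowHom (colPres Y).U dimFlow := Pres.desc cd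
  let δ : (colPres Y).U.Path → ℕ := fun x => dl.toFunP x
  have hqn : ∀ n, Q.comp ((colStr Y).incl n) = (stg Y n).q := fun n => Pres.desc_inj cq n
  have hdn : ∀ n, dl.comp ((colStr Y).incl n) = (stg Y n).δ := fun n => Pres.desc_inj cd n
  have hdp : ∀ n x, δ (((colStr Y).incl n).toFunP x) = (stg Y n).dim x := fun n x => by
    have := congrArg FlowHom.toFunP (hdn n)
    exact congrFun this x
  refine ⟨⟨(colPres Y).U, colStr Y, Q, δ, ?_, Function.bijective_id, fun n => ?_, ?_, ?_, ?_⟩⟩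
  · intro x y h
    exact dl.comp_map x y h rfl
  · rw [hqn]; exact (stg Y n).hq
  · intro n e x hx
    refine (hdp (n+1) _).trans ((Stage.δ_cell (stg Y n) n e x).trans ?_)
    unfold Stage.cellDim
    exact dif_neg hx.ne
  · intro n e x
    refine lt_of_eq_of_lt (hdp n _) (e.2.2 x)
  · intro n φ ψ h1 h2
    refine ⟨⟨(φ, ψ), ?_, fun x => ?_⟩, rfl, ?_⟩
    · rw [hqn] at h1; exact h1
    · exact lt_of_eq_of_lt (hdp n _).symm (h2 x)
    · rw [hqn (n+1)]
      exact Stage.q_cell (stg Y n) n _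

end PartD2

section PartD3
open Set Metric Topology
local notation "II" => unitInterval

/-- subflow of paths satisfying a multiplicative property -/
def subFlow (A : Flow) (P : A.Path → Prop) (hP : ∀ x y h, P x → P y → P (A.comp x y h)) : Flow where
  State := A.State
  Path := {w : A.Path // P w}
  s w := A.s w.1
  t w := A.t w.1
  isOpen_preimage_s a := A.isOpen_pre_s continuous_subtype_val a
  isOpen_preimage_t a := A.isOpen_pre_t continuous_subtype_val a
  comp x y h := ⟨A.comp x.1 y.1 h, hP _ _ _ x.2 y.2⟩
  continuous_comp := Continuous.subtype_mk (A.cont_comp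
    (continuous_subtype_val.comp (continuous_fst.comp continuous_subtype_val))
    (continuous_subtype_val.comp (continuous_snd.comp continuous_subtype_val)) (fun z => z.2)) _
  s_comp x y h := A.s_comp _ _ _
  t_comp x y h := A.t_comp _ _ _
  comp_assoc x y z hxy hyz h1 h2 := Subtype.ext (A.comp_assoc _ _ _ _ _ _ _)

section
variable {A : Flow} {P : A.Path → Prop} (hP : ∀ x y h, P x → P y → P (A.comp x y h))

/-- inclusion of the subflow -/
def subFlow.inc : FlowHom (subFlow A P hP) A where
  toFun0 := _root_.id
  toFunP w := w.1
  continuous_toFunP := continuous_subtype_val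
  s_map _ := rfl
  t_map _ := rfl
  comp_map _ _ _ _ := rfl

/-- corestriction -/
def subFlow.cod {B : Flow} (f : FlowHom B A) (hf : ∀ x, P (f.toFunP x)) : FlowHom B (subFlow A P hP) where
  toFun0 := f.toFun0
  toFunP w := ⟨f.toFunP w, hf w⟩
  continuous_toFunP := Continuous.subtype_mk f.continuous_toFunP _
  s_map := f.s_map
  t_map := f.t_map
  comp_map x y h h' := Subtype.ext (f.comp_map x y h h')

theorem subFlow.inc_cod {B : Flow} (f : FlowHom B A) (hf : ∀ x, P (f.toFunP x)) :
    (subFlow.inc hP).comp (subFlow.cod hP f hf) = f := rfl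

theorem subFlow.cod_eq {B : Flow} (f : FlowHom B A) (hf : ∀ x, P (f.toFunP x)) (g : FlowHom B (subFlow A P hP))
    (h : f = (subFlow.inc hP).comp g) : subFlow.cod hP f hf = g := by
  subst h; rfl
end

theorem SCofibrantStructure.gen_sk {X : Flow} (S : SCofibrantStructure X) (n : ℕ)
    (P : (S.sk (n+1)).Path → Prop) (hP : ∀ x y h, P x → P y → P ((S.sk (n+1)).comp x y h))
    (h1 : ∀ w, P ((S.ι n).toFunP w)) (h2 : ∀ i (x : closedDisk n), P ((S.cellMap n i).toFunP x)) (w) : P w := by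
  obtain ⟨f, ⟨hf1, hf2⟩, -⟩ := S.attach_isPushout n (subFlow _ P hP) (subFlow.cod hP (S.ι n) h1)
    (fun i => subFlow.cod hP (S.cellMap n i) (h2 i)) (fun i => by
      have := S.attach_comm n i
      have k0 := congrArg FlowHom.toFun0 this
      have k1 := congrArg FlowHom.toFunP this
      exact FlowHom.ext k0 (funext fun x => Subtype.ext (congrFun k1 x)))
  have : (subFlow.inc hP).comp f = FlowHom.id _ := by
    refine S.homExt_sk ?_ fun i => ?_
    · rw [FlowHom.comp_assoc, hf1]; rfl
    · rw [FlowHom.comp_assoc, hf2]; rfl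
  have k := congrFun (congrArg FlowHom.toFunP this) w
  have k2 : (f.toFunP w).1 = w := k
  exact k2 ▸ (f.toFunP w).2

theorem SCofibrantStructure.gen_X {X : Flow} (S : SCofibrantStructure X)
    (P : X.Path → Prop) (hP : ∀ x y h, P x → P y → P (X.comp x y h))
    (h1 : ∀ n w, P ((S.incl n).toFunP w)) (w) : P w := by
  obtain ⟨f, hf, -⟩ := S.isColimit (subFlow _ P hP) (fun n => subFlow.cod hP (S.incl n) (h1 n))
    (fun n => (subFlow.cod_eq hP _ _ _ (S.incl_comm n).symm).symm)
  have : (subFlow.inc hP).comp f = FlowHom.id _ := by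
    refine S.homExt fun n => ?_
    rw [FlowHom.comp_assoc, hf]; rfl
  have k := congrFun (congrArg FlowHom.toFunP this) w
  have k2 : (f.toFunP w).1 = w := k
  exact k2 ▸ (f.toFunP w).2

/-- products of elements of a set -/
inductive Words {A : Flow} (L : Set A.Path) : A.Path → Prop
  | base (w : A.Path) (h : w ∈ L) : Words L w
  | cons (a w : A.Path) (ha : a ∈ L) (hw : Words L w) (h : A.t a = A.s w) : Words L (A.comp a w h)

theorem Words.mul {A : Flow} {L : Set A.Path} {x y : A.Path} (hx : Words L x) (hy : Words L y) :
    ∀ h, Words L (A.comp x y h) := by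
  induction hx with
  | base w hw => intro h; exact Words.cons _ _ hw hy h
  | cons a w ha hw haw ih =>
    intro h
    have h' : A.t w = A.s y := by rw [← h, A.t_comp]
    have h3 : A.t a = A.s (A.comp w y h') := by rw [A.s_comp, haw]
    rw [← A.comp_assoc a w y haw h' h3 h]
    exact Words.cons _ _ ha (ih h') _

theorem Words.map {A B : Flow} {L : Set A.Path} {L' : Set B.Path} (f : FlowHom A B)
    (hL : ∀ w ∈ L, f.toFunP w ∈ L') {x : A.Path} (hx : Words L x) : Words L' (f.toFunP x) := by
  induction hx with
  | base w hw => exact Words.base _ (hL _ hw)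
  | cons a w ha hw haw ih =>
    rw [f.comp_map a w haw (f.composable haw)]
    exact Words.cons _ _ (hL _ ha) ih _

theorem Words.inj {A : Flow} {L : Set A.Path} {G : Type*} (N : A.Path → List G)
    (hN : ∀ x y h, N (A.comp x y h) = N x ++ N y) (h1 : ∀ w ∈ L, ∃ g, N w = [g])
    (h2 : ∀ w ∈ L, ∀ w' ∈ L, N w = N w' → w = w') {x : A.Path} (hx : Words L x) :
    ∀ {y}, Words L y → N x = N y → x = y := by
  have hne : ∀ {w}, Words L w → N w ≠ [] := by
    intro w hw
    induction hw with
    | base w hw => obtain ⟨g, hg⟩ := h1 w hw; simp [hg]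
    | cons a w ha hw haw ih => rw [hN]; simp [ih]
  induction hx with
  | base w hw =>
    intro y hy
    cases hy with
    | base _ hy => exact h2 _ hw _ hy
    | cons a v ha hv hav =>
      intro e
      obtain ⟨g, hg⟩ := h1 w hw
      obtain ⟨g', hg'⟩ := h1 a ha
      rw [hN, hg, hg'] at e
      have e2 : g = g' ∧ [] = N v := by simpa using e
      exact absurd e2.2.symm (hne hv)
  | cons a w ha hw haw ih =>
    intro y hy
    cases hy with
    | base _ hy =>
      intro e
      obtain ⟨g, hg⟩ := h1 _ hy
      obtain ⟨g', hg'⟩ := h1 a ha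
      rw [hN, hg, hg'] at e
      have e2 : g' = g ∧ N w = [] := by simpa using e
      exact absurd e2.2 (hne hw)
    | cons b v hb hv hbv =>
      intro e
      obtain ⟨g, hg⟩ := h1 a ha
      obtain ⟨g', hg'⟩ := h1 b hb
      rw [hN, hN, hg, hg'] at e
      have e2 : g = g' ∧ N w = N v := by simpa using e
      exact FlowHom.cong_comp _ _ (h2 _ ha _ hb (by rw [hg, hg', e2.1])) (ih hv e2.2)

namespace Repl
variable {Y : Flow} (R : Repl Y)

/-- all the cells -/
abbrev Cell : Type := Σ n, R.S.cells n

/-- the points of the open cells -/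
abbrev Ltr : Type := Σ c : R.Cell, {x : closedDisk c.1 // ‖x.1‖ < 1}

/-- characteristic map -/
def chi (c : R.Cell) : C(closedDisk c.1, R.X.Path) :=
  ⟨fun x => (R.S.incl (c.1+1)).toFunP ((R.S.cellMap c.1 c.2).toFunP x),
    (R.S.incl (c.1+1)).continuous_toFunP.comp (R.S.cellMap c.1 c.2).continuous_toFunP⟩

/-- the elementary paths -/
def letter (g : R.Ltr) : R.X.Path := R.chi g.1 g.2.1

theorem incl_ι (n : ℕ) (w) : (R.S.incl (n+1)).toFunP ((R.S.ι n).toFunP w) = (R.S.incl n).toFunP w := by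
  have := congrArg FlowHom.toFunP (R.S.incl_comm n)
  exact congrFun this w

theorem cell_bd (c : R.Cell) (x : diskBoundary c.1) :
    (R.S.cellMap c.1 c.2).toFunP (diskBoundaryInclusion c.1 x) =
      (R.S.ι c.1).toFunP ((R.S.attachMap c.1 c.2).toFunP x) := by
  have := congrArg FlowHom.toFunP (R.S.attach_comm c.1 c.2)
  exact congrFun this x

theorem chi_bd (c : R.Cell) (x : diskBoundary c.1) :
    R.chi c (diskBoundaryInclusion c.1 x) =
      (R.S.incl c.1).toFunP ((R.S.attachMap c.1 c.2).toFunP x) :=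
  (congrArg (R.S.incl (c.1+1)).toFunP (R.cell_bd c x)).trans (R.incl_ι _ _)

/-- elementary paths of the skeleta -/
def Ls : ∀ m, Set (R.S.sk m).Path
  | 0 => ∅
  | m+1 => (R.S.ι m).toFunP '' Ls m ∪ {w | ∃ (e : R.S.cells m) (x : closedDisk m), ‖x.1‖ < 1 ∧
      w = (R.S.cellMap m e).toFunP x}

theorem words_sk (m : ℕ) : ∀ w, Words (R.Ls m) w := by
  induction m with
  | zero => intro w; exact (R.S.isEmpty_path_sk_zero.false w).elim
  | succ m ih =>
    have h1 : ∀ w, Words (R.Ls (m+1)) ((R.S.ι m).toFunP w) := fun w =>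
      (ih w).map (R.S.ι m) fun v hv => Or.inl ⟨v, hv, rfl⟩
    refine R.S.gen_sk m _ (fun x y h hx hy => hx.mul hy h) h1 fun i x => ?_
    rcases (disk_norm_le x).lt_or_eq with hx | hx
    · exact Words.base _ (Or.inr ⟨i, x, hx, rfl⟩)
    · have := R.cell_bd ⟨m, i⟩ (mkS x.1 hx)
      rw [incl_mkS] at this
      rw [this]
      exact h1 _

theorem words_X : ∀ w, Words (Set.range R.letter) w := by
  have hL : ∀ m, ∀ w ∈ R.Ls m, (R.S.incl m).toFunP w ∈ Set.range R.letter := by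
    intro m
    induction m with
    | zero => intro w hw; exact absurd hw (by simp [Ls])
    | succ m ih =>
      rintro w (⟨v, hv, rfl⟩ | ⟨e, x, hx, rfl⟩)
      · rw [incl_ι]; exact ih v hv
      · exact ⟨⟨⟨m, e⟩, ⟨x, hx⟩⟩, rfl⟩
  exact R.S.gen_X _ (fun x y h hx hy => hx.mul hy h) fun n w => (R.words_sk n w).map _ (hL n)

theorem nu {M : Type} [TopologicalSpace M] (op : M → M → M)
    (hc : Continuous fun p : M × M => op p.1 p.2) (ha : ∀ x y z, op x (op y z) = op (op x y) z)
    (Cond : ∀ c : R.Cell, (closedDisk c.1 → M) → Prop)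
    (H : ∀ (c : R.Cell) (b : C(diskBoundary c.1, M)), ∃ f : C(closedDisk c.1, M),
      (∀ x, f (diskBoundaryInclusion c.1 x) = b x) ∧ Cond c f) :
    ∃ ν : R.X.Path → M, Continuous ν ∧ (∀ x y h, ν (R.X.comp x y h) = op (ν x) (ν y)) ∧
      ∀ c, Cond c (fun x => ν (R.chi c x)) := by
  let Z := semiFlow M op hc ha
  let I : ∀ n, FlowHom (R.S.sk n) Z → Prop := fun n => match n with
    | 0 => fun _ => True
    | k+1 => fun g => ∀ e, Cond ⟨k, e⟩ (fun x => g.toFunP ((R.S.cellMap k e).toFunP x))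
  suffices hh : ∃ h : FlowHom R.X Z, ∀ n, I n (h.comp (R.S.incl n)) by
    obtain ⟨h, hh⟩ := hh
    refine ⟨h.toFunP, h.continuous_toFunP, fun x y hxy => h.comp_map x y hxy rfl, fun c => ?_⟩
    exact hh (c.1+1) c.2
  refine R.S.recur Z I ⟨homOfEmpty R.S.isEmpty_path_sk_zero _ fun _ => (), trivial⟩ ?_
  intro n g _
  choose f hf1 hf2 using fun e => H ⟨n, e⟩ (g.comp (R.S.attachMap n e)).pathMap
  obtain ⟨g', ⟨hg1, hg2⟩, -⟩ := R.S.attach_isPushout n Z g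
    (fun e => globHom (Z := Z) (fun _ => ()) (f e) (fun _ => rfl) (fun _ => rfl))
    (fun e => FlowHom.ext rfl (funext fun x => hf1 e x))
  refine ⟨g', hg1, fun e => ?_⟩
  have := congrArg FlowHom.toFunP (hg2 e)
  have h3 : (fun x => g'.toFunP ((R.S.cellMap n e).toFunP x)) = (f e) := this
  show Cond ⟨n, e⟩ (fun x => g'.toFunP ((R.S.cellMap n e).toFunP x))
  exact (congrArg (Cond ⟨n, e⟩) h3).mpr (hf2 e)

theorem exists_N : ∃ N : R.X.Path → List R.Ltr,
    (∀ x y h, N (R.X.comp x y h) = N x ++ N y) ∧ ∀ g, N (R.letter g) = [g] := by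
  obtain ⟨ν, -, h1, h2⟩ := R.nu (M := Ind (List R.Ltr)) (fun x y => List.append x y) continuous_top
    (fun x y z => (List.append_assoc x y z).symm)
    (fun (c : R.Cell) (f : closedDisk c.1 → Ind (List R.Ltr)) => ∀ (x : closedDisk c.1) (hx : ‖x.1‖ < 1), f x = ([⟨c, ⟨x, hx⟩⟩] : List R.Ltr)) (by
      classical
      intro c b
      refine ⟨⟨fun x => if h : ‖x.1‖ = 1 then b (mkS x.1 h) else
        if hx : ‖x.1‖ < 1 then ([⟨c, ⟨x, hx⟩⟩] : List R.Ltr) else ([] : List R.Ltr), continuous_top⟩, ?_, ?_⟩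
      · intro x
        have : ‖(diskBoundaryInclusion c.1 x).1‖ = 1 := sph_norm x
        exact (dif_pos this).trans rfl
      · intro x hx
        exact (dif_neg hx.ne).trans (dif_pos hx))
  exact ⟨ν, h1, fun g => h2 g.1 g.2.1 g.2.2⟩

/-- the list of letters -/
noncomputable def N : R.X.Path → List R.Ltr := R.exists_N.choose
theorem N_comp (x y h) : R.N (R.X.comp x y h) = R.N x ++ R.N y := R.exists_N.choose_spec.1 x y h
theorem N_letter (g) : R.N (R.letter g) = [g] := R.exists_N.choose_spec.2 g

theorem N_inj : Function.Injective R.N := by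
  intro x y hxy
  refine Words.inj R.N R.N_comp ?_ ?_ (R.words_X x) (R.words_X y) hxy
  · rintro _ ⟨g, rfl⟩; exact ⟨g, R.N_letter g⟩
  · rintro _ ⟨g, rfl⟩ _ ⟨g', rfl⟩ h
    rw [N_letter, N_letter] at h
    rw [show g = g' by simpa using h]

theorem incl_inj (m : ℕ) : Function.Injective (R.S.incl m).toFunP := by
  have key : ∀ m, (∀ w ∈ R.Ls m, ∃ g : R.Ltr, g.1.1 < m ∧ R.N ((R.S.incl m).toFunP w) = [g]) ∧
      ∀ w ∈ R.Ls m, ∀ w' ∈ R.Ls m, R.N ((R.S.incl m).toFunP w) = R.N ((R.S.incl m).toFunP w') → w = w' := by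
    intro m
    induction m with
    | zero => simp [Ls]
    | succ m ih =>
      have hcell : ∀ (e : R.S.cells m) (x : closedDisk m) (hx : ‖x.1‖ < 1),
          R.N ((R.S.incl (m+1)).toFunP ((R.S.cellMap m e).toFunP x)) = [⟨⟨m, e⟩, ⟨x, hx⟩⟩] :=
        fun e x hx => R.N_letter ⟨⟨m, e⟩, ⟨x, hx⟩⟩
      refine ⟨?_, ?_⟩
      · rintro w (⟨v, hv, rfl⟩ | ⟨e, x, hx, rfl⟩)
        · obtain ⟨g, hg1, hg2⟩ := ih.1 v hv
          exact ⟨g, hg1.trans (Nat.lt_succ_self m), by rw [incl_ι, hg2]⟩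
        · exact ⟨⟨⟨m, e⟩, ⟨x, hx⟩⟩, Nat.lt_succ_self m, hcell e x hx⟩
      · rintro w (⟨v, hv, rfl⟩ | ⟨e, x, hx, rfl⟩) w' (⟨v', hv', rfl⟩ | ⟨e', x', hx', rfl⟩) h
        · rw [incl_ι, incl_ι] at h
          rw [ih.2 v hv v' hv' h]
        · obtain ⟨g, hg1, hg2⟩ := ih.1 v hv
          rw [incl_ι, hg2, hcell e' x' hx'] at h
          have : g = ⟨⟨m, e'⟩, ⟨x', hx'⟩⟩ := by simpa using h
          subst this; exact absurd hg1 (lt_irrefl _)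
        · obtain ⟨g, hg1, hg2⟩ := ih.1 v' hv'
          rw [incl_ι, hg2, hcell e x hx] at h
          have : ⟨⟨m, e⟩, ⟨x, hx⟩⟩ = g := by simpa using h
          subst this; exact absurd hg1 (lt_irrefl _)
        · rw [hcell e x hx, hcell e' x' hx'] at h
          have : (⟨⟨m, e⟩, ⟨x, hx⟩⟩ : R.Ltr) = ⟨⟨m, e'⟩, ⟨x', hx'⟩⟩ := by simpa using h
          cases this; rfl
  intro x y hxy
  refine Words.inj (fun w => R.N ((R.S.incl m).toFunP w)) ?_ ?_ (key m).2 (R.words_sk m x) (R.words_sk m y)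
    (congrArg R.N hxy)
  · intro x y h
    show R.N ((R.S.incl m).toFunP _) = _
    rw [(R.S.incl m).comp_map x y h ((R.S.incl m).composable h), N_comp]
  · intro w hw
    obtain ⟨g, -, hg⟩ := (key m).1 w hw
    exact ⟨g, hg⟩

/-- the type of a path -/
noncomputable def tp (w : R.X.Path) : List R.Cell := (R.N w).map Sigma.fst
theorem tp_comp (x y h) : R.tp (R.X.comp x y h) = R.tp x ++ R.tp y := by simp [tp, N_comp]
theorem tp_letter (g) : R.tp (R.letter g) = [g.1] := by simp [tp, N_letter]

/-- dimension of a type -/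
def dimL (ω : List R.Cell) : ℕ := (ω.map Sigma.fst).sum

theorem δ_letter (g) : R.δ (R.letter g) = g.1.1 := R.h1 g.1.1 g.1.2 g.2.1 g.2.2

theorem δ_tp (w) : R.δ w = R.dimL (R.tp w) := by
  have := R.words_X w
  induction this with
  | base w hw => obtain ⟨g, rfl⟩ := hw; simp [δ_letter, tp_letter, dimL]
  | cons a w ha hw h ih =>
    obtain ⟨g, rfl⟩ := ha
    rw [R.hδ, ih, tp_comp, tp_letter, δ_letter]; simp [dimL]

theorem decomp (w) : (∃ g, w = R.letter g) ∨ ∃ g w' h, w = R.X.comp (R.letter g) w' h := by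
  cases R.words_X w with
  | base w hw => obtain ⟨g, rfl⟩ := hw; exact Or.inl ⟨g, rfl⟩
  | cons a w ha hw h => obtain ⟨g, rfl⟩ := ha; exact Or.inr ⟨g, w, h, rfl⟩

theorem exists_tr {k m : ℕ} (h : k ≤ m) : ∃ τ : FlowHom (R.S.sk k) (R.S.sk m), (R.S.incl m).comp τ = R.S.incl k := by
  induction m, h using Nat.le_induction with
  | base => exact ⟨FlowHom.id _, rfl⟩
  | succ m h ih =>
    obtain ⟨τ, hτ⟩ := ih
    exact ⟨(R.S.ι m).comp τ, by rw [← FlowHom.comp_assoc, R.S.incl_comm, hτ]⟩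

end Repl
end PartD3

section PartD4
open Set Metric Topology
local notation "II" => unitInterval

theorem bdEmb (n : ℕ) : IsClosedEmbedding (diskBoundaryInclusion n) :=
  (diskBoundaryInclusion n).continuous.isClosedEmbedding (fun x y h => by
    have := congrArg Subtype.val h
    exact Subtype.ext this)

theorem tietzeDisk {n : ℕ} (b : C(diskBoundary n, ℝ)) :
    ∃ f : C(closedDisk n, ℝ), ∀ x, f (diskBoundaryInclusion n x) = b x := by
  obtain ⟨f, hf⟩ := ContinuousMap.exists_extension' (bdEmb n) b
  exact ⟨f, fun x => congrFun hf x⟩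

theorem adjust {Z : Type*} [TopologicalSpace Z] [NormalSpace Z] [T1Space Z] (A : Set Z) (hA : IsClosed A)
    (f : C(Z, ℝ)) (v : Z → ℝ) (P : Finset Z) (hP : ∀ p ∈ P, p ∉ A) :
    ∃ f' : C(Z, ℝ), (∀ a ∈ A, f' a = f a) ∧ ∀ p ∈ P, f' p = v p := by
  classical
  induction P using Finset.induction_on with
  | empty => exact ⟨f, fun _ _ => rfl, by simp⟩
  | insert p P hp ih =>
    obtain ⟨f', h1, h2⟩ := ih fun q hq => hP q (Finset.mem_insert_of_mem hq)
    obtain ⟨u, hu0, hu1, -⟩ := exists_continuous_zero_one_of_isClosed (s := A ∪ (P : Set Z)) (t := {p})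
      (hA.union P.finite_toSet.isClosed) isClosed_singleton (by
        rw [Set.disjoint_singleton_right]
        rintro (h | h)
        · exact hP p (Finset.mem_insert_self _ _) h
        · exact hp h)
    refine ⟨⟨fun x => f' x + u x * (v p - f' p), by fun_prop⟩, fun a ha => ?_, fun q hq => ?_⟩
    · have : u a = 0 := hu0 (Or.inl ha)
      simp [this, h1 a ha]
    · rcases Finset.mem_insert.1 hq with rfl | hq
      · have : u q = 1 := hu1 rfl
        simp [this]
      · have : u q = 0 := hu0 (Or.inr hq)
        simp [this, h2 q hq]

theorem map_injOn {α β : Type*} (d : α → β) (F : Finset α) (h : ∀ g ∈ F, ∀ g' ∈ F, d g = d g' → g = g') :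
    ∀ l l' : List α, (∀ g ∈ l, g ∈ F) → (∀ g ∈ l', g ∈ F) → l.map d = l'.map d → l = l'
  | [], [], _, _, _ => rfl
  | [], _ :: _, _, _, e => by simp at e
  | _ :: _, [], _, _, e => by simp at e
  | a :: l, a' :: l', h1, h2, e => by
    simp only [List.map_cons, List.cons.injEq] at e
    rw [h a (h1 a (by simp)) a' (h2 a' (by simp)) e.1,
      map_injOn d F h l l' (fun g hg => h1 g (by simp [hg])) (fun g hg => h2 g (by simp [hg])) e.2]

namespace Repl
variable {Y : Flow} (R : Repl Y)

theorem N_ind {P : R.X.Path → Prop} (h1 : ∀ g, P (R.letter g))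
    (h2 : ∀ g w h, P w → P (R.X.comp (R.letter g) w h)) (w) : P w := by
  have := R.words_X w
  induction this with
  | base w hw => obtain ⟨g, rfl⟩ := hw; exact h1 g
  | cons a w ha hw h ih => obtain ⟨g, rfl⟩ := ha; exact h2 g w h ih

theorem nu_len (κ : R.Cell → ℝ) : ∃ ν : R.X.Path → ℝ, Continuous ν ∧
    (∀ w, ((R.N w).length : ℝ) ≤ ν w + 1) ∧ ∀ w, ∀ g ∈ R.N w, κ g.1 * (1 - ‖g.2.1.1‖) ≤ ν w := by
  have hpos : ∀ x : ℝ, 0 ≤ max x 0 := fun x => le_max_right _ _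
  obtain ⟨ν, hc, h1, h2⟩ := R.nu (M := {x : ℝ // 0 ≤ x}) (fun x y => ⟨x.1 + y.1 + 1, by linarith [x.2, y.2]⟩)
    (by fun_prop) (fun x y z => Subtype.ext (by simp only; ring))
    (fun (c : R.Cell) (f : closedDisk c.1 → {x : ℝ // 0 ≤ x}) => ∀ x : closedDisk c.1, κ c * (1 - ‖x.1‖) ≤ (f x).1) (by
      intro c b
      obtain ⟨f, hf⟩ := tietzeDisk (⟨fun x => (b x).1, by fun_prop⟩ : C(diskBoundary c.1, ℝ))
      refine ⟨⟨fun x => ⟨max (f x) 0 + max (κ c) 0 * (1 - ‖x.1‖), ?_⟩, ?_⟩, ?_, ?_⟩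
      · have := disk_norm_le x
        have := mul_nonneg (hpos (κ c)) (sub_nonneg.2 this)
        linarith [hpos (f x)]
      · fun_prop
      · intro x
        apply Subtype.ext
        have e1 : ‖(diskBoundaryInclusion c.1 x).1‖ = 1 := sph_norm x
        have e2 : f (diskBoundaryInclusion c.1 x) = (b x).1 := hf x
        show max (f (diskBoundaryInclusion c.1 x)) 0 + max (κ c) 0 * (1 - ‖(diskBoundaryInclusion c.1 x).1‖) = (b x).1
        rw [e1, e2, max_eq_left (b x).2]; ring
      · intro x
        show κ c * (1 - ‖x.1‖) ≤ max (f x) 0 + max (κ c) 0 * (1 - ‖x.1‖)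
        have h1 := mul_le_mul_of_nonneg_right (le_max_left (κ c) 0) (sub_nonneg.2 (disk_norm_le x))
        linarith [hpos (f x)])
  have h1' : ∀ x y h, (ν (R.X.comp x y h)).1 = (ν x).1 + (ν y).1 + 1 := fun x y h => by rw [h1]
  refine ⟨fun w => (ν w).1, by fun_prop, ?_, ?_⟩
  · refine R.N_ind ?_ ?_
    · intro g; rw [N_letter]; have := (ν (R.letter g)).2; simpa using this
    · intro g w h ih
      simp only [N_comp, N_letter, h1'] at ih ⊢
      have := (ν (R.letter g)).2
      push_cast [List.length_append, List.length_singleton]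
      linarith
  · have hl : ∀ g : R.Ltr, κ g.1 * (1 - ‖g.2.1.1‖) ≤ (ν (R.letter g)).1 := fun g => h2 g.1 g.2.1
    refine R.N_ind ?_ ?_
    · intro g g' hg'; rw [N_letter] at hg'
      rw [List.mem_singleton.1 hg']; exact hl g
    · intro g w h ih g' hg'
      rw [N_comp, N_letter] at hg'
      simp only [h1']
      have p1 := (ν (R.letter g)).2
      have p2 := (ν w).2
      rcases List.mem_append.1 hg' with hg' | hg'
      · rw [List.mem_singleton.1 hg']; linarith [hl g]
      · linarith [ih g' hg']

theorem tp_finite {K : Set R.X.Path} (hK : IsCompact K) : (R.tp '' K).Finite := by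
  classical
  have hC : {c : R.Cell | ∃ w ∈ K, c ∈ R.tp w}.Finite := by
    by_contra hinf
    have hinf : {c : R.Cell | ∃ w ∈ K, c ∈ R.tp w}.Infinite := hinf
    let c := hinf.natEmbedding
    have hc : ∀ i, ∃ w ∈ K, ∃ g ∈ R.N w, g.1 = (c i).1 := by
      intro i
      obtain ⟨w, hw, h⟩ := (c i).2
      obtain ⟨g, hg, he⟩ := List.mem_map.1 h
      exact ⟨w, hw, g, hg, he⟩
    choose w hw g hg he using hc
    have cinj : Function.Injective fun i => (c i).1 := Subtype.val_injective.comp c.injective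
    obtain ⟨ν, hν, -, h2⟩ := R.nu_len (Function.extend (fun i => (c i).1) (fun i => (i : ℝ) / (1 - ‖(g i).2.1.1‖)) 0)
    have key : ∀ i : ℕ, (i : ℝ) ≤ ν (w i) := by
      intro i
      have := h2 _ _ (hg i)
      have ev := (congrArg (Function.extend (fun i => (c i).1) (fun i => (i : ℝ) / (1 - ‖(g i).2.1.1‖)) 0) (he i)).trans
        (cinj.extend_apply _ _ i)
      rw [ev] at this
      have hp : (1 - ‖(g i).2.1.1‖) ≠ 0 := (sub_pos.2 (g i).2.2).ne'
      rwa [div_mul_cancel₀ _ hp] at this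
    obtain ⟨B, hB⟩ := (hK.image hν).bddAbove
    obtain ⟨i, hi⟩ := exists_nat_gt B
    exact absurd (hB ⟨_, hw i, rfl⟩) (not_le.2 (hi.trans_le (key i)))
  obtain ⟨ν, hν, h1, -⟩ := R.nu_len 0
  obtain ⟨B, hB⟩ := (hK.image hν).bddAbove
  obtain ⟨n, hn⟩ := exists_nat_gt (B + 1)
  have : Finite {c : R.Cell | ∃ w ∈ K, c ∈ R.tp w} := hC
  refine ((List.finite_length_le {c : R.Cell | ∃ w ∈ K, c ∈ R.tp w} n).image (List.map Subtype.val)).subset ?_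
  rintro _ ⟨w, hw, rfl⟩
  refine ⟨(R.tp w).attach.map fun c => ⟨c.1, w, hw, c.2⟩, ?_, ?_⟩
  · have h2 : ((R.N w).length : ℝ) ≤ n := by
      have := hB ⟨w, hw, rfl⟩
      linarith [h1 w]
    have : (R.tp w).length = (R.N w).length := by simp [tp]
    show List.length _ ≤ n
    rw [List.length_map, List.length_attach, this]; exact_mod_cast h2
  · simp

theorem sep (w w' : R.X.Path) (hw : w ≠ w') : ∃ ν : R.X.Path → ℝ × ℝ, Continuous ν ∧ ν w ≠ ν w' := by
  classical
  let F : Finset R.Ltr := (R.N w ++ R.N w').toFinset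
  let B : ℕ := F.card + 2
  let d : R.Ltr → ℕ := fun g => if h : g ∈ F then (F.equivFin ⟨g, h⟩ : ℕ) else 0
  have dlt : ∀ g, d g < B := by
    intro g
    by_cases h : g ∈ F
    · simp only [d, dif_pos h]; have := (F.equivFin ⟨g, h⟩).2; omega
    · simp only [d, dif_neg h]; omega
  have dinj : ∀ g ∈ F, ∀ g' ∈ F, d g = d g' → g = g' := by
    intro g h g' h' e
    simp only [d, dif_pos h, dif_pos h'] at e
    have := F.equivFin.injective (Fin.ext e)
    exact congrArg Subtype.val this
  obtain ⟨ν, hc, h1, h2⟩ := R.nu (M := ℝ × ℝ) (fun x y => (x.1 * y.1, x.1 * y.2 + x.2))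
    (by fun_prop) (fun x y z => Prod.ext (by simp only; ring) (by simp only; ring))
    (fun (c : R.Cell) (f : closedDisk c.1 → ℝ × ℝ) => ∀ (x : closedDisk c.1) (hx : ‖x.1‖ < 1),
      (⟨c, ⟨x, hx⟩⟩ : R.Ltr) ∈ F → f x = ((B : ℝ), (d ⟨c, ⟨x, hx⟩⟩ : ℝ))) (by
      intro c b
      obtain ⟨f1, hf1⟩ := tietzeDisk (⟨fun x => (b x).1, by fun_prop⟩ : C(diskBoundary c.1, ℝ))
      obtain ⟨f2, hf2⟩ := tietzeDisk (⟨fun x => (b x).2, by fun_prop⟩ : C(diskBoundary c.1, ℝ))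
      have hA : IsClosed {x : closedDisk c.1 | ‖x.1‖ = 1} := isClosed_eq (by fun_prop) continuous_const
      have hP : {x : closedDisk c.1 | ∃ hx : ‖x.1‖ < 1, (⟨c, ⟨x, hx⟩⟩ : R.Ltr) ∈ F}.Finite := by
        have hf : (F : Set R.Ltr).Finite := F.finite_toSet
        have : {y : {x : closedDisk c.1 // ‖x.1‖ < 1} | (⟨c, y⟩ : R.Ltr) ∈ F}.Finite :=
          hf.preimage (f := fun y : {x : closedDisk c.1 // ‖x.1‖ < 1} => (⟨c, y⟩ : R.Ltr)) (fun y _ y' _ h => by simpa using h)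
        refine (this.image Subtype.val).subset ?_
        rintro x ⟨hx, h⟩
        exact ⟨⟨x, hx⟩, h, rfl⟩
      have hPA : ∀ p ∈ hP.toFinset, p ∉ {x : closedDisk c.1 | ‖x.1‖ = 1} := by
        intro p hp h
        obtain ⟨hx, -⟩ := hP.mem_toFinset.1 hp
        exact hx.ne h
      obtain ⟨k1, hk1, hk1'⟩ := adjust _ hA f1 (fun _ => (B : ℝ)) hP.toFinset hPA
      obtain ⟨k2, hk2, hk2'⟩ := adjust _ hA f2 (fun x => if hx : ‖x.1‖ < 1 then (d ⟨c, ⟨x, hx⟩⟩ : ℝ) else 0) hP.toFinset hPA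
      refine ⟨⟨fun x => (k1 x, k2 x), by fun_prop⟩, fun x => ?_, fun x hx hF => ?_⟩
      · have e1 : ‖(diskBoundaryInclusion c.1 x).1‖ = 1 := sph_norm x
        exact Prod.ext ((hk1 _ e1).trans (hf1 x)) ((hk2 _ e1).trans (hf2 x))
      · have := hP.mem_toFinset.2 ⟨hx, hF⟩
        exact Prod.ext (hk1' x this) ((hk2' x this).trans (dif_pos hx)))
  have hl : ∀ g ∈ F, ν (R.letter g) = ((B : ℝ), (d g : ℝ)) := fun g hg => h2 g.1 g.2.1 g.2.2 hg
  have key : ∀ v, (∀ g ∈ R.N v, g ∈ F) → ν v = (((B ^ (R.N v).length : ℕ) : ℝ), ((Nat.ofDigits B ((R.N v).map d) : ℕ) : ℝ)) := by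
    refine R.N_ind ?_ ?_
    · intro g hg
      rw [N_letter] at hg ⊢
      rw [hl g (hg g (by simp))]; simp
    · intro g v h ih hg
      rw [N_comp, N_letter] at hg ⊢
      rw [h1, hl g (hg g (by simp)), ih fun g' hg' => hg g' (by simp [hg'])]
      simp [Nat.ofDigits_cons, pow_succ]
      constructor <;> ring
  refine ⟨ν, hc, fun e => hw (R.N_inj ?_)⟩
  have m1 : ∀ g ∈ R.N w, g ∈ F := fun g hg => by simp [F, hg]
  have m2 : ∀ g ∈ R.N w', g ∈ F := fun g hg => by simp [F, hg]
  rw [key w m1, key w' m2, Prod.mk.injEq] at e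
  obtain ⟨e1, e2⟩ := e
  have hB : 1 < B := by omega
  have len : (R.N w).length = (R.N w').length := Nat.pow_right_injective hB (by exact_mod_cast e1)
  have e3 : (R.N w).map d = (R.N w').map d := Nat.ofDigits_inj_of_len_eq hB (by simpa using len)
    (by simp only [List.mem_map]; rintro _ ⟨g, -, rfl⟩; exact dlt g)
    (by simp only [List.mem_map]; rintro _ ⟨g, -, rfl⟩; exact dlt g) (by exact_mod_cast e2)
  exact map_injOn d F dinj _ _ m1 m2 e3

theorem t2 : T2Space R.X.Path := ⟨fun w w' h => by
  obtain ⟨ν, hν, hne⟩ := R.sep w w' h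
  exact separated_by_continuous hν hne⟩

end Repl
end PartD4

section PartD5
open Set Metric Topology
local notation "II" => unitInterval

/-- characteristic map of the open stratum of paths of a given type -/
structure WordCell {Y : Flow} (R : Repl Y) (ω : List R.Cell) : Type 1 where
  V : Type
  [nacg : NormedAddCommGroup V]
  [nsp : NormedSpace ℝ V]
  [fd : FiniteDimensional ℝ V]
  fr : Module.finrank ℝ V = R.dimL ω
  χ : C(closedBall (0 : V) 1, R.X.Path)
  surj : ∀ w, R.tp w = ω → ∃ v, ‖v.1‖ < 1 ∧ χ v = w
  htp : ∀ v, ‖v.1‖ < 1 → R.tp (χ v) = ω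
  inj : ∀ v v', ‖v.1‖ < 1 → ‖v'.1‖ < 1 → χ v = χ v' → v = v'
  bd : ∀ v, ‖v.1‖ = 1 → R.δ (χ v) < R.dimL ω
  lift : ∀ m, (∀ c ∈ ω, c.1 < m) → ∃ Ψ : C(closedBall (0 : V) 1, (R.S.sk m).Path), ∀ v, (R.S.incl m).toFunP (Ψ v) = χ v

attribute [instance] WordCell.nacg WordCell.nsp WordCell.fd

theorem ball_norm_le {V : Type*} [NormedAddCommGroup V] (v : closedBall (0 : V) 1) : ‖v.1‖ ≤ 1 := by
  have := v.2
  rwa [mem_closedBall_zero_iff] at this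

namespace WordCell
variable {Y : Flow} {R : Repl Y}

theorem δ_le {ω} (W : WordCell R ω) (v) : R.δ (W.χ v) ≤ R.dimL ω := by
  rcases (ball_norm_le v).lt_or_eq with h | h
  · rw [R.δ_tp, W.htp v h]
  · exact (W.bd v h).le

theorem inj' {ω} (W : WordCell R ω) (v w) (hv : ‖v.1‖ < 1) (h : W.χ v = W.χ w) : v = w := by
  rcases (ball_norm_le w).lt_or_eq with hw | hw
  · exact W.inj v w hv hw h
  · have := W.bd w hw
    rw [← h, R.δ_tp, W.htp v hv] at this
    exact absurd this (lt_irrefl _)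

theorem tp_length_pos (w) : R.tp w ≠ [] := by
  rcases R.decomp w with ⟨g, rfl⟩ | ⟨g, w', h, rfl⟩
  · simp [R.tp_letter]
  · simp [R.tp_comp, R.tp_letter]

/-- one letter -/
noncomputable def single (c : R.Cell) : WordCell R [c] where
  V := EuclideanSpace ℝ (Fin c.1)
  fr := by simp [Repl.dimL]
  χ := R.chi c
  surj w hw := by
    rcases R.decomp w with ⟨g, rfl⟩ | ⟨g, w', h, rfl⟩
    · rw [R.tp_letter] at hw
      obtain ⟨c', x, hx⟩ := g
      have : c' = c := by simpa using hw
      subst this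
      exact ⟨x, hx, rfl⟩
    · rw [R.tp_comp, R.tp_letter] at hw
      have : g.1 = c ∧ R.tp w' = [] := by simpa using hw
      exact absurd this.2 (tp_length_pos _)
  htp v hv := R.tp_letter ⟨c, ⟨v, hv⟩⟩
  inj v v' hv hv' h := by
    have := (R.N_letter ⟨c, ⟨v, hv⟩⟩).symm.trans ((congrArg R.N h).trans (R.N_letter ⟨c, ⟨v', hv'⟩⟩))
    simpa using this
  bd v hv := by
    have := R.chi_bd c (mkS v.1 hv)
    rw [incl_mkS] at this
    rw [this]
    have h := R.h2 c.1 c.2 (mkS v.1 hv)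
    simpa [Repl.dimL] using h
  lift m hm := by
    obtain ⟨τ, hτ⟩ := R.exists_tr (Nat.succ_le_of_lt (hm c (by simp)))
    refine ⟨⟨fun x => τ.toFunP ((R.S.cellMap c.1 c.2).toFunP x),
      τ.continuous_toFunP.comp (R.S.cellMap c.1 c.2).continuous_toFunP⟩, fun v => ?_⟩
    have := congrArg FlowHom.toFunP hτ
    exact congrFun this _

theorem const_of_ball {V : Type} [NormedAddCommGroup V] [NormedSpace ℝ V] {A : Type*} 
    (f : closedBall (0 : V) 1 → A) (hf : ∀ a, IsOpen (f ⁻¹' {a})) (v w) : f v = f w := by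
  have : PreconnectedSpace (closedBall (0 : V) 1) :=
    isPreconnected_iff_preconnectedSpace.1 (convex_closedBall (0 : V) 1).isPreconnected
  have hl : IsLocallyConstant f := IsLocallyConstant.iff_isOpen_fiber.2 hf
  exact hl.apply_eq_of_preconnectedSpace v w

theorem ht {ω} (W : WordCell R ω) (v w) : R.X.t (W.χ v) = R.X.t (W.χ w) :=
  const_of_ball (fun v => R.X.t (W.χ v)) (fun a => R.X.isOpen_pre_t W.χ.continuous a) v w

theorem hs {ω} (W : WordCell R ω) (v w) : R.X.s (W.χ v) = R.X.s (W.χ w) :=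
  const_of_ball (fun v => R.X.s (W.χ v)) (fun a => R.X.isOpen_pre_s W.χ.continuous a) v w

theorem prod_lt {V V' : Type} [NormedAddCommGroup V] [NormedAddCommGroup V'] (v : V × V') (r : ℝ) : ‖v‖ < r ↔ ‖v.1‖ < r ∧ ‖v.2‖ < r := by
  rw [Prod.norm_def]; exact max_lt_iff

/-- first coordinate -/
def p1 {V V' : Type} [NormedAddCommGroup V] [NormedAddCommGroup V'] (v : closedBall (0 : V × V') 1) : closedBall (0 : V) 1 :=
  ⟨v.1.1, by rw [mem_closedBall_zero_iff]; exact (norm_fst_le _).trans (ball_norm_le v)⟩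
/-- second coordinate -/
def p2 {V V' : Type} [NormedAddCommGroup V] [NormedAddCommGroup V'] (v : closedBall (0 : V × V') 1) : closedBall (0 : V') 1 :=
  ⟨v.1.2, by rw [mem_closedBall_zero_iff]; exact (norm_snd_le _).trans (ball_norm_le v)⟩

theorem cont_p1 {V V' : Type} [NormedAddCommGroup V] [NormedAddCommGroup V'] : Continuous (p1 (V := V) (V' := V')) :=
  Continuous.subtype_mk (continuous_fst.comp continuous_subtype_val) _
theorem cont_p2 {V V' : Type} [NormedAddCommGroup V] [NormedAddCommGroup V'] : Continuous (p2 (V := V) (V' := V')) :=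
  Continuous.subtype_mk (continuous_snd.comp continuous_subtype_val) _

/-- concatenation -/
noncomputable def mul {ω ω' : List R.Cell} (W : WordCell R ω) (W' : WordCell R ω')
    (hc : ∀ v v', R.X.t (W.χ v) = R.X.s (W'.χ v'))
    (hdec : ∀ w, R.tp w = ω ++ ω' → ∃ x y h, R.tp x = ω ∧ R.tp y = ω' ∧ w = R.X.comp x y h) : WordCell R (ω ++ ω') where
  V := W.V × W'.V
  fr := by rw [Module.finrank_prod, W.fr, W'.fr]; simp [Repl.dimL]
  χ := ⟨fun v => R.X.comp (W.χ (p1 v)) (W'.χ (p2 v)) (hc _ _),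
    R.X.cont_comp (W.χ.continuous.comp cont_p1) (W'.χ.continuous.comp cont_p2) _⟩
  surj w hw := by
    obtain ⟨x, y, h, hx, hy, rfl⟩ := hdec w hw
    obtain ⟨v, hv, e⟩ := W.surj x hx
    obtain ⟨v', hv', e'⟩ := W'.surj y hy
    have : ‖((v.1, v'.1) : W.V × W'.V)‖ < 1 := (prod_lt _ _).2 ⟨hv, hv'⟩
    exact ⟨⟨(v.1, v'.1), by rw [mem_closedBall_zero_iff]; exact this.le⟩, this, FlowHom.cong_comp _ _ e e'⟩
  htp v hv := by
    obtain ⟨h1, h2⟩ := (prod_lt _ _).1 hv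
    exact (R.tp_comp _ _ _).trans (by rw [W.htp (p1 v) h1, W'.htp (p2 v) h2])
  inj v v' hv hv' h := by
    obtain ⟨h1, h2⟩ := (prod_lt _ _).1 hv
    obtain ⟨h1', h2'⟩ := (prod_lt _ _).1 hv'
    have e := (R.N_comp _ _ _).symm.trans ((congrArg R.N h).trans (R.N_comp _ _ _))
    have hl : ∀ z : closedBall (0 : W.V) 1, ‖z.1‖ < 1 → (R.N (W.χ z)).length = ω.length := by
      intro z hz
      have := congrArg List.length (W.htp z hz)
      simpa [Repl.tp] using this
    obtain ⟨e1, e2⟩ := List.append_inj e ((hl (p1 v) h1).trans (hl (p1 v') h1').symm)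
    have k1 := W.inj _ _ h1 h1' (R.N_inj e1)
    have k2 := W'.inj _ _ h2 h2' (R.N_inj e2)
    exact Subtype.ext (Prod.ext (congrArg Subtype.val k1) (congrArg Subtype.val k2))
  bd v hv := by
    have e : R.δ (R.X.comp (W.χ (p1 v)) (W'.χ (p2 v)) (hc _ _)) = _ := R.hδ _ _ _
    have d : R.dimL (ω ++ ω') = R.dimL ω + R.dimL ω' := by simp [Repl.dimL]
    refine e.trans_lt ?_
    rw [d]
    have l1 := W.δ_le (p1 v)
    have l2 := W'.δ_le (p2 v)
    have : ‖v.1.1‖ = 1 ∨ ‖v.1.2‖ = 1 := by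
      rw [Prod.norm_def] at hv
      rcases max_choice ‖v.1.1‖ ‖v.1.2‖ with h | h
      · left; exact h.symm.trans hv
      · right; exact h.symm.trans hv
    rcases this with h | h
    · have := W.bd (p1 v) h; omega
    · have := W'.bd (p2 v) h; omega
  lift m hm := by
    obtain ⟨Ψ, hΨ⟩ := W.lift m fun c hc => hm c (by simp [hc])
    obtain ⟨Ψ', hΨ'⟩ := W'.lift m fun c hc => hm c (by simp [hc])
    have hcc : ∀ v v', (R.S.sk m).t (Ψ v) = (R.S.sk m).s (Ψ' v') := by
      intro v v'
      have hi : Function.Injective (R.S.incl m).toFun0 := fun a b hab => (R.hqn m).1 (congrArg R.q.toFun0 hab)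
      apply hi
      have h1 := (R.S.incl m).t_map (Ψ v)
      have h2 := (R.S.incl m).s_map (Ψ' v')
      rw [hΨ] at h1; rw [hΨ'] at h2
      have := hc v v'
      first | exact h1.symm.trans (this.trans h2) | exact h1.trans (this.trans h2.symm)
    refine ⟨⟨fun v => (R.S.sk m).comp (Ψ (p1 v)) (Ψ' (p2 v)) (hcc _ _),
      (R.S.sk m).cont_comp (Ψ.continuous.comp cont_p1) (Ψ'.continuous.comp cont_p2) _⟩, fun v => ?_⟩
    refine ((R.S.incl m).comp_map _ _ _ ((R.S.incl m).composable (hcc (p1 v) (p2 v)))).trans ?_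
    exact FlowHom.cong_comp _ _ (hΨ _) (hΨ' _)

theorem exists_of (w) : Nonempty (WordCell R (R.tp w)) := by
  refine R.N_ind (P := fun w => Nonempty (WordCell R (R.tp w))) ?_ ?_ w
  · intro g; rw [R.tp_letter]; exact ⟨single g.1⟩
  · rintro g w h ⟨W'⟩
    rw [R.tp_comp, R.tp_letter]
    refine ⟨mul (single g.1) W' ?_ ?_⟩
    · intro v v'
      obtain ⟨v2, -, e2⟩ := W'.surj w rfl
      rw [(single g.1).ht v g.2.1, W'.hs v' v2, e2]
      exact h
    · intro z hz
      rcases R.decomp z with ⟨g', rfl⟩ | ⟨g', w', h', rfl⟩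
      · rw [R.tp_letter] at hz
        have : g'.1 = g.1 ∧ [] = R.tp w := by simpa using hz
        exact absurd this.2.symm (tp_length_pos _)
      · rw [R.tp_comp, R.tp_letter] at hz
        have : g'.1 = g.1 ∧ R.tp w' = R.tp w := by simpa using hz
        exact ⟨_, _, h', by rw [R.tp_letter, this.1], this.2, rfl⟩

end WordCell
end PartD5

section PartD6
open Set Metric Topology
local notation "II" => unitInterval

instance ballCompact {V : Type*} [NormedAddCommGroup V] [NormedSpace ℝ V] [FiniteDimensional ℝ V] :
    CompactSpace (closedBall (0 : V) 1) :=
  haveI : ProperSpace V := FiniteDimensional.proper ℝ V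
  isCompact_iff_compactSpace.1 (isCompact_closedBall _ _)

instance sphCompact (n : ℕ) : CompactSpace (diskBoundary n) := isCompact_iff_compactSpace.1 (isCompact_sphere _ _)

namespace Repl
variable {Y : Flow} (R : Repl Y)

/-- types met by a map -/
def types {K : Type} (g : K → R.X.Path) : Set (List R.Cell) := R.tp '' Set.range g

theorem types_finite {K : Type} [TopologicalSpace K] [CompactSpace K] (g : C(K, R.X.Path)) : (R.types g).Finite :=
  R.tp_finite (isCompact_range g.continuous)

theorem exists_WC {K : Type} (g : K → R.X.Path) (ω : R.types g) : Nonempty (WordCell R ω.1) := by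
  obtain ⟨_, w, -, rfl⟩ := ω
  exact WordCell.exists_of w

theorem mem_types {K : Type} (g : K → R.X.Path) (k : K) : R.tp (g k) ∈ R.types g := ⟨g k, ⟨k, rfl⟩, rfl⟩

theorem lift_sk {n : ℕ} (g : C(diskBoundary n, R.X.Path)) (hg : ∀ k, R.δ (g k) < n) :
    ∃ G : C(diskBoundary n, (R.S.sk n).Path), ∀ x, (R.S.incl n).toFunP (G x) = g x := by
  haveI := R.t2
  haveI : Finite (R.types g) := R.types_finite g
  let W : ∀ ω : R.types g, WordCell R ω.1 := fun ω => (R.exists_WC g ω).some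
  have hd : ∀ ω : R.types g, ∀ c ∈ ω.1, c.1 < n := by
    rintro ⟨_, _, ⟨k, rfl⟩, rfl⟩ c hc
    have h1 := hg k
    rw [R.δ_tp] at h1
    exact (List.le_sum_of_mem (List.mem_map.2 ⟨c, hc, rfl⟩)).trans_lt h1
  choose Ψ hΨ using fun ω => (W ω).lift n (hd ω)
  let K := Σ ω : R.types g, closedBall (0 : (W ω).V) 1
  let p : K → R.X.Path := fun a => (W a.1).χ a.2
  have hp : Continuous p := continuous_sigma fun ω => (W ω).χ.continuous
  let ψ : K → (R.S.sk n).Path := fun a => Ψ a.1 a.2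
  have hψ : Continuous ψ := continuous_sigma fun ω => (Ψ ω).continuous
  have hψp : ∀ a, (R.S.incl n).toFunP (ψ a) = p a := fun a => hΨ a.1 a.2
  obtain ⟨f, hf⟩ := descend (fun a => (⟨p a, a, rfl⟩ : Set.range p)) (hp.subtype_mk _)
    (by rintro ⟨_, a, rfl⟩; exact ⟨a, rfl⟩) ψ hψ (fun a b h => by
      apply R.incl_inj n
      rw [hψp, hψp]; exact congrArg Subtype.val h)
  have hr : ∀ k, g k ∈ Set.range p := by
    intro k
    obtain ⟨v, -, hv⟩ := (W ⟨_, R.mem_types g k⟩).surj (g k) rfl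
    exact ⟨⟨⟨_, R.mem_types g k⟩, v⟩, hv⟩
  refine ⟨⟨fun k => f ⟨g k, hr k⟩, f.continuous.comp (g.continuous.subtype_mk _)⟩, fun k => ?_⟩
  obtain ⟨a, ha⟩ := hr k
  have e : (⟨g k, hr k⟩ : Set.range p) = ⟨p a, a, rfl⟩ := Subtype.ext ha.symm
  show (R.S.incl n).toFunP (f ⟨g k, hr k⟩) = g k
  rw [e, hf, hψp, ha]

theorem help_base {n : ℕ} (g : C(diskBoundary n, R.X.Path)) (hg : ∀ k, R.δ (g k) < n) :
    HelpAt R.q.pathMap n g := by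
  obtain ⟨G, hG⟩ := R.lift_sk g hg
  refine relHelp R.q.pathMap n g fun b1 hb1 => ?_
  have hb1' : ∀ x, b1 (diskBoundaryInclusion n x) = R.q.toFunP (g x) := hb1
  let o : closedDisk n := ⟨0, by simp⟩
  have hs : ∀ x, Y.s (b1 x) = Y.s (b1 o) := fun x =>
    WordCell.const_of_ball (fun v : closedDisk n => Y.s (b1 v)) (fun a => Y.isOpen_pre_s b1.continuous a) x o
  have ht : ∀ x, Y.t (b1 x) = Y.t (b1 o) := fun x =>
    WordCell.const_of_ball (fun v : closedDisk n => Y.t (b1 v)) (fun a => Y.isOpen_pre_t b1.continuous a) x o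
  obtain ⟨f0, hf0⟩ := (R.hqn n).2 (Y.s (b1 o))
  obtain ⟨f1, hf1⟩ := (R.hqn n).2 (Y.t (b1 o))
  have hGb : ∀ x, (R.q.comp (R.S.incl n)).toFunP (G x) = b1 (diskBoundaryInclusion n x) := fun x =>
    (congrArg R.q.toFunP (hG x)).trans (hb1' x).symm
  have hs' : ∀ x, (R.S.sk n).s (G x) = f0 := fun x => (R.hqn n).1 (by
    rw [hf0, ← hs (diskBoundaryInclusion n x), ← hGb x, FlowHom.s_map])
  have ht' : ∀ x, (R.S.sk n).t (G x) = f1 := fun x => (R.hqn n).1 (by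
    rw [hf1, ← ht (diskBoundaryInclusion n x), ← hGb x, FlowHom.t_map])
  let φ : FlowHom (Glob (diskBoundary n)) (R.S.sk n) := globHom ![f0, f1] G hs' ht'
  let ψ : FlowHom (Glob (closedDisk n)) Y := globHom ![Y.s (b1 o), Y.t (b1 o)] b1 hs ht
  have e0 : (R.q.comp (R.S.incl n)).comp φ = ψ.comp (globBoundaryInclusion n) := by
    refine FlowHom.ext ?_ (funext fun x => hGb x)
    have key : ∀ i : Fin 2, (R.q.comp (R.S.incl n)).toFun0 ((![f0, f1] : Fin 2 → _) i) =
        (![Y.s (b1 o), Y.t (b1 o)] : Fin 2 → _) i := by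
      intro i
      fin_cases i
      · exact hf0
      · exact hf1
    exact funext key
  obtain ⟨e, he1, he2⟩ := R.h4 n φ ψ e0 (fun x => by
    have := hG x
    exact (congrArg R.δ this).trans_lt (hg x))
  refine ⟨R.chi ⟨n, e⟩, ⟨fun p => b1 p.1, by fun_prop⟩, ?_, fun x _ => hb1 x, ?_, fun _ => rfl⟩
  · intro x
    refine (R.chi_bd ⟨n, e⟩ x).trans ?_
    have k := congrFun (congrArg FlowHom.toFunP he1) x
    exact (congrArg (R.S.incl n).toFunP k).trans (hG x)
  · intro x
    have k := congrFun (congrArg FlowHom.toFunP he2) x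
    exact k.symm

theorem help_lt {n d : ℕ} (hnd : n ≤ d) (IH : ∀ g : C(diskBoundary n, R.X.Path), (∀ k, R.δ (g k) < d) → HelpAt R.q.pathMap n g)
    (N : ℕ) : ∀ g : C(diskBoundary n, R.X.Path), (∀ k, R.δ (g k) < d + 1) →
      {ω ∈ R.types g | R.dimL ω = d}.ncard ≤ N → HelpAt R.q.pathMap n g := by
  haveI := R.t2
  induction N with
  | zero =>
    intro g hg hN
    have hfin : {ω ∈ R.types g | R.dimL ω = d}.Finite := (R.types_finite g).subset (Set.sep_subset _ _)
    have he := (Set.ncard_eq_zero hfin).1 (Nat.le_zero.1 hN)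
    refine IH g fun k => lt_of_le_of_ne (Nat.lt_succ_iff.1 (hg k)) fun h => ?_
    have : R.tp (g k) ∈ {ω ∈ R.types g | R.dimL ω = d} := ⟨R.mem_types g k, by rw [← R.δ_tp]; exact h⟩
    rw [he] at this; exact this
  | succ N ih =>
    intro g hg hN
    have hfin : {ω ∈ R.types g | R.dimL ω = d}.Finite := (R.types_finite g).subset (Set.sep_subset _ _)
    by_cases hne : {ω ∈ R.types g | R.dimL ω = d}.Nonempty
    swap
    · refine ih g hg ?_
      rw [Set.not_nonempty_iff_eq_empty.1 hne]; simp
    obtain ⟨ω0, hω0, hd0⟩ := hne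
    haveI : Finite (R.types g) := R.types_finite g
    let W : ∀ ω : R.types g, WordCell R ω.1 := fun ω => (R.exists_WC g ω).some
    have hdim : ∀ ω : R.types g, R.dimL ω.1 ≤ d := by
      rintro ⟨_, _, ⟨k, rfl⟩, rfl⟩
      have := hg k
      rw [R.δ_tp] at this
      exact Nat.lt_succ_iff.1 this
    let o : R.types g := ⟨ω0, hω0⟩
    let T : Set R.X.Path := ⋃ ω : {ω : R.types g // ω ≠ o}, Set.range (W ω.1).χ
    have hT : IsClosed T := isClosed_iUnion_of_finite fun ω => (isCompact_range (W ω.1).χ.continuous).isClosed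
    have hTd : ∀ z ∈ T, R.δ z ≤ d ∧ (R.δ z = d → R.tp z ∈ R.types g ∧ R.tp z ≠ ω0) := by
      intro z hz
      obtain ⟨ω, v, rfl⟩ := Set.mem_iUnion.1 hz
      refine ⟨((W ω.1).δ_le v).trans (hdim ω.1), fun h => ?_⟩
      rcases (ball_norm_le v).lt_or_eq with hv | hv
      · rw [(W ω.1).htp v hv]
        exact ⟨ω.1.2, fun h => ω.2 (Subtype.ext h)⟩
      · have h1 := (W ω.1).bd v hv
        have h2 := hdim ω.1
        omega
    obtain ⟨H, hH0, hH1⟩ := pushOff (W o).χ (W o).inj' T hT (fun v hv hvT => by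
        have h1 := (W o).htp v hv
        have h2 : R.δ ((W o).χ v) = d := by rw [R.δ_tp, h1]; exact hd0
        exact ((hTd _ hvT).2 h2).2 h1) g (fun k => by
        by_cases hk : R.tp (g k) = ω0
        · obtain ⟨v, -, hv⟩ := (W o).surj (g k) hk
          exact Or.inr ⟨v, hv⟩
        · obtain ⟨v, -, hv⟩ := (W ⟨_, R.mem_types g k⟩).surj (g k) rfl
          exact Or.inl (Set.mem_iUnion.2 ⟨⟨⟨_, R.mem_types g k⟩, fun h => hk (congrArg Subtype.val h)⟩, v, hv⟩))
      (small_sphere n _ (by rw [(W o).fr]; exact hnd.trans_eq hd0.symm))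
    let g1 : C(diskBoundary n, R.X.Path) := ⟨fun k => H (k, 1), by fun_prop⟩
    have hδ1 : ∀ k, R.δ (g1 k) ≤ d ∧ (R.δ (g1 k) = d → R.tp (g1 k) ∈ R.types g ∧ R.tp (g1 k) ≠ ω0) := by
      intro k
      rcases hH1 k with h | ⟨v, hv, e⟩
      · exact hTd _ h
      · have h1 := (W o).bd v hv
        have h2 : R.dimL o.1 = d := hd0
        have h3 : R.δ (g1 k) = R.δ ((W o).χ v) := congrArg R.δ e.symm
        constructor
        · omega
        · intro h; omega
    refine helpDrag R.q.pathMap n g g1 H hH0 (fun _ => rfl) (ih g1 (fun k => Nat.lt_succ_iff.2 (hδ1 k).1) ?_)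
    have hsub : {ω ∈ R.types g1 | R.dimL ω = d} ⊂ {ω ∈ R.types g | R.dimL ω = d} := by
      rw [Set.ssubset_iff_of_subset]
      · refine ⟨ω0, ⟨hω0, hd0⟩, ?_⟩
        rintro ⟨⟨_, ⟨k, rfl⟩, e⟩, -⟩
        exact ((hδ1 k).2 (by rw [R.δ_tp, e]; exact hd0)).2 e
      · rintro _ ⟨⟨_, ⟨k, rfl⟩, rfl⟩, h⟩
        exact ⟨((hδ1 k).2 (by rw [R.δ_tp]; exact h)).1, h⟩
    have := Set.ncard_lt_ncard hsub hfin
    omega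

theorem help_d {n : ℕ} (d : ℕ) : ∀ g : C(diskBoundary n, R.X.Path), (∀ k, R.δ (g k) < d) → HelpAt R.q.pathMap n g := by
  induction d with
  | zero => intro g hg; exact R.help_base g fun k => absurd (hg k) (Nat.not_lt_zero _)
  | succ d ih =>
    intro g hg
    by_cases h : n ≤ d
    · exact R.help_lt h ih _ g hg le_rfl
    · exact R.help_base g fun k => by have := hg k; omega

theorem weq : IsWeakHomotopyEquiv R.q.pathMap := by
  refine weq_of_help _ fun n g => ?_
  obtain ⟨d, hd⟩ := ((R.types_finite g).image R.dimL).bddAbove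
  refine R.help_d (d+1) g fun k => ?_
  rw [R.δ_tp]
  exact Nat.lt_succ_iff.2 (hd ⟨_, R.mem_types g k, rfl⟩)

end Repl

theorem exists_replacement (Y : Flow) : ∃ (X : Flow) (q : FlowHom X Y), SCofibrant X ∧ IsWeakSHomotopyEquiv q := by
  obtain ⟨R⟩ := exists_repl Y
  exact ⟨R.X, R.q, ⟨R.S⟩, R.hq, R.weq⟩

end PartD6

/-- the inclusion of the full subcategory of S-cofibrant flows into
`Flow` induces an equivalence of categories between the category of S-cofibrant
flows with morphisms up to S-homotopy and the localization of `Flow` with respect to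
the weak S-homotopy equivalences. -/
theorem sCofibrant_up_to_sHomotopy_equiv_localization :
    ∃ F : CategoryTheory.Quotient sHomotopyHomRel ⥤ weakSHomotopyEquivalences.Localization,
      CategoryTheory.Quotient.functor sHomotopyHomRel ⋙ F =
        ObjectProperty.ι SCofibrant ⋙ weakSHomotopyEquivalences.Q ∧
      F.IsEquivalence :=
  mainOfReplacement exists_replacement

end Gaucher
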